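/- Let H be a nonbipartite, edge-critical, strictly 2-balanced graph and let ε > 0 be a constant. If p = p(n) satisfies np → ∞ and p ≤ (θ_H − ε)·n^{−1/m_2(H)}·(log n)^{1/(e_H − 1)}, then with high probability (probability tending to 1 as n → ∞) the random graph G_{n,p} is not H-Simonovits; that is, whp G_{n,p} has a largest H-free subgraph that is not (χ(H)−1)-partite. -/

import Mathlib

open scoped Classical
open Filter

noncomputable section

/-- The possible edges of a graph on vertex set `Fin n`. -/
abbrev EdgeType (n : ℕ) := {e : Sym2 (Fin n) // ¬ e.IsDiag}

/-- A graph on vertex set `Fin n`, identified with its edge set. -/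
abbrev EdgeSetGraph (n : ℕ) := Finset (EdgeType n)

/-- Probability of the event `A` under the binomial random graph `G_{n,p}`. -/
def prGnp (n : ℕ) (p : ℝ) (A : EdgeSetGraph n → Prop) : ℝ :=
  ∑ G ∈ Finset.univ.filter fun G : EdgeSetGraph n => A G,
    p ^ G.card * (1 - p) ^ (n.choose 2 - G.card)

/-- The simple graph on `Fin n` associated with an edge set. -/
def toSG {n : ℕ} (G : EdgeSetGraph n) : SimpleGraph (Fin n) :=
  SimpleGraph.fromEdgeSet {s | ∃ e ∈ G, (e : Sym2 (Fin n)) = s}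

/-- `G'` contains a copy of `H` (as a subgraph). -/
def ContainsCopy {V : Type} (H : SimpleGraph V) {n : ℕ} (G' : EdgeSetGraph n) : Prop :=
  ∃ f : H →g toSG G', Function.Injective f

/-- `G'` is `H`-free. -/
def HFree {V : Type} (H : SimpleGraph V) {n : ℕ} (G' : EdgeSetGraph n) : Prop :=
  ¬ ContainsCopy H G'

/-- `G'` is `r`-partite: some partition of the vertices into `r` parts crosses all its
edges. -/
def IsRPartite {n : ℕ} (r : ℕ) (G' : EdgeSetGraph n) : Prop :=
  ∃ φ : Fin n → Fin r, ∀ e ∈ G', ¬ (Sym2.map φ (e : Sym2 (Fin n))).IsDiag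

/-- The 2-density `m₂(H) = max{(e_F - 1)/(v_F - 2) : F ⊆ H, e_F ≥ 2}` of a graph `H`. -/
def m2 {V : Type*} [Fintype V] (H : SimpleGraph V) : ℝ :=
  sSup {x : ℝ | ∃ F : H.Subgraph, 2 ≤ F.edgeSet.ncard ∧
    x = ((F.edgeSet.ncard : ℝ) - 1) / ((F.verts.ncard : ℝ) - 2)}

/-- `H` is strictly 2-balanced. -/
def StrictlyTwoBalanced {V : Type*} [Fintype V] (H : SimpleGraph V) : Prop :=
  2 ≤ H.edgeSet.ncard ∧
    m2 H = ((H.edgeSet.ncard : ℝ) - 1) / ((Fintype.card V : ℝ) - 2) ∧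
    ∀ F : H.Subgraph, 2 ≤ F.edgeSet.ncard → F ≠ ⊤ →
      ((F.edgeSet.ncard : ℝ) - 1) / ((F.verts.ncard : ℝ) - 2) < m2 H

/-- The number of copies of `H` in `G`: the number of subgraphs of `G` isomorphic to `H`. -/
def copCount {V W : Type*} (H : SimpleGraph V) (G : SimpleGraph W) : ℕ :=
  {S : G.Subgraph | Nonempty (S.coe ≃g H)}.ncard

/-- The graph `K_r(m)⁺`: the complete balanced `r`-partite graph with parts of size `m`,
with one extra edge added inside a part. -/
def KrmPlus (r m : ℕ) : SimpleGraph (Fin r × Fin m) where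
  Adj a b := a ≠ b ∧ (a.1 ≠ b.1 ∨ (a.1.val = 0 ∧ b.1.val = 0 ∧ a.2.val ≤ 1 ∧ b.2.val ≤ 1))
  symm := by
    constructor
    rintro a b ⟨h1, h2⟩
    exact ⟨h1.symm, by tauto⟩
  loopless := ⟨fun a h => h.1 rfl⟩

section ProductMeasure

variable {E : Type*} [Fintype E]

/-- The weight of a subset in the binomial random subset of `E`. -/
def wt (p : ℝ) (G : Finset E) : ℝ := p ^ G.card * (1 - p) ^ (Fintype.card E - G.card)

/-- Expectation with respect to the binomial random subset of `E`. -/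
def Ex (p : ℝ) (f : Finset E → ℝ) : ℝ := ∑ G, wt p G * f G

/-- Real-valued indicator of a proposition. -/
def ind (P : Prop) : ℝ := if P then 1 else 0

lemma ind_nonneg (P : Prop) : 0 ≤ ind P := by unfold ind; split_ifs <;> norm_num
lemma ind_le_one (P : Prop) : ind P ≤ 1 := by unfold ind; split_ifs <;> norm_num
lemma ind_of {P : Prop} (h : P) : ind P = 1 := if_pos h
lemma ind_not {P : Prop} (h : ¬ P) : ind P = 0 := if_neg h
lemma ind_mono {P Q : Prop} (h : P → Q) : ind P ≤ ind Q := by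
  by_cases hP : P
  · rw [ind_of hP, ind_of (h hP)]
  · rw [ind_not hP]; exact ind_nonneg Q
lemma ind_le_of {P : Prop} {x : ℝ} (h0 : 0 ≤ x) (h : P → 1 ≤ x) : ind P ≤ x := by
  unfold ind; split_ifs with hP
  · exact h hP
  · exact h0

lemma sum_ind {ι : Type*} (s : Finset ι) (P : ι → Prop) [DecidablePred P] :
    ∑ i ∈ s, ind (P i) = ((s.filter P).card : ℝ) := by
  unfold ind
  rw [Finset.card_filter, Nat.cast_sum]
  refine Finset.sum_congr rfl fun i _ => ?_
  split_ifs <;> simp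

variable {p : ℝ}

lemma wt_nonneg (h0 : 0 ≤ p) (h1 : p ≤ 1) (G : Finset E) : 0 ≤ wt p G :=
  mul_nonneg (pow_nonneg h0 _) (pow_nonneg (sub_nonneg.2 h1) _)

lemma Ex_const (c : ℝ) : Ex (E := E) p (fun _ => c) = c := by
  unfold Ex wt
  rw [← Finset.sum_mul]
  have := Fintype.sum_pow_mul_eq_add_pow E p (1 - p)
  rw [this]; simp

lemma Ex_add (f g : Finset E → ℝ) : Ex p (fun G => f G + g G) = Ex p f + Ex p g := by
  simp [Ex, mul_add, Finset.sum_add_distrib]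

lemma Ex_sub (f g : Finset E → ℝ) : Ex p (fun G => f G - g G) = Ex p f - Ex p g := by
  simp [Ex, mul_sub, Finset.sum_sub_distrib]

lemma Ex_mul_left (c : ℝ) (f : Finset E → ℝ) : Ex p (fun G => c * f G) = c * Ex p f := by
  simp only [Ex, Finset.mul_sum]
  exact Finset.sum_congr rfl fun _ _ => by ring

lemma Ex_mul_right (c : ℝ) (f : Finset E → ℝ) : Ex p (fun G => f G * c) = Ex p f * c := by
  simp only [Ex, Finset.sum_mul]
  exact Finset.sum_congr rfl fun _ _ => by ring

lemma Ex_sum {ι : Type*} (s : Finset ι) (f : ι → Finset E → ℝ) :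
    Ex p (fun G => ∑ i ∈ s, f i G) = ∑ i ∈ s, Ex p (f i) := by
  simp only [Ex, Finset.mul_sum]
  exact Finset.sum_comm

lemma Ex_mono (h0 : 0 ≤ p) (h1 : p ≤ 1) {f g : Finset E → ℝ} (h : ∀ G, f G ≤ g G) :
    Ex p f ≤ Ex p g :=
  Finset.sum_le_sum fun G _ => mul_le_mul_of_nonneg_left (h G) (wt_nonneg h0 h1 G)

lemma Ex_nonneg (h0 : 0 ≤ p) (h1 : p ≤ 1) {f : Finset E → ℝ} (h : ∀ G, 0 ≤ f G) :
    0 ≤ Ex p f :=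
  Finset.sum_nonneg fun G _ => mul_nonneg (wt_nonneg h0 h1 G) (h G)

/-- Union bound. -/
lemma Ex_ind_exists_le (h0 : 0 ≤ p) (h1 : p ≤ 1) {ι : Type*} (s : Finset ι)
    (P : ι → Finset E → Prop) :
    Ex p (fun G => ind (∃ i ∈ s, P i G)) ≤ ∑ i ∈ s, Ex p (fun G => ind (P i G)) := by
  rw [← Ex_sum]
  refine Ex_mono h0 h1 fun G => ind_le_of (Finset.sum_nonneg fun i _ => ind_nonneg _) ?_
  rintro ⟨i, hi, hP⟩
  calc (1 : ℝ) = ind (P i G) := (ind_of hP).symm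
    _ ≤ _ := Finset.single_le_sum (f := fun i => ind (P i G)) (fun i _ => ind_nonneg _) hi

/-- Markov's inequality. -/
lemma Ex_markov (h0 : 0 ≤ p) (h1 : p ≤ 1) {f : Finset E → ℝ} (hf : ∀ G, 0 ≤ f G)
    {t : ℝ} (ht : 0 < t) :
    Ex p (fun G => ind (t ≤ f G)) ≤ Ex p f / t := by
  rw [div_eq_mul_inv, ← Ex_mul_right]
  refine Ex_mono h0 h1 fun G => ind_le_of (mul_nonneg (hf G) (inv_nonneg.2 ht.le)) fun h => ?_
  rw [← div_eq_mul_inv, one_le_div ht]; exact h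

lemma Ex_split (e : E) (f : Finset E → ℝ) :
    Ex p f = p * Ex p (fun G => f (insert e G)) + (1 - p) * Ex p (fun G => f (G.erase e)) := by
  have key : ∀ g : Finset E → ℝ, Ex p g = ∑ G ∈ (Finset.univ.erase e).powerset,
      p ^ G.card * (1 - p) ^ (Fintype.card E - 1 - G.card) *
        ((1 - p) * g G + p * g (insert e G)) := by
    intro g
    unfold Ex
    have : (Finset.univ : Finset (Finset E)) = (insert e (Finset.univ.erase e)).powerset := by
      rw [Finset.insert_erase (Finset.mem_univ e)]; simp
    rw [this, Finset.sum_powerset_insert (Finset.notMem_erase e _), ← Finset.sum_add_distrib]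
    refine Finset.sum_congr rfl fun G hG => ?_
    have heG : e ∉ G := fun h => Finset.notMem_erase e _ (Finset.mem_powerset.1 hG h)
    have hc : G.card + 1 ≤ Fintype.card E := by
      rw [← Finset.card_insert_of_notMem heG]; exact Finset.card_le_univ _
    unfold wt
    rw [Finset.card_insert_of_notMem heG]
    obtain ⟨k, hk⟩ := Nat.exists_eq_add_of_le hc
    have e1 : Fintype.card E - G.card = k + 1 := by omega
    have e2 : Fintype.card E - 1 - G.card = k := by omega
    have e3 : Fintype.card E - (G.card + 1) = k := by omega
    rw [e1, e2, e3]; ring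
  rw [key f, key (fun G => f (insert e G)), key (fun G => f (G.erase e)), Finset.mul_sum,
    Finset.mul_sum, ← Finset.sum_add_distrib]
  refine Finset.sum_congr rfl fun G hG => ?_
  have heG : e ∉ G := fun h => Finset.notMem_erase e _ (Finset.mem_powerset.1 hG h)
  rw [Finset.insert_idem, Finset.erase_insert heG, Finset.erase_eq_of_notMem heG]
  ring

lemma Ex_ind_subset_mul (A : Finset E) (F : Finset E → ℝ) :
    Ex p (fun S => ind (A ⊆ S) * F S) = p ^ A.card * Ex p (fun S => F (S ∪ A)) := by
  induction A using Finset.induction_on generalizing F with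
  | empty => simp [ind]
  | insert a A ha ih =>
    rw [Ex_split a]
    have h2 : ∀ G : Finset E, ind (insert a A ⊆ G.erase a) * F (G.erase a) = 0 := by
      intro G
      rw [ind_not, zero_mul]
      intro h
      exact Finset.notMem_erase a G (h (Finset.mem_insert_self a A))
    have h1 : ∀ G : Finset E, ind (insert a A ⊆ insert a G) * F (insert a G)
        = ind (A ⊆ G) * F (insert a G) := by
      intro G
      congr 2
      rw [Finset.insert_subset_insert_iff ha]
    simp only [h1, h2, Ex_const, mul_zero, add_zero]
    rw [ih (fun G => F (insert a G)), Finset.card_insert_of_notMem ha, pow_succ]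
    simp only [Finset.union_insert]
    ring

lemma Ex_ind_subset (A : Finset E) : Ex p (fun S => ind (A ⊆ S)) = p ^ A.card := by
  have := Ex_ind_subset_mul (p := p) A (fun _ => 1)
  simpa [Ex_const] using this

lemma Ex_harris (h0 : 0 ≤ p) (h1 : p ≤ 1) {f g : Finset E → ℝ} (hf : Antitone f)
    (hg : Antitone g) (hf1 : ∀ G, f G ≤ 1) (hg1 : ∀ G, g G ≤ 1) :
    Ex p f * Ex p g ≤ Ex p (fun G => f G * g G) := by
  have h := fkg (μ := wt (E := E) p) (f := fun G => 1 - f G) (g := fun G => 1 - g G)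
    (fun G => wt_nonneg h0 h1 G) (fun G => sub_nonneg.2 (hf1 G)) (fun G => sub_nonneg.2 (hg1 G))
    (fun a b hab => sub_le_sub_left (hf hab) 1) (fun a b hab => sub_le_sub_left (hg hab) 1)
    (fun a b => by
      have hc := Finset.card_union_add_card_inter a b
      have c1 : (a ∪ b).card ≤ Fintype.card E := Finset.card_le_univ _
      have c2 : (a ∩ b).card ≤ Fintype.card E := Finset.card_le_univ _
      have c3 : a.card ≤ Fintype.card E := Finset.card_le_univ _
      have c4 : b.card ≤ Fintype.card E := Finset.card_le_univ _
      apply le_of_eq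
      simp only [wt, Finset.inf_eq_inter, Finset.sup_eq_union]
      rw [show p ^ a.card * (1 - p) ^ (Fintype.card E - a.card) *
          (p ^ b.card * (1 - p) ^ (Fintype.card E - b.card)) =
          p ^ (a.card + b.card) * (1 - p) ^ ((Fintype.card E - a.card) +
          (Fintype.card E - b.card)) by rw [pow_add, pow_add]; ring,
        show p ^ (a ∩ b).card * (1 - p) ^ (Fintype.card E - (a ∩ b).card) *
          (p ^ (a ∪ b).card * (1 - p) ^ (Fintype.card E - (a ∪ b).card)) =
          p ^ ((a ∩ b).card + (a ∪ b).card) * (1 - p) ^ ((Fintype.card E - (a ∩ b).card) +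
          (Fintype.card E - (a ∪ b).card)) by rw [pow_add, pow_add]; ring]
      congr 2 <;> omega)
  change Ex p (fun G => 1 - f G) * Ex p (fun G => 1 - g G) ≤
    (∑ a, wt p a) * Ex p (fun G => (1 - f G) * (1 - g G)) at h
  have e1 : ∑ a : Finset E, wt p a = 1 := by
    have := Ex_const (E := E) (p := p) 1
    simpa [Ex] using this
  have e2 : (fun G => (1 - f G) * (1 - g G)) = fun G => (1 - f G) - (g G - f G * g G) := by
    funext G; ring
  rw [e1, e2] at h
  simp only [Ex_sub, Ex_const] at h
  linarith

lemma one_sub_sum_le_prod {ι : Type*} (s : Finset ι) (x : ι → ℝ) (h0 : ∀ i ∈ s, 0 ≤ x i)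
    (h1 : ∀ i ∈ s, x i ≤ 1) : 1 - ∑ i ∈ s, x i ≤ ∏ i ∈ s, (1 - x i) := by
  induction s using Finset.induction_on with
  | empty => simp
  | insert a s ha ih =>
    rw [Finset.sum_insert ha, Finset.prod_insert ha]
    have i1 := ih (fun i hi => h0 i (Finset.mem_insert_of_mem hi))
      (fun i hi => h1 i (Finset.mem_insert_of_mem hi))
    have i2 := h0 a (Finset.mem_insert_self a s)
    have i3 := h1 a (Finset.mem_insert_self a s)
    have i4 : 0 ≤ ∑ i ∈ s, x i :=
      Finset.sum_nonneg fun i hi => h0 i (Finset.mem_insert_of_mem hi)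
    nlinarith [mul_nonneg i2 i4, mul_nonneg (sub_nonneg.2 i3) (sub_nonneg.2 i1)]

variable {ι : Type*}

/-- The number of indices whose set is contained in the random set. -/
def cnt (A : ι → Finset E) (I : Finset ι) (S : Finset E) : ℕ := (I.filter fun i => A i ⊆ S).card

lemma Ex_cnt (A : ι → Finset E) (I : Finset ι) :
    Ex p (fun S => (cnt A I S : ℝ)) = ∑ i ∈ I, p ^ (A i).card := by
  have : (fun S => (cnt A I S : ℝ)) = fun S => ∑ i ∈ I, ind (A i ⊆ S) := by
    funext S; rw [sum_ind]; rfl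
  rw [this, Ex_sum]
  exact Finset.sum_congr rfl fun i _ => Ex_ind_subset _

omit [Fintype E] in
lemma antitone_prod_ind (A : ι → Finset E) (J : Finset ι) (B : Finset E) {c : ℝ} (hc0 : 0 ≤ c)
    (hc1 : c ≤ 1) : Antitone fun S => ∏ j ∈ J, (1 - c * ind (A j ⊆ S ∪ B)) := by
  intro S T hST
  refine Finset.prod_le_prod (fun j _ => ?_) (fun j _ => ?_)
  · nlinarith [ind_le_one (A j ⊆ T ∪ B), ind_nonneg (A j ⊆ T ∪ B)]
  · have : ind (A j ⊆ S ∪ B) ≤ ind (A j ⊆ T ∪ B) :=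
      ind_mono fun h => h.trans (Finset.union_subset_union_left hST)
    nlinarith

omit [Fintype E] in
lemma prod_ind_mem_unit (A : ι → Finset E) (J : Finset ι) (S : Finset E) {c : ℝ} (hc0 : 0 ≤ c)
    (hc1 : c ≤ 1) : 0 ≤ ∏ j ∈ J, (1 - c * ind (A j ⊆ S)) ∧
      ∏ j ∈ J, (1 - c * ind (A j ⊆ S)) ≤ 1 := by
  have h0 : ∀ j, 0 ≤ 1 - c * ind (A j ⊆ S) := fun j => by
    nlinarith [ind_le_one (A j ⊆ S), ind_nonneg (A j ⊆ S)]
  refine ⟨Finset.prod_nonneg fun j _ => h0 j, Finset.prod_le_one (fun j _ => h0 j) fun j _ => ?_⟩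
  nlinarith [ind_le_one (A j ⊆ S), ind_nonneg (A j ⊆ S)]

/-- Janson-type bound on the Laplace transform of the count. -/
lemma Ex_prod_le (h0 : 0 ≤ p) (h1 : p ≤ 1) (A : ι → Finset E) (I : Finset ι) {c : ℝ}
    (hc0 : 0 ≤ c) (hc1 : c ≤ 1) :
    Ex p (fun S => ∏ i ∈ I, (1 - c * ind (A i ⊆ S))) ≤
      Real.exp (-c * ∑ i ∈ I, p ^ (A i).card +
        c ^ 2 * ∑ i ∈ I, ∑ j ∈ I.filter (fun j => ¬ Disjoint (A i) (A j)),
          p ^ (A i ∪ A j).card) := by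
  induction I using Finset.induction_on with
  | empty => simp [Ex_const]
  | insert i J hi ih =>
    set P := Ex p (fun S => ∏ j ∈ J, (1 - c * ind (A j ⊆ S))) with hP
    have hP0 : 0 ≤ P := Ex_nonneg h0 h1 fun S => (prod_ind_mem_unit A J S hc0 hc1).1
    set D := ∑ j ∈ J.filter (fun j => ¬ Disjoint (A i) (A j)), p ^ (A i ∪ A j).card with hD
    set J1 := J.filter (fun j => ¬ Disjoint (A i) (A j)) with hJ1
    set J2 := J.filter (fun j => ¬ ¬ Disjoint (A i) (A j)) with hJ2
    have step : (p ^ (A i).card - c * D) * P ≤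
        Ex p (fun S => ind (A i ⊆ S) * ∏ j ∈ J, (1 - c * ind (A j ⊆ S))) := by
      have hRn : 0 ≤ Ex p (fun S => ind (A i ⊆ S) * ∏ j ∈ J, (1 - c * ind (A j ⊆ S))) :=
        Ex_nonneg h0 h1 fun S => mul_nonneg (ind_nonneg _) (prod_ind_mem_unit A J S hc0 hc1).1
      by_cases hneg : p ^ (A i).card - c * D < 0
      · exact (mul_nonpos_of_nonpos_of_nonneg hneg.le hP0).trans hRn
      push Not at hneg
      rw [Ex_ind_subset_mul]
      have hsplit : ∀ S : Finset E, ∏ j ∈ J, (1 - c * ind (A j ⊆ S ∪ A i)) =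
          (∏ j ∈ J1, (1 - c * ind (A j ⊆ S ∪ A i))) * ∏ j ∈ J2, (1 - c * ind (A j ⊆ S)) := by
        intro S
        rw [← Finset.prod_filter_mul_prod_filter_not J (fun j => ¬ Disjoint (A i) (A j))]
        congr 1
        refine Finset.prod_congr rfl fun j hj => ?_
        have hd : Disjoint (A j) (A i) := by
          have := (Finset.mem_filter.1 hj).2
          rw [not_not] at this
          exact this.symm
        congr 3
        rw [eq_iff_iff]
        exact ⟨fun h x hx => (Finset.mem_union.1 (h hx)).resolve_right
          (Finset.disjoint_left.1 hd hx), fun h => h.trans Finset.subset_union_left⟩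
      simp only [hsplit]
      have har := Ex_harris h0 h1
        (f := fun S => ∏ j ∈ J1, (1 - c * ind (A j ⊆ S ∪ A i)))
        (g := fun S => ∏ j ∈ J2, (1 - c * ind (A j ⊆ S)))
        (antitone_prod_ind A J1 (A i) hc0 hc1)
        (by simpa using antitone_prod_ind A J2 ∅ hc0 hc1)
        (fun S => (prod_ind_mem_unit A J1 _ hc0 hc1).2)
        (fun S => (prod_ind_mem_unit A J2 _ hc0 hc1).2)
      have hg : P ≤ Ex p (fun S => ∏ j ∈ J2, (1 - c * ind (A j ⊆ S))) := by
        refine Ex_mono h0 h1 fun S => ?_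
        rw [← Finset.prod_filter_mul_prod_filter_not J (fun j => ¬ Disjoint (A i) (A j))]
        exact mul_le_of_le_one_left (prod_ind_mem_unit A J2 S hc0 hc1).1
          (prod_ind_mem_unit A J1 S hc0 hc1).2
      have hf : p ^ (A i).card - c * D ≤ p ^ (A i).card *
          Ex p (fun S => ∏ j ∈ J1, (1 - c * ind (A j ⊆ S ∪ A i))) := by
        have l1 : Ex p (fun S => 1 - ∑ j ∈ J1, c * ind (A j ⊆ S ∪ A i)) ≤
            Ex p (fun S => ∏ j ∈ J1, (1 - c * ind (A j ⊆ S ∪ A i))) := by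
          refine Ex_mono h0 h1 fun S => one_sub_sum_le_prod _ _ (fun j _ => ?_) (fun j _ => ?_)
          · exact mul_nonneg hc0 (ind_nonneg _)
          · nlinarith [ind_le_one (A j ⊆ S ∪ A i), ind_nonneg (A j ⊆ S ∪ A i)]
        rw [Ex_sub, Ex_const, Ex_sum] at l1
        have l2 : p ^ (A i).card * ∑ j ∈ J1, Ex p (fun S => c * ind (A j ⊆ S ∪ A i)) = c * D := by
          rw [hD, Finset.mul_sum, Finset.mul_sum]
          refine Finset.sum_congr rfl fun j _ => ?_
          rw [Ex_mul_left]
          have := Ex_ind_subset_mul (p := p) (A i) (fun S => ind (A j ⊆ S))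
          rw [mul_left_comm, ← this, ← Ex_ind_subset (p := p) (A i ∪ A j)]
          congr 2
          funext S
          unfold ind
          simp only [Finset.union_subset_iff]
          split_ifs <;> simp_all
        nlinarith [pow_nonneg h0 (A i).card]
      have hpp := pow_nonneg h0 (A i).card
      calc _ ≤ (p ^ (A i).card * Ex p (fun S => ∏ j ∈ J1, (1 - c * ind (A j ⊆ S ∪ A i)))) * P :=
            mul_le_mul_of_nonneg_right hf hP0
        _ ≤ (p ^ (A i).card * Ex p (fun S => ∏ j ∈ J1, (1 - c * ind (A j ⊆ S ∪ A i)))) *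
            Ex p (fun S => ∏ j ∈ J2, (1 - c * ind (A j ⊆ S))) :=
            mul_le_mul_of_nonneg_left hg (hneg.trans hf)
        _ ≤ _ := by rw [mul_assoc]; exact mul_le_mul_of_nonneg_left har hpp
    have e1 : Ex p (fun S => ∏ j ∈ insert i J, (1 - c * ind (A j ⊆ S))) =
        P - c * Ex p (fun S => ind (A i ⊆ S) * ∏ j ∈ J, (1 - c * ind (A j ⊆ S))) := by
      rw [hP, ← Ex_mul_left, ← Ex_sub]
      congr 1; funext S
      rw [Finset.prod_insert hi]; ring
    have hle : P - c * Ex p (fun S => ind (A i ⊆ S) * ∏ j ∈ J, (1 - c * ind (A j ⊆ S))) ≤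
        P * (1 + (-c * p ^ (A i).card + c ^ 2 * D)) := by nlinarith
    rw [e1]
    refine hle.trans ?_
    have hexp : 1 + (-c * p ^ (A i).card + c ^ 2 * D) ≤
        Real.exp (-c * p ^ (A i).card + c ^ 2 * D) := by
      rw [add_comm]; exact Real.add_one_le_exp _
    refine (mul_le_mul_of_nonneg_left hexp hP0).trans ?_
    refine (mul_le_mul_of_nonneg_right ih (Real.exp_pos _).le).trans ?_
    rw [← Real.exp_add]
    refine Real.exp_le_exp.2 ?_
    rw [Finset.sum_insert hi, Finset.sum_insert hi]
    have hpn : ∀ k, 0 ≤ p ^ k := fun k => pow_nonneg h0 k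
    have m1 : D ≤ ∑ j ∈ (insert i J).filter (fun j => ¬ Disjoint (A i) (A j)),
        p ^ (A i ∪ A j).card :=
      Finset.sum_le_sum_of_subset_of_nonneg
        (Finset.filter_subset_filter _ (Finset.subset_insert i J)) fun _ _ _ => hpn _
    have m2 : ∑ k ∈ J, ∑ j ∈ J.filter (fun j => ¬ Disjoint (A k) (A j)), p ^ (A k ∪ A j).card ≤
        ∑ k ∈ J, ∑ j ∈ (insert i J).filter (fun j => ¬ Disjoint (A k) (A j)),
          p ^ (A k ∪ A j).card :=
      Finset.sum_le_sum fun k _ => Finset.sum_le_sum_of_subset_of_nonneg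
        (Finset.filter_subset_filter _ (Finset.subset_insert i J)) fun _ _ _ => hpn _
    nlinarith [sq_nonneg c]

lemma exp_neg_le_one_sub {c : ℝ} (h0 : 0 ≤ c) (h1 : c ≤ 1 / 2) :
    Real.exp (-(c + c ^ 2)) ≤ 1 - c := by
  have hq := Real.quadratic_le_exp_of_nonneg (x := c + c ^ 2) (by positivity)
  have h3 : (1 : ℝ) ≤ Real.exp (c + c ^ 2) * (1 - c) := by
    have : (1 : ℝ) ≤ (1 + (c + c ^ 2) + (c + c ^ 2) ^ 2 / 2) * (1 - c) := by
      have : 0 ≤ c ^ 2 * (1 - c - c ^ 2 - c ^ 3) := by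
        apply mul_nonneg (sq_nonneg c)
        nlinarith [mul_nonneg h0 h0, mul_nonneg (mul_nonneg h0 h0) h0]
      nlinarith
    exact this.trans (mul_le_mul_of_nonneg_right hq (by linarith))
  rw [Real.exp_neg, inv_le_iff_one_le_mul₀ (Real.exp_pos _)]
  linarith

/-- Janson's lower tail inequality. -/
lemma Ex_lower_tail (h0 : 0 ≤ p) (h1 : p ≤ 1) (A : ι → Finset E) (I : Finset ι) {B t : ℝ}
    (ht : 0 < t) (hμ : ∑ i ∈ I, p ^ (A i).card ≤ B)
    (hΔ : ∑ i ∈ I, ∑ j ∈ I.filter (fun j => ¬ Disjoint (A i) (A j)), p ^ (A i ∪ A j).card ≤ B) :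
    Ex p (fun S => ind ((cnt A I S : ℝ) ≤ ∑ i ∈ I, p ^ (A i).card - t)) ≤
      Real.exp (-(t ^ 2 / (8 * B))) := by
  set μ := ∑ i ∈ I, p ^ (A i).card with hμd
  by_cases htμ : μ < t
  · have : (fun S : Finset E => ind ((cnt A I S : ℝ) ≤ μ - t)) = fun _ => 0 := by
      funext S
      refine ind_not ?_
      have : (0 : ℝ) ≤ cnt A I S := Nat.cast_nonneg _
      linarith
    rw [this, Ex_const]; exact (Real.exp_pos _).le
  push Not at htμ
  have hB : 0 < B := by linarith
  set c := t / (4 * B) with hc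
  have hc0 : 0 ≤ c := by positivity
  have hc1 : c ≤ 1 / 2 := by
    rw [hc, div_le_iff₀ (by positivity)]; linarith
  have hprod : ∀ S : Finset E, ∏ i ∈ I, (1 - c * ind (A i ⊆ S)) = (1 - c) ^ cnt A I S := by
    intro S
    unfold cnt
    rw [← Finset.prod_const, Finset.prod_filter]
    refine Finset.prod_congr rfl fun i _ => ?_
    unfold ind; split_ifs <;> simp
  have key := Ex_prod_le h0 h1 A I hc0 (by linarith : c ≤ 1)
  have hpt : ∀ S : Finset E, ind ((cnt A I S : ℝ) ≤ μ - t) ≤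
      (∏ i ∈ I, (1 - c * ind (A i ⊆ S))) * Real.exp ((c + c ^ 2) * (μ - t)) := by
    intro S
    rw [hprod]
    refine ind_le_of (mul_nonneg (pow_nonneg (by linarith) _) (Real.exp_pos _).le) fun h => ?_
    have := pow_le_pow_left₀ (Real.exp_pos _).le (exp_neg_le_one_sub hc0 hc1) (cnt A I S)
    rw [← Real.exp_nat_mul] at this
    refine le_trans ?_ (mul_le_mul_of_nonneg_right this (Real.exp_pos _).le)
    rw [← Real.exp_add, Real.one_le_exp_iff]
    nlinarith [sq_nonneg c]
  refine (Ex_mono h0 h1 hpt).trans ?_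
  rw [Ex_mul_right]
  refine (mul_le_mul_of_nonneg_right key (Real.exp_pos _).le).trans ?_
  rw [← Real.exp_add]
  refine Real.exp_le_exp.2 ?_
  have e2 : t ^ 2 / (8 * B) = c * t - 2 * c ^ 2 * B := by
    rw [hc]; field_simp; ring
  rw [e2]
  nlinarith [sq_nonneg c, mul_nonneg (sq_nonneg c) ht.le,
    mul_le_mul_of_nonneg_left hΔ (sq_nonneg c),
    mul_le_mul_of_nonneg_left hμ (sq_nonneg c)]

end ProductMeasure

section UniformCounts

variable {E ι : Type*} [Fintype E] {p : ℝ}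

omit [Fintype E] in
lemma cnt_filter_add (A : ι → Finset E) (I : Finset ι) (Q : ι → Prop) (S : Finset E) :
    cnt A (I.filter Q) S + cnt A (I.filter fun i => ¬ Q i) S = cnt A I S := by
  unfold cnt
  rw [Finset.filter_comm Q, Finset.filter_comm (fun i => ¬ Q i)]
  exact Finset.card_filter_add_card_filter_not _

/-- Lower tail for subfamilies with the variance proxy of a larger family. -/
lemma Ex_lower_tail_filter (h0 : 0 ≤ p) (h1 : p ≤ 1) (A : ι → Finset E) (I : Finset ι)
    (Q : ι → Prop) [DecidablePred Q] {B t : ℝ} (ht : 0 < t) (hμ : ∑ i ∈ I, p ^ (A i).card ≤ B)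
    (hΔ : ∑ i ∈ I, ∑ j ∈ I.filter (fun j => ¬ Disjoint (A i) (A j)), p ^ (A i ∪ A j).card ≤ B) :
    Ex p (fun S => ind ((cnt A (I.filter Q) S : ℝ) ≤ ∑ i ∈ I.filter Q, p ^ (A i).card - t)) ≤
      Real.exp (-(t ^ 2 / (8 * B))) := by
  refine Ex_lower_tail h0 h1 A _ ht ?_ ?_
  · exact (Finset.sum_le_sum_of_subset_of_nonneg (Finset.filter_subset _ _)
      fun _ _ _ => pow_nonneg h0 _).trans hμ
  · refine le_trans ?_ hΔ
    refine (Finset.sum_le_sum_of_subset_of_nonneg (Finset.filter_subset _ _)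
      fun _ _ _ => Finset.sum_nonneg fun _ _ => pow_nonneg h0 _).trans ?_
    exact Finset.sum_le_sum fun i _ => Finset.sum_le_sum_of_subset_of_nonneg
      (Finset.filter_subset_filter _ (Finset.filter_subset _ _)) fun _ _ _ => pow_nonneg h0 _

/-- Upper tail for the total count, deduced from the lower tail and Markov's inequality. -/
lemma Ex_total_upper (h0 : 0 ≤ p) (h1 : p ≤ 1) (A : ι → Finset E) (I : Finset ι) {B t t' : ℝ}
    (ht : 0 < t) (ht' : 0 < t') (hμ : ∑ i ∈ I, p ^ (A i).card ≤ B)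
    (hΔ : ∑ i ∈ I, ∑ j ∈ I.filter (fun j => ¬ Disjoint (A i) (A j)), p ^ (A i ∪ A j).card ≤ B) :
    Ex p (fun S => ind (∑ i ∈ I, p ^ (A i).card + t ≤ (cnt A I S : ℝ))) ≤
      (t' + B * Real.exp (-(t' ^ 2 / (8 * B)))) / t := by
  set μ := ∑ i ∈ I, p ^ (A i).card with hμd
  have hμ0 : 0 ≤ μ := Finset.sum_nonneg fun _ _ => pow_nonneg h0 _
  have htail := Ex_lower_tail h0 h1 A I ht' hμ hΔ
  rw [le_div_iff₀ ht, ← Ex_mul_right]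
  have hpt : ∀ S : Finset E, ind (μ + t ≤ (cnt A I S : ℝ)) * t ≤
      (cnt A I S : ℝ) - (μ - t') + μ * ind ((cnt A I S : ℝ) ≤ μ - t') := by
    intro S
    have hc : (0 : ℝ) ≤ cnt A I S := Nat.cast_nonneg _
    by_cases ha : μ + t ≤ (cnt A I S : ℝ)
    · rw [ind_of ha]
      nlinarith [mul_nonneg hμ0 (ind_nonneg ((cnt A I S : ℝ) ≤ μ - t'))]
    · rw [ind_not ha, zero_mul]
      by_cases hb : (cnt A I S : ℝ) ≤ μ - t'
      · rw [ind_of hb]; linarith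
      · rw [ind_not hb]; push Not at hb; linarith
  refine (Ex_mono h0 h1 hpt).trans ?_
  rw [Ex_add, Ex_sub, Ex_mul_left, Ex_cnt, Ex_const, ← hμd]
  have := mul_le_mul hμ htail (Ex_nonneg h0 h1 fun _ => ind_nonneg _) (hμ0.trans hμ)
  linarith

/-- Uniform upper bound for the counts of a parametrised collection of subfamilies. -/
lemma Ex_uniform_upper (h0 : 0 ≤ p) (h1 : p ≤ 1) (A : ι → Finset E) (I : Finset ι)
    {Θ : Type*} [Fintype Θ] (Q : Θ → ι → Prop) {B t t' : ℝ}
    (ht : 0 < t) (ht' : 0 < t') (hμ : ∑ i ∈ I, p ^ (A i).card ≤ B)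
    (hΔ : ∑ i ∈ I, ∑ j ∈ I.filter (fun j => ¬ Disjoint (A i) (A j)), p ^ (A i ∪ A j).card ≤ B) :
    Ex p (fun S => ind (∃ θ, ∑ i ∈ I.filter (Q θ), p ^ (A i).card + 2 * t ≤
        (cnt A (I.filter (Q θ)) S : ℝ))) ≤
      (t' + B * Real.exp (-(t' ^ 2 / (8 * B)))) / t +
        Fintype.card Θ * Real.exp (-(t ^ 2 / (8 * B))) := by
  have hpt : ∀ S : Finset E, ind (∃ θ, ∑ i ∈ I.filter (Q θ), p ^ (A i).card + 2 * t ≤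
        (cnt A (I.filter (Q θ)) S : ℝ)) ≤ ind (∑ i ∈ I, p ^ (A i).card + t ≤ (cnt A I S : ℝ)) +
        ind (∃ θ ∈ (Finset.univ : Finset Θ), (cnt A (I.filter fun i => ¬ Q θ i) S : ℝ) ≤
          ∑ i ∈ I.filter (fun i => ¬ Q θ i), p ^ (A i).card - t) := by
    intro S
    refine ind_le_of (add_nonneg (ind_nonneg _) (ind_nonneg _)) ?_
    rintro ⟨θ, hθ⟩
    by_cases ha : ∑ i ∈ I, p ^ (A i).card + t ≤ (cnt A I S : ℝ)
    · rw [ind_of ha]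
      linarith [ind_nonneg (∃ θ ∈ (Finset.univ : Finset Θ),
        (cnt A (I.filter fun i => ¬ Q θ i) S : ℝ) ≤
          ∑ i ∈ I.filter (fun i => ¬ Q θ i), p ^ (A i).card - t)]
    · rw [ind_not ha, ind_of, zero_add]
      refine ⟨θ, Finset.mem_univ _, ?_⟩
      have e1 := Finset.sum_filter_add_sum_filter_not I (Q θ) (fun i => p ^ (A i).card)
      have e2 : (cnt A (I.filter (Q θ)) S : ℝ) + cnt A (I.filter fun i => ¬ Q θ i) S
          = cnt A I S := by exact_mod_cast cnt_filter_add A I (Q θ) S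
      push Not at ha
      linarith
  refine (Ex_mono h0 h1 hpt).trans ?_
  rw [Ex_add]
  refine add_le_add (Ex_total_upper h0 h1 A I ht ht' hμ hΔ) ?_
  refine (Ex_ind_exists_le h0 h1 _ _).trans ?_
  refine (Finset.sum_le_sum fun θ _ =>
    Ex_lower_tail_filter h0 h1 A I (fun i => ¬ Q θ i) ht hμ hΔ).trans ?_
  rw [Finset.sum_const, nsmul_eq_mul, Finset.card_univ]

/-- Lower tail for the number of elements of the random set in a fixed set. -/
lemma Ex_inter_lower_tail (h0 : 0 ≤ p) (h1 : p ≤ 1) (D : Finset E) {B t : ℝ} (ht : 0 < t)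
    (hB : p * D.card ≤ B) :
    Ex p (fun S => ind (((D ∩ S).card : ℝ) ≤ p * D.card - t)) ≤
      Real.exp (-(t ^ 2 / (8 * B))) := by
  have hμ : ∑ i ∈ D, p ^ ({i} : Finset E).card = p * D.card := by
    simp [mul_comm]
  have := Ex_lower_tail h0 h1 (fun e : E => ({e} : Finset E)) D (B := B) ht (by rwa [hμ]) (by
    refine le_trans (le_of_eq ?_) hB
    rw [← hμ]
    refine Finset.sum_congr rfl fun i hi => ?_
    have : D.filter (fun j => ¬ Disjoint ({i} : Finset E) {j}) = {i} := by
      ext j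
      simp only [Finset.mem_filter, Finset.disjoint_singleton, not_not, Finset.mem_singleton]
      constructor
      · rintro ⟨_, rfl⟩; rfl
      · rintro rfl; exact ⟨hi, rfl⟩
    rw [this]; simp)
  rw [hμ] at this
  refine le_trans (le_of_eq ?_) this
  congr 1; funext S
  congr 3
  simp only [cnt, Finset.singleton_subset_iff]
  rw [Finset.filter_mem_eq_inter]

end UniformCounts

section Embeddings

variable {V : Type*} [Fintype V] {n : ℕ}

/-- The image of a set of pairs under an embedding into `Fin n`, as a set of edges. -/
def im (D : Finset (Sym2 V)) (ψ : V ↪ Fin n) : EdgeSetGraph n :=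
  Finset.univ.filter fun e => ∃ d ∈ D, Sym2.map ψ d = e.1

omit [Fintype V] in
lemma mem_im {D : Finset (Sym2 V)} {ψ : V ↪ Fin n} {e : EdgeType n} :
    e ∈ im D ψ ↔ ∃ d ∈ D, Sym2.map ψ d = e.1 := by simp [im]

omit [Fintype V] in
lemma not_isDiag_map (ψ : V ↪ Fin n) {d : Sym2 V} (hd : ¬ d.IsDiag) :
    ¬ (Sym2.map ψ d).IsDiag := by
  rwa [Sym2.isDiag_map ψ.injective]

omit [Fintype V] in
lemma card_im {D : Finset (Sym2 V)} (hD : ∀ d ∈ D, ¬ d.IsDiag) (ψ : V ↪ Fin n) :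
    (im D ψ).card = D.card := by
  symm
  refine Finset.card_bij (fun d hd => ⟨Sym2.map ψ d, not_isDiag_map ψ (hD d hd)⟩) ?_ ?_ ?_
  · intro d hd; exact mem_im.2 ⟨d, hd, rfl⟩
  · intro d hd d' hd' h
    exact Sym2.map.injective ψ.injective (Subtype.ext_iff.1 h)
  · rintro e he
    obtain ⟨d, hd, h⟩ := mem_im.1 he
    exact ⟨d, hd, Subtype.ext h⟩

/-- Vertices covered by a set of pairs. -/
def cov (F : Finset (Sym2 V)) : Finset V := Finset.univ.filter fun w => ∃ d ∈ F, w ∈ d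

/-- The pairs of `D` whose image under `ψ'` is an edge of the image of `ψ`. -/
def shared (D : Finset (Sym2 V)) (ψ ψ' : V ↪ Fin n) : Finset (Sym2 V) :=
  D.filter fun d => ∃ e ∈ im D ψ, Sym2.map ψ' d = e.1

omit [Fintype V] in
lemma card_im_sdiff {D : Finset (Sym2 V)} (hD : ∀ d ∈ D, ¬ d.IsDiag) (ψ ψ' : V ↪ Fin n) :
    (im D ψ' \ im D ψ).card = D.card - (shared D ψ ψ').card := by
  have : im D ψ' \ im D ψ = im (D \ shared D ψ ψ') ψ' := by
    ext e
    simp only [Finset.mem_sdiff, mem_im, shared, Finset.mem_filter]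
    constructor
    · rintro ⟨⟨d, hd, h⟩, h2⟩
      refine ⟨d, ⟨hd, ?_⟩, h⟩
      rintro ⟨_, e', ⟨d', hd', h3⟩, h4⟩
      exact h2 ⟨d', hd', by rw [h3, ← h4, h]⟩
    · rintro ⟨d, ⟨hd, h1⟩, h⟩
      refine ⟨⟨d, hd, h⟩, ?_⟩
      rintro ⟨d', hd', h3⟩
      exact h1 ⟨hd, e, ⟨d', hd', h3⟩, h⟩
  rw [this, card_im fun d hd => hD d (Finset.mem_sdiff.1 hd).1,
    Finset.card_sdiff_of_subset (show shared D ψ ψ' ⊆ D from Finset.filter_subset _ _)]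

lemma card_shared_le (F D : Finset (Sym2 V)) (ψ : V ↪ Fin n) :
    ((Finset.univ.filter fun ψ' : V ↪ Fin n => shared D ψ ψ' = F).card : ℝ) ≤
      (Fintype.card V : ℝ) ^ Fintype.card V * (n : ℝ) ^ (Fintype.card V - (cov F).card) := by
  set S : V → Finset (Fin n) := fun w =>
    if w ∈ cov F then Finset.univ.map ψ else Finset.univ with hS
  have h1 : (Finset.univ.filter fun ψ' : V ↪ Fin n => shared D ψ ψ' = F).card ≤
      (Fintype.piFinset S).card := by
    refine Finset.card_le_card_of_injOn (fun ψ' => (ψ' : V → Fin n)) ?_ ?_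
    · intro ψ' hψ'
      have hF : shared D ψ ψ' = F := (Finset.mem_filter.1 hψ').2
      simp only [Finset.mem_coe, Fintype.mem_piFinset]
      intro w
      by_cases hw : w ∈ cov F
      · simp only [hS, hw, if_true]
        obtain ⟨d, hd, hwd⟩ := (Finset.mem_filter.1 hw).2
        rw [← hF] at hd
        obtain ⟨_, e, he, h⟩ := Finset.mem_filter.1 hd
        obtain ⟨d0, _, h0⟩ := mem_im.1 he
        have : ψ' w ∈ Sym2.map ψ d0 := by
          rw [h0, ← h]; exact Sym2.mem_map.2 ⟨w, hwd, rfl⟩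
        obtain ⟨x, _, hx⟩ := Sym2.mem_map.1 this
        exact Finset.mem_map.2 ⟨x, Finset.mem_univ _, hx⟩
      · simp only [hS, hw, if_false, Finset.mem_univ]
    · intro a _ b _ h
      exact DFunLike.coe_injective h
  have h2 : ((Fintype.piFinset S).card : ℝ) =
      (Fintype.card V : ℝ) ^ (cov F).card * (n : ℝ) ^ (Fintype.card V - (cov F).card) := by
    rw [Fintype.card_piFinset]
    have : ∀ w, (S w).card = if w ∈ cov F then Fintype.card V else n := by
      intro w
      by_cases hw : w ∈ cov F
      · simp [hS, hw]
      · simp [hS, hw]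
    simp only [this, Finset.prod_ite, Finset.prod_const]
    have e1 : (Finset.univ.filter fun w => w ∈ cov F) = cov F := by ext; simp
    have e2 : (Finset.univ.filter fun w => w ∉ cov F).card = Fintype.card V - (cov F).card := by
      rw [← Finset.card_compl]; congr 1; ext; simp
    rw [e1, e2]; push_cast; ring
  refine (Nat.cast_le.2 h1).trans ?_
  rw [h2]
  rcases Nat.eq_zero_or_pos (Fintype.card V) with hV | hV
  · have : (cov F).card = 0 := by
      have := Finset.card_le_univ (cov F); omega
    simp [hV, this]
  · have h3 : (1 : ℝ) ≤ Fintype.card V := by exact_mod_cast hV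
    gcongr
    exact Finset.card_le_univ _

/-- Sum over embeddings whose shared part with a fixed embedding lies in a given collection. -/
lemma pair_sum_le {p : ℝ} (h0 : 0 ≤ p) {D : Finset (Sym2 V)} (hD : ∀ d ∈ D, ¬ d.IsDiag)
    (ψ : V ↪ Fin n) (𝓢 : Finset (Sym2 V) → Prop) {B : ℝ}
    (hB : ∀ F ⊆ D, 𝓢 F →
      (n : ℝ) ^ (Fintype.card V - (cov F).card) * p ^ (D.card - F.card) ≤ B) (hB0 : 0 ≤ B) :
    ∑ ψ' ∈ Finset.univ.filter (fun ψ' : V ↪ Fin n => 𝓢 (shared D ψ ψ')),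
      p ^ (im D ψ' \ im D ψ).card ≤
      2 ^ D.card * (Fintype.card V : ℝ) ^ Fintype.card V * B := by
  have hmaps : ∀ ψ' ∈ Finset.univ.filter (fun ψ' : V ↪ Fin n => 𝓢 (shared D ψ ψ')),
      shared D ψ ψ' ∈ D.powerset.filter 𝓢 := by
    intro ψ' h
    exact Finset.mem_filter.2 ⟨Finset.mem_powerset.2 (Finset.filter_subset _ _),
      (Finset.mem_filter.1 h).2⟩
  rw [← Finset.sum_fiberwise_of_maps_to hmaps]
  have hb : ∀ F ∈ D.powerset.filter 𝓢, ∑ ψ' ∈ (Finset.univ.filter (fun ψ' : V ↪ Fin n =>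
      𝓢 (shared D ψ ψ'))).filter (fun ψ' => shared D ψ ψ' = F), p ^ (im D ψ' \ im D ψ).card ≤
      (Fintype.card V : ℝ) ^ Fintype.card V * B := by
    intro F hF
    obtain ⟨hFD, hFS⟩ := Finset.mem_filter.1 hF
    calc _ = ∑ ψ' ∈ (Finset.univ.filter (fun ψ' : V ↪ Fin n =>
          𝓢 (shared D ψ ψ'))).filter (fun ψ' => shared D ψ ψ' = F), p ^ (D.card - F.card) := by
          refine Finset.sum_congr rfl fun ψ' h => ?_
          rw [card_im_sdiff hD, (Finset.mem_filter.1 h).2]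
      _ ≤ ∑ ψ' ∈ Finset.univ.filter (fun ψ' : V ↪ Fin n => shared D ψ ψ' = F),
          p ^ (D.card - F.card) := by
          refine Finset.sum_le_sum_of_subset_of_nonneg ?_ fun _ _ _ => pow_nonneg h0 _
          intro ψ' h
          exact Finset.mem_filter.2 ⟨Finset.mem_univ _, (Finset.mem_filter.1 h).2⟩
      _ ≤ ((Fintype.card V : ℝ) ^ Fintype.card V *
          (n : ℝ) ^ (Fintype.card V - (cov F).card)) * p ^ (D.card - F.card) := by
          rw [Finset.sum_const, nsmul_eq_mul]
          exact mul_le_mul_of_nonneg_right (card_shared_le F D ψ) (pow_nonneg h0 _)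
      _ ≤ _ := by
          rw [mul_assoc]
          exact mul_le_mul_of_nonneg_left (hB F (Finset.mem_powerset.1 hFD) hFS) (by positivity)
  refine (Finset.sum_le_sum hb).trans ?_
  rw [Finset.sum_const, nsmul_eq_mul, mul_assoc]
  refine mul_le_mul_of_nonneg_right ?_ (by positivity)
  have : (D.powerset.filter 𝓢).card ≤ 2 ^ D.card := by
    rw [← Finset.card_powerset]; exact Finset.card_filter_le _ _
  exact_mod_cast this

omit [Fintype V] in
lemma not_disjoint_im_iff (D : Finset (Sym2 V)) (ψ ψ' : V ↪ Fin n) :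
    ¬ Disjoint (im D ψ) (im D ψ') ↔ (shared D ψ ψ').Nonempty := by
  rw [Finset.not_disjoint_iff]
  constructor
  · rintro ⟨e, h1, h2⟩
    obtain ⟨d, hd, h⟩ := mem_im.1 h2
    exact ⟨d, Finset.mem_filter.2 ⟨hd, e, h1, h⟩⟩
  · rintro ⟨d, hd⟩
    obtain ⟨hd, e, he, h⟩ := Finset.mem_filter.1 hd
    exact ⟨e, he, mem_im.2 ⟨d, hd, h⟩⟩

lemma card_embedding_le : (Fintype.card (V ↪ Fin n) : ℝ) ≤ (n : ℝ) ^ Fintype.card V := by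
  have : Fintype.card (V ↪ Fin n) ≤ Fintype.card (V → Fin n) :=
    Fintype.card_le_of_injective (fun ψ => (ψ : V → Fin n)) DFunLike.coe_injective
  rw [Fintype.card_fun, Fintype.card_fin] at this
  exact_mod_cast this

/-- The pair sum over all ordered pairs of embeddings whose shared part lies in a collection. -/
lemma double_pair_sum_le {p : ℝ} (h0 : 0 ≤ p) {D : Finset (Sym2 V)}
    (hD : ∀ d ∈ D, ¬ d.IsDiag) (𝓢 : Finset (Sym2 V) → Prop) {B : ℝ}
    (hB : ∀ F ⊆ D, 𝓢 F →
      (n : ℝ) ^ (Fintype.card V - (cov F).card) * p ^ (D.card - F.card) ≤ B) (hB0 : 0 ≤ B) :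
    ∑ ψ : V ↪ Fin n, ∑ ψ' ∈ Finset.univ.filter (fun ψ' : V ↪ Fin n => 𝓢 (shared D ψ ψ')),
      p ^ (im D ψ ∪ im D ψ').card ≤
      (n : ℝ) ^ Fintype.card V * p ^ D.card *
        (2 ^ D.card * (Fintype.card V : ℝ) ^ Fintype.card V * B) := by
  have : ∀ ψ : V ↪ Fin n, ∑ ψ' ∈ Finset.univ.filter (fun ψ' : V ↪ Fin n => 𝓢 (shared D ψ ψ')),
      p ^ (im D ψ ∪ im D ψ').card ≤
      p ^ D.card * (2 ^ D.card * (Fintype.card V : ℝ) ^ Fintype.card V * B) := by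
    intro ψ
    refine le_trans (le_of_eq ?_)
      (mul_le_mul_of_nonneg_left (pair_sum_le h0 hD ψ 𝓢 hB hB0) (pow_nonneg h0 _))
    rw [Finset.mul_sum]
    refine Finset.sum_congr rfl fun ψ' _ => ?_
    rw [← pow_add]
    congr 1
    rw [Finset.union_comm, ← Finset.card_sdiff_add_card, card_im hD ψ]; ring
  refine (Finset.sum_le_sum fun ψ _ => this ψ).trans ?_
  rw [Finset.sum_const, nsmul_eq_mul, Finset.card_univ, ← mul_assoc]
  exact mul_le_mul_of_nonneg_right
    (mul_le_mul_of_nonneg_right card_embedding_le (pow_nonneg h0 _)) (by positivity)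

end Embeddings

section Cuts

variable {n r : ℕ}

/-- The edge `e` joins two different classes of the colouring `φ`. -/
def Crosses (φ : Fin n → Fin r) (e : EdgeType n) : Prop := ¬ (Sym2.map φ e.1).IsDiag

/-- The edges of `G` crossing `φ`. -/
def cutE (φ : Fin n → Fin r) (G : EdgeSetGraph n) : EdgeSetGraph n := G.filter (Crosses φ)

/-- The edges of `G` inside the classes of `φ`. -/
def intE (φ : Fin n → Fin r) (G : EdgeSetGraph n) : EdgeSetGraph n :=
  G.filter fun e => ¬ Crosses φ e

lemma card_cutE_add_card_intE (φ : Fin n → Fin r) (G : EdgeSetGraph n) :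
    (cutE φ G).card + (intE φ G).card = G.card :=
  Finset.card_filter_add_card_filter_not _

/-- The size of a largest `r`-cut. -/
def maxCut (r : ℕ) (G : EdgeSetGraph n) : ℕ :=
  Finset.univ.sup fun φ : Fin n → Fin r => (cutE φ G).card

lemma card_cutE_le (φ : Fin n → Fin r) (G : EdgeSetGraph n) : (cutE φ G).card ≤ maxCut r G :=
  Finset.le_sup (f := fun φ : Fin n → Fin r => (cutE φ G).card) (Finset.mem_univ φ)

/-- The set of optimal cuts. -/
def maxCuts (r : ℕ) (G : EdgeSetGraph n) : Finset (Fin n → Fin r) :=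
  Finset.univ.filter fun φ => (cutE φ G).card = maxCut r G

lemma mem_maxCuts {φ : Fin n → Fin r} {G : EdgeSetGraph n} :
    φ ∈ maxCuts r G ↔ (cutE φ G).card = maxCut r G := by simp [maxCuts]

lemma maxCuts_nonempty [NeZero r] (G : EdgeSetGraph n) : (maxCuts r G).Nonempty := by
  obtain ⟨φ, _, h⟩ := Finset.exists_mem_eq_sup (Finset.univ : Finset (Fin n → Fin r))
    Finset.univ_nonempty (fun φ => (cutE φ G).card)
  exact ⟨φ, mem_maxCuts.2 h.symm⟩

/-- A choice of an element of a set of colourings. -/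
def pick [NeZero r] (M : Finset (Fin n → Fin r)) : Fin n → Fin r :=
  if h : M.Nonempty then h.choose else fun _ => 0

/-- The canonical optimal cut; it only depends on the set of optimal cuts. -/
def canon (r : ℕ) [NeZero r] (G : EdgeSetGraph n) : Fin n → Fin r := pick (maxCuts r G)

lemma canon_mem [NeZero r] (G : EdgeSetGraph n) : canon r G ∈ maxCuts r G := by
  unfold canon pick
  rw [dif_pos (maxCuts_nonempty G)]
  exact (maxCuts_nonempty G).choose_spec

lemma card_cutE_canon [NeZero r] (G : EdgeSetGraph n) :
    (cutE (canon r G) G).card = maxCut r G := mem_maxCuts.1 (canon_mem G)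

lemma cutE_mono (φ : Fin n → Fin r) {F G : EdgeSetGraph n} (h : F ⊆ G) : cutE φ F ⊆ cutE φ G :=
  Finset.filter_subset_filter _ h

lemma maxCut_mono {F G : EdgeSetGraph n} (h : F ⊆ G) : maxCut r F ≤ maxCut r G :=
  Finset.sup_le fun φ _ => (Finset.card_le_card (cutE_mono φ h)).trans (card_cutE_le φ G)

lemma IsRPartite.card_le_maxCut {F G : EdgeSetGraph n} (hF : IsRPartite r F) (h : F ⊆ G) :
    F.card ≤ maxCut r G := by
  obtain ⟨φ, hφ⟩ := hF
  refine le_trans ?_ ((card_cutE_le φ F).trans (maxCut_mono h))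
  rw [cutE, Finset.filter_true_of_mem]
  exact hφ

/-- The edge joining two distinct vertices. -/
def mkE {u v : Fin n} (h : u ≠ v) : EdgeType n := ⟨s(u, v), by simpa using h⟩

lemma crosses_mkE (φ : Fin n → Fin r) {u v : Fin n} (h : u ≠ v) :
    Crosses φ (mkE h) ↔ φ u ≠ φ v := by simp [Crosses, mkE]

lemma exists_mkE (e : EdgeType n) : ∃ (u v : Fin n) (h : u ≠ v), e = mkE h := by
  obtain ⟨e, he⟩ := e
  induction e using Sym2.ind with
  | _ u v => exact ⟨u, v, by simpa using he, rfl⟩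

/-- The neighbours of a vertex. -/
def nbr (G : EdgeSetGraph n) (u : Fin n) : Finset (Fin n) :=
  Finset.univ.filter fun v => ∃ h : u ≠ v, mkE h ∈ G

lemma mem_nbr {G : EdgeSetGraph n} {u v : Fin n} : v ∈ nbr G u ↔ ∃ h : u ≠ v, mkE h ∈ G := by
  simp [nbr]

lemma card_nbr (G : EdgeSetGraph n) (u : Fin n) :
    (nbr G u).card = (G.filter fun e => u ∈ e.1).card := by
  refine Finset.card_bij (fun v hv => mkE (mem_nbr.1 hv).1) ?_ ?_ ?_
  · intro v hv
    exact Finset.mem_filter.2 ⟨(mem_nbr.1 hv).2, by simp [mkE]⟩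
  · intro v hv w hw h
    have : s(u, v) = s(u, w) := Subtype.ext_iff.1 h
    exact Sym2.congr_right.1 this
  · rintro ⟨e, he⟩ h
    obtain ⟨h1, h2⟩ := Finset.mem_filter.1 h
    obtain ⟨v, rfl⟩ : ∃ v, e = s(u, v) := h2
    exact ⟨v, mem_nbr.2 ⟨by simpa using he, h1⟩, rfl⟩

lemma sum_card_nbr (G : EdgeSetGraph n) : ∑ u, (nbr G u).card = 2 * G.card := by
  simp only [card_nbr, Finset.card_filter]
  rw [Finset.sum_comm]
  have : ∀ e ∈ G, ∑ u : Fin n, (if u ∈ e.1 then 1 else 0) = 2 := by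
    intro e _
    obtain ⟨u, v, h, rfl⟩ := exists_mkE e
    rw [← Finset.card_filter]
    have : (Finset.univ.filter fun w => w ∈ (mkE h).1) = {u, v} := by
      ext w; simp [mkE]
    rw [this, Finset.card_pair h]
  rw [Finset.sum_congr rfl this, Finset.sum_const, smul_eq_mul, mul_comm]

/-- Colour classes. -/
def cls (φ : Fin n → Fin r) (k : Fin r) : Finset (Fin n) := Finset.univ.filter fun v => φ v = k

lemma mem_cls {φ : Fin n → Fin r} {k : Fin r} {v : Fin n} : v ∈ cls φ k ↔ φ v = k := by
  simp [cls]

lemma sum_card_cls (φ : Fin n → Fin r) : ∑ k, (cls φ k).card = n := by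
  have := Finset.card_eq_sum_card_fiberwise (f := φ) (s := Finset.univ) (t := Finset.univ)
    (fun _ _ => Finset.mem_coe.2 (Finset.mem_univ _))
  rw [Finset.card_univ, Fintype.card_fin] at this
  exact this.symm

lemma sum_card_cls_comp (φ : Fin n → Fin r) :
    ∑ u, (cls φ (φ u)).card = ∑ k, (cls φ k).card ^ 2 := by
  rw [← Finset.sum_fiberwise (s := Finset.univ) (g := φ)]
  refine Finset.sum_congr rfl fun k _ => ?_
  rw [Finset.sum_congr rfl (g := fun _ => (cls φ k).card)
    (fun u hu => by rw [(Finset.mem_filter.1 hu).2]), Finset.sum_const, smul_eq_mul, sq]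
  rfl

/-- Twice the number of internal pairs plus `n` is the sum of the squares of the class sizes. -/
lemma two_mul_card_intE_univ (φ : Fin n → Fin r) :
    2 * (intE φ Finset.univ).card + n = ∑ k, (cls φ k).card ^ 2 := by
  rw [← sum_card_cls_comp, ← sum_card_nbr]
  have : ∀ u, (cls φ (φ u)).card = (nbr (intE φ Finset.univ) u).card + 1 := by
    intro u
    have : cls φ (φ u) = insert u (nbr (intE φ Finset.univ) u) := by
      ext v
      simp only [mem_cls, Finset.mem_insert, mem_nbr, intE, Finset.mem_filter, Finset.mem_univ,
        true_and, crosses_mkE, not_not]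
      constructor
      · intro h
        by_cases hv : v = u
        · exact Or.inl hv
        · exact Or.inr ⟨fun h' => hv h'.symm, h.symm⟩
      · rintro (rfl | ⟨_, h⟩)
        · rfl
        · exact h.symm
    rw [this, Finset.card_insert_of_notMem]
    intro h
    exact (mem_nbr.1 h).1 rfl
  simp only [this, Finset.sum_add_distrib]
  simp

lemma sq_le_mul_sum_sq (φ : Fin n → Fin r) : n ^ 2 ≤ r * ∑ k, (cls φ k).card ^ 2 := by
  have : (∑ k : Fin r, (cls φ k).card) ^ 2 ≤
      (Finset.univ : Finset (Fin r)).card * ∑ k, (cls φ k).card ^ 2 := sq_sum_le_card_mul_sum_sq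
  rw [sum_card_cls, Finset.card_univ, Fintype.card_fin] at this
  exact this

lemma card_mono_colourings (a b : Fin n) (h : a ≠ b) :
    r * (Finset.univ.filter fun φ : Fin n → Fin r => φ a = φ b).card ≤ r ^ n := by
  have : ((Finset.univ : Finset (Fin r)) ×ˢ
      Finset.univ.filter fun φ : Fin n → Fin r => φ a = φ b).card ≤
      (Finset.univ : Finset (Fin n → Fin r)).card := by
    refine Finset.card_le_card_of_injOn (fun x : Fin r × (Fin n → Fin r) =>
      Function.update x.2 a x.1) (fun _ _ => Finset.mem_coe.2 (Finset.mem_univ _)) ?_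
    rintro ⟨j, φ⟩ h1 ⟨k, ψ⟩ h2 heq
    have h1' : φ a = φ b := by simpa using h1
    have h2' : ψ a = ψ b := by simpa using h2
    simp only at heq
    have hj : j = k := by simpa using congrFun heq a
    have hne : ∀ c, c ≠ a → φ c = ψ c := fun c hc => by
      simpa [Function.update_of_ne hc] using congrFun heq c
    refine Prod.ext hj (funext fun c => ?_)
    by_cases hc : c = a
    · subst hc; exact h1'.trans ((hne b h.symm).trans h2'.symm)
    · exact hne c hc
  simpa using this

/-- Some colouring has at most the average number of internal edges. -/
lemma mul_card_intE_canon_le [NeZero r] (G : EdgeSetGraph n) :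
    r * (intE (canon r G) G).card ≤ G.card := by
  by_contra hlt
  push Not at hlt
  have hall : ∀ φ : Fin n → Fin r, G.card + 1 ≤ r * (intE φ G).card := by
    intro φ
    have h1 := card_cutE_add_card_intE φ G
    have h2 := card_cutE_add_card_intE (canon r G) G
    have h3 := card_cutE_canon (r := r) G
    have h4 := card_cutE_le φ G
    have : (intE (canon r G) G).card ≤ (intE φ G).card := by omega
    exact lt_of_lt_of_le hlt (Nat.mul_le_mul_left r this)
  have hsum : ∑ φ : Fin n → Fin r, r * (intE φ G).card ≤ G.card * r ^ n := by
    rw [← Finset.mul_sum]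
    simp only [intE, Finset.card_filter]
    rw [Finset.sum_comm, Finset.mul_sum]
    refine (Finset.sum_le_card_nsmul _ _ (r ^ n) fun e _ => ?_).trans (by rw [smul_eq_mul])
    obtain ⟨u, v, h, rfl⟩ := exists_mkE e
    rw [← Finset.card_filter]
    simp only [crosses_mkE, not_not]
    exact card_mono_colourings u v h
  have hlow : ∑ φ : Fin n → Fin r, (G.card + 1) ≤ ∑ φ : Fin n → Fin r, r * (intE φ G).card :=
    Finset.sum_le_sum fun φ _ => hall φ
  rw [Finset.sum_const, smul_eq_mul, Finset.card_univ, Fintype.card_fun, Fintype.card_fin,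
    Fintype.card_fin] at hlow
  have hpos : 0 < r ^ n := pow_pos (Nat.pos_of_ne_zero (NeZero.ne r)) n
  nlinarith

end Cuts

section AntiConcentration

lemma sum_pi_eval {α : Type*} {s : ℕ} (T : Finset α) (i : Fin s) (f : α → ℝ) :
    ∑ x ∈ Fintype.piFinset (fun _ : Fin s => T), f (x i) =
      (T.card : ℝ) ^ (s - 1) * ∑ y ∈ T, f y := by
  have h := Finset.prod_univ_sum (fun _ : Fin s => T) (fun j y => if j = i then f y else (1 : ℝ))
  have e1 : ∀ x : Fin s → α, ∏ j, (if j = i then f (x j) else (1 : ℝ)) = f (x i) := by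
    intro x; simp
  simp only [e1] at h
  rw [← h, ← Finset.mul_prod_erase _ _ (Finset.mem_univ i)]
  rw [Finset.prod_congr rfl (g := fun _ => (T.card : ℝ)) (fun j hj => by
    simp [(Finset.mem_erase.1 hj).1])]
  simp [mul_comm]

lemma sum_fun_eval {α : Type*} [Fintype α] {s : ℕ} (i : Fin s) (f : α → ℝ) :
    ∑ x : Fin s → α, f (x i) = (Fintype.card α : ℝ) ^ (s - 1) * ∑ y, f y := by
  have := sum_pi_eval (Finset.univ : Finset α) i f
  rwa [Fintype.piFinset_univ] at this

lemma one_sub_cos_le_abs (y : ℝ) : 1 - Real.cos y ≤ |y| := by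
  rcases le_or_gt |y| 2 with h | h
  · have := Real.one_sub_sq_div_two_le_cos (x := y)
    nlinarith [sq_abs y, abs_nonneg y]
  · linarith [Real.neg_one_le_cos y]

/-- The fluctuation of a random walk with steps `±1, 0`. -/
lemma sum_posPart_walk_ge {α : Type*} [Fintype α] (ξ : α → ℝ)
    (hξ : ∀ y, ξ y = 0 ∨ ξ y = 1 ∨ ξ y = -1) {k : ℕ} (hk : 1 ≤ k) {L c ζ : ℝ}
    (hζ0 : 0 ≤ ζ)
    (hc : c * Fintype.card α ≤ ∑ y, ξ y ^ 2) (hζ : |∑ y, ξ y| ≤ ζ * Fintype.card α)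
    (hζc : 10 * k * ζ ≤ c) (hζL : ζ * k ^ 2 ≤ L) (hL : 5 * L ≤ (1 - Real.exp (-(c / 10))) * k) :
    (Fintype.card α : ℝ) ^ (k ^ 2) * L ≤
      ∑ x : Fin (k ^ 2) → α, max 0 (∑ i, ξ (x i) - L) := by
  set N : ℝ := ((Fintype.card α : ℕ) : ℝ) with hN
  have hN0 : 0 ≤ N := Nat.cast_nonneg _
  set s := k ^ 2 with hs
  have hs1 : 1 ≤ s := Nat.one_le_pow _ _ hk
  have hkpos : (0 : ℝ) < k := by exact_mod_cast hk
  have hk1 : (1 : ℝ) ≤ k := by exact_mod_cast hk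
  set t : ℝ := 1 / k with ht
  have ht0 : 0 < t := by positivity
  have ht1 : t ≤ 1 := by rw [ht, div_le_one hkpos]; exact hk1
  have htk : t * k = 1 := by rw [ht]; field_simp
  set D : (Fin s → α) → ℝ := fun x => ∑ i, ξ (x i) with hD
  -- the characteristic function of a single step
  set Φ : ℂ := ∑ y, Complex.exp ((t * ξ y : ℝ) * Complex.I) with hΦ
  have hcos1 : t ^ 2 / 5 ≤ 1 - Real.cos t := by
    have := Real.cos_bound (x := t) (by rw [abs_of_pos ht0]; exact ht1)
    rw [abs_of_pos ht0] at this
    have h2 := (abs_le.1 this).2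
    have h3 : t ^ 4 ≤ t ^ 2 := pow_le_pow_of_le_one ht0.le ht1 (by norm_num)
    linarith [sq_nonneg t]
  have hcos0 : 0 ≤ Real.cos t := by
    have := Real.one_sub_sq_div_two_le_cos (x := t)
    nlinarith
  have hξ1 : ∑ y, ξ y ^ 2 ≤ N := by
    calc ∑ y, ξ y ^ 2 ≤ ∑ _y : α, (1 : ℝ) := Finset.sum_le_sum fun y _ => by
          rcases hξ y with h | h | h <;> rw [h] <;> norm_num
      _ = N := by simp [hN]
  have hre : Φ.re = N - (∑ y, ξ y ^ 2) * (1 - Real.cos t) := by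
    rw [hΦ, Complex.re_sum, Finset.sum_mul]
    have : N = ∑ _y : α, (1 : ℝ) := by simp [hN]
    rw [this, ← Finset.sum_sub_distrib]
    refine Finset.sum_congr rfl fun y _ => ?_
    rw [Complex.exp_ofReal_mul_I_re]
    rcases hξ y with h | h | h <;> rw [h] <;> simp
  have him : Φ.im = Real.sin t * ∑ y, ξ y := by
    rw [hΦ, Complex.im_sum, Finset.mul_sum]
    refine Finset.sum_congr rfl fun y _ => ?_
    rw [Complex.exp_ofReal_mul_I_im]
    rcases hξ y with h | h | h <;> rw [h] <;> simp
  have hnorm : ‖Φ‖ ≤ N * Real.exp (-(c * t ^ 2 / 10)) := by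
    refine (Complex.norm_le_abs_re_add_abs_im Φ).trans ?_
    have hre0 : 0 ≤ Φ.re := by
      rw [hre]
      have : (∑ y, ξ y ^ 2) * (1 - Real.cos t) ≤ N * 1 :=
        mul_le_mul hξ1 (by linarith) (by linarith [Real.cos_le_one t]) hN0
      linarith
    have h1 : Φ.re ≤ N - c * N * (t ^ 2 / 5) := by
      rw [hre]
      have : c * N * (t ^ 2 / 5) ≤ (∑ y, ξ y ^ 2) * (1 - Real.cos t) :=
        mul_le_mul hc hcos1 (by positivity) (Finset.sum_nonneg fun _ _ => sq_nonneg _)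
      linarith
    have h2 : |Φ.im| ≤ t * (ζ * N) := by
      rw [him, abs_mul]
      refine mul_le_mul ?_ hζ (abs_nonneg _) ht0.le
      have := Real.abs_sin_le_abs (x := t)
      rwa [abs_of_pos ht0] at this
    rw [abs_of_nonneg hre0]
    have h3 : 1 - c * t ^ 2 / 10 ≤ Real.exp (-(c * t ^ 2 / 10)) := by
      have := Real.add_one_le_exp (-(c * t ^ 2 / 10)); linarith
    have h4 : t * ζ ≤ c * t ^ 2 / 10 := by
      have : 10 * k * ζ * (t * t) ≤ c * (t * t) := mul_le_mul_of_nonneg_right hζc (by positivity)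
      have e : 10 * k * ζ * (t * t) = 10 * (t * ζ) * (t * k) := by ring
      rw [e, htk] at this
      linarith [sq t]
    nlinarith [mul_le_mul_of_nonneg_left h3 hN0, mul_le_mul_of_nonneg_left h4 hN0]
  have hcosum : ∑ x, Real.cos (t * D x) ≤ N ^ s * Real.exp (-(c / 10)) := by
    have e1 : ∑ x : Fin s → α, Real.cos (t * D x) = (Φ ^ s).re := by
      rw [hΦ, Fintype.sum_pow, Complex.re_sum]
      refine Finset.sum_congr rfl fun x _ => ?_
      rw [← Complex.exp_sum, ← Finset.sum_mul, ← Complex.ofReal_sum, ← Finset.mul_sum,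
        Complex.exp_ofReal_mul_I_re]
    rw [e1]
    refine (Complex.re_le_norm _).trans ?_
    rw [norm_pow]
    refine (pow_le_pow_left₀ (norm_nonneg _) hnorm s).trans (le_of_eq ?_)
    rw [mul_pow, ← Real.exp_nat_mul]
    congr 2
    have : (s : ℝ) = k ^ 2 := by rw [hs]; push_cast; ring
    rw [this]
    have e : (k : ℝ) ^ 2 * -(c * t ^ 2 / 10) = -(c / 10) * (t * k) ^ 2 := by ring
    rw [e, htk]; ring
  have hcard : ∑ _x : Fin s → α, (1 : ℝ) = N ^ s := by simp [hN]
  have habs : k * (N ^ s * (1 - Real.exp (-(c / 10)))) ≤ ∑ x, |D x| := by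
    have : ∀ x, (k : ℝ) * (1 - Real.cos (t * D x)) ≤ |D x| := by
      intro x
      have h := mul_le_mul_of_nonneg_left (one_sub_cos_le_abs (t * D x)) hkpos.le
      rw [abs_mul, abs_of_pos ht0, ← mul_assoc (k : ℝ) t, mul_comm (k : ℝ) t, htk, one_mul] at h
      exact h
    refine le_trans ?_ (Finset.sum_le_sum fun x _ => this x)
    rw [← Finset.mul_sum, Finset.sum_sub_distrib, hcard]
    nlinarith
  have hsumD : -(N ^ s * (s * ζ)) ≤ ∑ x, D x := by
    have : ∑ x, D x = s * (N ^ (s - 1) * ∑ y, ξ y) := by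
      simp only [hD]
      rw [Finset.sum_comm, Finset.sum_congr rfl fun i _ => sum_fun_eval i ξ]
      simp [hN]
    rw [this]
    have hp : N ^ s = N ^ (s - 1) * N := by
      rw [← pow_succ, Nat.sub_add_cancel hs1]
    have h2 := (abs_le.1 hζ).1
    rw [hp]
    have h3 : (0 : ℝ) ≤ s * N ^ (s - 1) := by positivity
    nlinarith [mul_le_mul_of_nonneg_left h2 h3]
  have hpt : ∀ x, (|D x| + D x) / 2 - L ≤ max 0 (D x - L) := by
    intro x
    rcases le_or_gt 0 (D x) with h | h
    · rw [abs_of_nonneg h]; exact le_trans (by linarith) (le_max_right _ _)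
    · rw [abs_of_neg h]
      refine le_trans ?_ (le_max_left _ _)
      have : 0 ≤ L := le_trans (by positivity) hζL
      linarith
  refine le_trans ?_ (Finset.sum_le_sum fun x _ => hpt x)
  rw [Finset.sum_sub_distrib, ← Finset.sum_div, Finset.sum_add_distrib]
  have hL' : ∑ _x : Fin s → α, L = N ^ s * L := by simp [hN]
  rw [hL']
  have hNs : 0 ≤ N ^ s := by positivity
  have hsk : (s : ℝ) = k ^ 2 := by rw [hs]; push_cast; ring
  have h5 : (s : ℝ) * ζ ≤ L := by rw [hsk, mul_comm]; exact hζL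
  nlinarith [mul_le_mul_of_nonneg_left hL hNs, mul_le_mul_of_nonneg_left h5 hNs]

end AntiConcentration

section Rigidity

variable {n r : ℕ}

/-- Typical graphs: degrees are not too small, all colourings have at least about the expected
number of internal edges, and the number of edges is not too large. -/
structure Typ (r : ℕ) (p ζ : ℝ) (G : EdgeSetGraph n) : Prop where
  deg : ∀ u, (1 - ζ) * (n * p) ≤ (nbr G u).card
  int : ∀ φ : Fin n → Fin r,
    p * (intE φ Finset.univ).card - ζ * (n ^ 2 * p) ≤ (intE φ G).card
  tot : 2 * (G.card : ℝ) ≤ (1 + ζ) * (n ^ 2 * p)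

/-- Vertices whose colour class is substantially different in some nearly optimal cut. -/
def unstable (r : ℕ) [NeZero r] (L : ℕ) (G : EdgeSetGraph n) : Finset (Fin n) :=
  Finset.univ.filter fun u => ∃ φ' : Fin n → Fin r, maxCut r G ≤ (cutE φ' G).card + L ∧
    n ≤ 2 * r * (symmDiff (cls φ' (φ' u)) (cls (canon r G) (canon r G u))).card

lemma Typ.sum_sq_le [NeZero r] {p ζ : ℝ} {L : ℕ} {G : EdgeSetGraph n} (h : Typ r p ζ G)
    (hp : 0 < p) (hζ : 0 ≤ ζ) (hL : 2 * L / p + n ≤ ζ * n ^ 2) {φ : Fin n → Fin r}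
    (hφ : maxCut r G ≤ (cutE φ G).card + L) :
    ∑ k, ((cls φ k).card : ℝ) ^ 2 ≤ n ^ 2 / r + 4 * ζ * n ^ 2 := by
  have hr : (1 : ℝ) ≤ r := by exact_mod_cast Nat.pos_of_ne_zero (NeZero.ne r)
  have h1 : ((intE φ G).card : ℝ) ≤ G.card / r + L := by
    have a1 := card_cutE_add_card_intE φ G
    have a2 := card_cutE_add_card_intE (canon r G) G
    have a3 := card_cutE_canon (r := r) G
    have a4 : (intE φ G).card ≤ (intE (canon r G) G).card + L := by omega
    have a5 : (r : ℝ) * (intE (canon r G) G).card ≤ G.card := by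
      exact_mod_cast mul_card_intE_canon_le (r := r) G
    have a6 : ((intE (canon r G) G).card : ℝ) ≤ G.card / r := by
      rw [le_div_iff₀ (by linarith)]; linarith
    have : ((intE φ G).card : ℝ) ≤ (intE (canon r G) G).card + L := by exact_mod_cast a4
    linarith
  have h2 := h.int φ
  have h3 := h.tot
  have h4 : (2 * (intE φ Finset.univ).card + n : ℝ) = ∑ k, ((cls φ k).card : ℝ) ^ 2 := by
    exact_mod_cast two_mul_card_intE_univ φ
  rw [← h4]
  have h5 : p * (2 * (intE φ Finset.univ).card + n : ℝ) ≤ p * (n ^ 2 / r + 4 * ζ * n ^ 2) := by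
    have b1 : (G.card : ℝ) / r ≤ (1 + ζ) * (n ^ 2 * p) / 2 / r :=
      div_le_div_of_nonneg_right (by linarith) (by linarith)
    have b2 : ζ * (n ^ 2 * p) / r ≤ ζ * (n ^ 2 * p) := div_le_self (by positivity) hr
    have b3 : p * (2 * L / p + n) ≤ p * (ζ * n ^ 2) := mul_le_mul_of_nonneg_left hL hp.le
    have b4 : p * (2 * L / p + n) = 2 * L + p * n := by field_simp
    have b5 : (1 + ζ) * (n ^ 2 * p) / 2 / r = (p * (n ^ 2 / r) + ζ * (n ^ 2 * p) / r) / 2 := by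
      ring
    rw [b4] at b3
    nlinarith
  exact le_of_mul_le_mul_left h5 hp

lemma abs_card_cls_sub_le {φ : Fin n → Fin r} (hr : 1 ≤ r) {η : ℝ} (hη : 0 ≤ η)
    (h : ∑ k, ((cls φ k).card : ℝ) ^ 2 ≤ n ^ 2 / r + 4 * η ^ 2 * n ^ 2) (k : Fin r) :
    |((cls φ k).card : ℝ) - n / r| ≤ 2 * η * n := by
  have hr' : (0 : ℝ) < r := by exact_mod_cast hr
  have hs : ∑ k, (((cls φ k).card : ℝ) - n / r) ^ 2 ≤ (2 * η * n) ^ 2 := by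
    have e : ∑ k, (((cls φ k).card : ℝ) - n / r) ^ 2 =
        ∑ k, ((cls φ k).card : ℝ) ^ 2 - n ^ 2 / r := by
      have e1 : ∑ k, ((cls φ k).card : ℝ) = n := by exact_mod_cast sum_card_cls φ
      simp only [sub_sq, Finset.sum_add_distrib, Finset.sum_sub_distrib]
      rw [← Finset.sum_mul, ← Finset.mul_sum, e1]
      simp only [Finset.sum_const, Finset.card_univ, Fintype.card_fin, nsmul_eq_mul]
      field_simp; ring
    rw [e]; nlinarith
  have h1 := Finset.single_le_sum (f := fun k => (((cls φ k).card : ℝ) - n / r) ^ 2)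
    (fun _ _ => sq_nonneg _) (Finset.mem_univ k)
  exact abs_le_of_sq_le_sq (h1.trans hs) (by positivity)

/-- Nearly optimal cuts separate stable vertices of different classes. -/
lemma separates_of_notMem_unstable [NeZero r] {p η : ℝ} {L : ℕ} {G : EdgeSetGraph n}
    (hn : 0 < n) (h : Typ r p (η ^ 2) G) (hp : 0 < p) (hη : 0 ≤ η) (hηr : 4 * η * r ≤ 1)
    (hL : 2 * L / p + n ≤ η ^ 2 * n ^ 2) {a b : Fin n} (ha : a ∉ unstable r L G)
    (hb : b ∉ unstable r L G) (hab : canon r G a ≠ canon r G b) {φ' : Fin n → Fin r}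
    (hφ' : maxCut r G ≤ (cutE φ' G).card + L) : φ' a ≠ φ' b := by
  intro heq
  have hr1 : 1 ≤ r := Nat.pos_of_ne_zero (NeZero.ne r)
  have hr' : (0 : ℝ) < r := by exact_mod_cast hr1
  set φ := canon r G with hφ
  have hs := h.sum_sq_le hp (sq_nonneg η) hL (φ := φ)
    (by rw [hφ, card_cutE_canon]; omega)
  have ha' : 2 * r * (symmDiff (cls φ' (φ' a)) (cls φ (φ a))).card < n := by
    by_contra hcon
    push Not at hcon
    exact ha (Finset.mem_filter.2 ⟨Finset.mem_univ _, φ', hφ', hcon⟩)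
  have hb' : 2 * r * (symmDiff (cls φ' (φ' b)) (cls φ (φ b))).card < n := by
    by_contra hcon
    push Not at hcon
    exact hb (Finset.mem_filter.2 ⟨Finset.mem_univ _, φ', hφ', hcon⟩)
  rw [← heq] at hb'
  have hsub : cls φ (φ a) ∪ cls φ (φ b) ⊆ symmDiff (cls φ' (φ' a)) (cls φ (φ a)) ∪
      symmDiff (cls φ' (φ' a)) (cls φ (φ b)) := by
    intro v hv
    simp only [Finset.mem_union, Finset.mem_symmDiff, mem_cls] at hv ⊢
    by_cases h1 : φ v = φ a
    · by_cases h2 : φ' v = φ' a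
      · right; left; exact ⟨h2, fun h3 => hab (h1.symm.trans h3)⟩
      · left; right; exact ⟨h1, h2⟩
    · have h3 := hv.resolve_left h1
      by_cases h2 : φ' v = φ' a
      · left; left; exact ⟨h2, h1⟩
      · right; right; exact ⟨h3, h2⟩
  have hdisj : Disjoint (cls φ (φ a)) (cls φ (φ b)) := by
    rw [Finset.disjoint_left]
    intro v h1 h2
    exact hab ((mem_cls.1 h1).symm.trans (mem_cls.1 h2))
  have hc := (Finset.card_le_card hsub).trans (Finset.card_union_le _ _)
  rw [Finset.card_union_of_disjoint hdisj] at hc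
  have hca := (abs_le.1 (abs_card_cls_sub_le hr1 hη hs (φ a))).1
  have hcb := (abs_le.1 (abs_card_cls_sub_le hr1 hη hs (φ b))).1
  have hc' : r * ((cls φ (φ a)).card + (cls φ (φ b)).card) < n := by
    have := Nat.mul_le_mul_left (2 * r) hc
    nlinarith
  have hc'' : (r : ℝ) * ((cls φ (φ a)).card + (cls φ (φ b)).card) < n := by exact_mod_cast hc'
  have hn' : (0 : ℝ) < n := by exact_mod_cast hn
  have e1 : (r : ℝ) * (n / r) = n := by field_simp
  nlinarith

lemma card_cutE_sdiff {φ : Fin n → Fin r} {G T : EdgeSetGraph n} (hT : T ⊆ G)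
    (hc : ∀ e ∈ T, Crosses φ e) : (cutE φ (G \ T)).card + T.card = (cutE φ G).card := by
  have : cutE φ (G \ T) = cutE φ G \ T := by
    ext e; simp only [cutE, Finset.mem_filter, Finset.mem_sdiff]; tauto
  rw [this]
  exact Finset.card_sdiff_add_card_eq_card fun e he => Finset.mem_filter.2 ⟨hT he, hc e he⟩

/-- Deleting a few crossing edges between stable vertices does not change the optimal cuts. -/
lemma maxCuts_sdiff [NeZero r] {p η : ℝ} {L : ℕ} {G : EdgeSetGraph n}
    (hn : 0 < n) (h : Typ r p (η ^ 2) G) (hp : 0 < p) (hη : 0 ≤ η) (hηr : 4 * η * r ≤ 1)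
    (hL : 2 * L / p + n ≤ η ^ 2 * n ^ 2) {T : EdgeSetGraph n} (hT : T ⊆ G) (hTL : T.card ≤ L)
    (hc : ∀ e ∈ T, Crosses (canon r G) e) (hst : ∀ e ∈ T, ∀ u ∈ e.1, u ∉ unstable r L G) :
    maxCuts r (G \ T) = maxCuts r G := by
  have hnear : ∀ φ' : Fin n → Fin r, maxCut r G ≤ (cutE φ' G).card + L →
      (cutE φ' (G \ T)).card + T.card = (cutE φ' G).card := by
    intro φ' hφ'
    refine card_cutE_sdiff hT fun e he => ?_
    have h1 := hc e he
    have h2 := hst e he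
    obtain ⟨u, v, huv, rfl⟩ := exists_mkE e
    rw [crosses_mkE] at h1 ⊢
    exact separates_of_notMem_unstable hn h hp hη hηr hL (h2 u (by simp [mkE]))
      (h2 v (by simp [mkE])) h1 hφ'
  have hmax : maxCut r (G \ T) + T.card = maxCut r G := by
    apply le_antisymm
    · obtain ⟨φ', hφ'⟩ := maxCuts_nonempty (r := r) (G \ T)
      rw [mem_maxCuts] at hφ'
      rw [← hφ']
      by_cases hd : maxCut r G ≤ (cutE φ' G).card + L
      · rw [hnear φ' hd]; exact card_cutE_le φ' G
      · have := Finset.card_le_card (cutE_mono φ' (Finset.sdiff_subset : G \ T ⊆ G))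
        omega
    · have h1 := hnear (canon r G) (by rw [card_cutE_canon]; omega)
      rw [card_cutE_canon] at h1
      have := card_cutE_le (canon r G) (G \ T)
      omega
  ext φ'
  rw [mem_maxCuts, mem_maxCuts]
  by_cases hd : maxCut r G ≤ (cutE φ' G).card + L
  · have := hnear φ' hd; omega
  · have := Finset.card_le_card (cutE_mono φ' (Finset.sdiff_subset : G \ T ⊆ G))
    have := card_cutE_le φ' G
    omega

end Rigidity

section Stars

variable {n r s : ℕ}

/-- The star with centre `u` and leaves `x i`. -/
def starE (u : Fin n) (x : Fin s → Fin n) : EdgeSetGraph n :=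
  Finset.univ.filter fun e => ∃ i, ∃ h : u ≠ x i, mkE h = e

lemma mem_star {u : Fin n} {x : Fin s → Fin n} {e : EdgeType n} :
    e ∈ starE u x ↔ ∃ i, ∃ h : u ≠ x i, mkE h = e := by simp [starE]

/-- The leaves are distinct and different from the centre. -/
def GoodStar (u : Fin n) (x : Fin s → Fin n) : Prop := Function.Injective x ∧ ∀ i, u ≠ x i

lemma mkE_injective {u v w : Fin n} (h : u ≠ v) (h' : u ≠ w) (heq : mkE h = mkE h') : v = w := by
  have : s(u, v) = s(u, w) := Subtype.ext_iff.1 heq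
  exact Sym2.congr_right.1 this

lemma card_star_filter {u : Fin n} {x : Fin s → Fin n} (hx : GoodStar u x)
    (Q : EdgeType n → Prop) :
    (((starE u x).filter Q).card : ℝ) = ∑ i, ind (Q (mkE (hx.2 i))) := by
  rw [sum_ind]
  norm_cast
  symm
  refine Finset.card_bij (fun i _ => mkE (hx.2 i)) ?_ ?_ ?_
  · intro i hi
    exact Finset.mem_filter.2 ⟨mem_star.2 ⟨i, hx.2 i, rfl⟩, (Finset.mem_filter.1 hi).2⟩
  · intro i _ j _ h
    exact hx.1 (mkE_injective _ _ h)
  · intro e he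
    obtain ⟨h1, h2⟩ := Finset.mem_filter.1 he
    obtain ⟨i, h, rfl⟩ := mem_star.1 h1
    exact ⟨i, Finset.mem_filter.2 ⟨Finset.mem_univ _, h2⟩, rfl⟩

lemma card_star {u : Fin n} {x : Fin s → Fin n} (hx : GoodStar u x) : (starE u x).card = s := by
  have := card_star_filter hx (fun _ => True)
  simp only [Finset.filter_true, ind_of trivial, Finset.sum_const, Finset.card_univ,
    Fintype.card_fin, nsmul_eq_mul, mul_one] at this
  exact_mod_cast this

lemma starE_subset_iff {u : Fin n} {x : Fin s → Fin n} (hx : GoodStar u x) {G : EdgeSetGraph n} :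
    starE u x ⊆ G ↔ ∀ i, x i ∈ nbr G u := by
  constructor
  · intro h i
    exact mem_nbr.2 ⟨hx.2 i, h (mem_star.2 ⟨i, hx.2 i, rfl⟩)⟩
  · intro h e he
    obtain ⟨i, h', rfl⟩ := mem_star.1 he
    exact (mem_nbr.1 (h i)).2

lemma card_cutE_star {u : Fin n} {x : Fin s → Fin n} (hx : GoodStar u x) (φ : Fin n → Fin r) :
    ((cutE φ (starE u x)).card : ℝ) = ∑ i, ind (φ (x i) ≠ φ u) := by
  rw [cutE, card_star_filter hx]
  refine Finset.sum_congr rfl fun i _ => ?_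
  rw [crosses_mkE, ne_comm]

lemma card_star_inter {u : Fin n} {x : Fin s → Fin n} (hx : GoodStar u x) (G : EdgeSetGraph n) :
    ((starE u x ∩ G).card : ℝ) = ∑ i, ind (x i ∈ nbr G u) := by
  rw [← Finset.filter_mem_eq_inter]
  have := card_star_filter hx (fun e => e ∈ G)
  rw [← Finset.filter_congr_decidable] at this
  rw [this]
  refine Finset.sum_congr rfl fun i _ => ?_
  congr 1
  rw [eq_iff_iff, mem_nbr]
  exact ⟨fun h => ⟨hx.2 i, h⟩, fun h => h.2⟩

lemma cutE_sdiff_add (φ : Fin n → Fin r) (G S : EdgeSetGraph n) :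
    (cutE φ G).card ≤ (cutE φ (G \ S)).card + (cutE φ S).card := by
  rw [← Finset.card_union_add_card_inter]
  refine le_trans (Finset.card_le_card ?_) (Nat.le_add_right _ _)
  intro e
  simp only [cutE, Finset.mem_union, Finset.mem_filter, Finset.mem_sdiff]
  tauto

lemma cutE_union_ge (φ : Fin n → Fin r) (G S : EdgeSetGraph n) :
    (cutE φ G).card + (cutE φ S).card ≤ (cutE φ (G ∪ S)).card + (S ∩ G).card := by
  have h1 : cutE φ (G ∪ S) = cutE φ G ∪ cutE φ S := Finset.filter_union _ _ _
  rw [h1, ← Finset.card_union_add_card_inter]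
  refine Nat.add_le_add_left (Finset.card_le_card ?_) _
  intro e
  simp only [cutE, Finset.mem_inter, Finset.mem_filter]
  tauto

lemma card_not_injective_le {α : Type*} (T : Finset α) (s : ℕ)
    [DecidablePred fun x : Fin s → α => ¬ Function.Injective x] :
    (((Fintype.piFinset fun _ : Fin s => T).filter fun x => ¬ Function.Injective x).card : ℝ) ≤
      s ^ 2 * (T.card : ℝ) ^ (s - 1) := by
  rcases s with _ | s
  · have : ((Fintype.piFinset fun _ : Fin 0 => T).filter fun x => ¬ Function.Injective x) = ∅ := by
      ext x
      simp only [Finset.mem_filter, Finset.notMem_empty, iff_false, not_and, not_not]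
      intro _ i
      exact i.elim0
    rw [this]; simp
  · have hpair : ∀ q : Fin (s + 1) × Fin (s + 1), q.1 ≠ q.2 →
        ((Fintype.piFinset fun _ : Fin (s + 1) => T).filter fun x => x q.1 = x q.2).card ≤
          T.card ^ s := by
      rintro ⟨i, j⟩ hij
      have : T.card ^ s = (Fintype.piFinset fun _ : Fin s => T).card := by simp
      rw [this]
      refine Finset.card_le_card_of_injOn (fun x => fun l => x (i.succAbove l)) ?_ ?_
      · intro x hx
        have := (Finset.mem_filter.1 hx).1
        rw [Fintype.mem_piFinset] at this
        simp only [Finset.mem_coe, Fintype.mem_piFinset]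
        exact fun l => this _
      · intro x hx y hy h
        have hx' : x i = x j := (Finset.mem_filter.1 hx).2
        have hy' : y i = y j := (Finset.mem_filter.1 hy).2
        have hne : ∀ l, l ≠ i → x l = y l := by
          intro l hl
          obtain ⟨l', rfl⟩ := Fin.exists_succAbove_eq hl
          exact congrFun h l'
        funext l
        by_cases hl : l = i
        · rw [hl, hx', hy']; exact hne j (Ne.symm hij)
        · exact hne l hl
    have hcov : ((Fintype.piFinset fun _ : Fin (s + 1) => T).filter
        fun x => ¬ Function.Injective x) ⊆
        (Finset.univ.filter fun q : Fin (s + 1) × Fin (s + 1) => q.1 ≠ q.2).biUnion fun q =>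
          (Fintype.piFinset fun _ : Fin (s + 1) => T).filter fun x => x q.1 = x q.2 := by
      intro x hx
      obtain ⟨h1, h2⟩ := Finset.mem_filter.1 hx
      simp only [Function.Injective, not_forall] at h2
      obtain ⟨i, j, h3, h4⟩ := h2
      exact Finset.mem_biUnion.2 ⟨(i, j), Finset.mem_filter.2 ⟨Finset.mem_univ _, h4⟩,
        Finset.mem_filter.2 ⟨h1, h3⟩⟩
    have hle := (Finset.card_le_card hcov).trans (Finset.card_biUnion_le_card_mul _ _ (T.card ^ s)
      fun q hq => hpair q (Finset.mem_filter.1 hq).2)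
    have h2 : (Finset.univ.filter fun q : Fin (s + 1) × Fin (s + 1) => q.1 ≠ q.2).card ≤
        (s + 1) ^ 2 := by
      refine (Finset.card_filter_le _ _).trans (le_of_eq ?_)
      simp [sq]
    have := hle.trans (Nat.mul_le_mul_right _ h2)
    rw [Nat.add_sub_cancel]
    exact_mod_cast this

/-- Leaf tuples that do not form a good star are rare. -/
lemma card_not_goodStar_le (u : Fin n) (s : ℕ) :
    ((Finset.univ.filter fun x : Fin s → Fin n => ¬ GoodStar u x).card : ℝ) ≤
      (s ^ 2 + s) * (n : ℝ) ^ (s - 1) := by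
  have h1 := card_not_injective_le (Finset.univ : Finset (Fin n)) s
  rw [Fintype.piFinset_univ, Finset.card_univ, Fintype.card_fin] at h1
  have h2 : ∀ x : Fin s → Fin n, ind (¬ GoodStar u x) ≤
      ind (¬ Function.Injective x) + ∑ i, ind (x i = u) := by
    intro x
    have h0 : 0 ≤ ∑ i, ind (x i = u) := Finset.sum_nonneg fun _ _ => ind_nonneg _
    refine ind_le_of (add_nonneg (ind_nonneg _) h0) fun h => ?_
    by_cases hi : Function.Injective x
    · have : ∃ i, u = x i := by
        by_contra hc
        push Not at hc
        exact h ⟨hi, hc⟩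
      obtain ⟨i, hiu⟩ := this
      have := Finset.single_le_sum (f := fun i => ind (x i = u)) (fun _ _ => ind_nonneg _)
        (Finset.mem_univ i)
      rw [ind_of hiu.symm] at this
      linarith [ind_nonneg (¬ Function.Injective x)]
    · rw [ind_of hi]; linarith
  have h3 := Finset.sum_le_sum fun (x : Fin s → Fin n) (_ : x ∈ Finset.univ) => h2 x
  rw [sum_ind, Finset.sum_add_distrib, sum_ind, Finset.sum_comm,
    Finset.sum_congr rfl fun i _ => sum_fun_eval i (fun y : Fin n => ind (y = u))] at h3
  have h4 : ∑ y : Fin n, ind (y = u) = 1 := by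
    rw [sum_ind]; simp [Finset.filter_eq']
  rw [h4] at h3
  simp only [Fintype.card_fin, mul_one, Finset.sum_const, Finset.card_univ, nsmul_eq_mul] at h3
  linarith

end Stars

section RigidityExpectation

variable {n r s : ℕ}

lemma sum_card_nbr_filter (φ : Fin n → Fin r) (G : EdgeSetGraph n) :
    ∑ u, (((nbr G u).filter fun y => φ y = φ u).card : ℝ) = 2 * (intE φ G).card := by
  have h := sum_card_nbr (intE φ G)
  have : ∀ u, (nbr (intE φ G) u) = (nbr G u).filter fun y => φ y = φ u := by
    intro u
    ext v
    simp only [mem_nbr, intE, Finset.mem_filter, crosses_mkE, not_not]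
    constructor
    · rintro ⟨h1, h2, h3⟩; exact ⟨⟨h1, h2⟩, h3.symm⟩
    · rintro ⟨⟨h1, h2⟩, h3⟩; exact ⟨h1, h2, h3.symm⟩
  simp only [this] at h
  exact_mod_cast h

lemma sum_internal_leaves_ge (φ : Fin n → Fin r) (G : EdgeSetGraph n) (u : Fin n) {D : ℝ}
    (hD0 : 0 ≤ D) (hD : D ≤ (nbr G u).card) :
    s * D ^ (s - 1) * ((((nbr G u).filter fun y => φ y = φ u).card : ℝ) - s ^ 2) ≤
      ∑ x ∈ Finset.univ.filter (GoodStar (s := s) u),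
        ind (starE u x ⊆ G) * ∑ i, ind (φ (x i) = φ u) := by
  set dI : ℝ := (((nbr G u).filter fun y => φ y = φ u).card : ℝ) with hdI
  set d : ℝ := ((nbr G u).card : ℝ) with hd
  have hs0 : (0 : ℝ) ≤ s := Nat.cast_nonneg _
  rcases le_or_gt dI (s ^ 2) with hlt | hlt
  · refine le_trans (mul_nonpos_of_nonneg_of_nonpos (by positivity) (by linarith)) ?_
    exact Finset.sum_nonneg fun x _ => mul_nonneg (ind_nonneg _)
      (Finset.sum_nonneg fun _ _ => ind_nonneg _)
  · set T := Fintype.piFinset fun _ : Fin s => nbr G u with hT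
    have h1 : ∑ x ∈ T.filter (fun x => Function.Injective x), ∑ i, ind (φ (x i) = φ u) ≤
        ∑ x ∈ Finset.univ.filter (GoodStar (s := s) u),
          ind (starE u x ⊆ G) * ∑ i, ind (φ (x i) = φ u) := by
      have hsub : T.filter (fun x => Function.Injective x) ⊆
          Finset.univ.filter (GoodStar (s := s) u) := by
        intro x hx
        obtain ⟨h1, h2⟩ := Finset.mem_filter.1 hx
        rw [hT, Fintype.mem_piFinset] at h1
        exact Finset.mem_filter.2 ⟨Finset.mem_univ _, h2, fun i => (mem_nbr.1 (h1 i)).1⟩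
      refine le_trans (le_of_eq ?_) (Finset.sum_le_sum_of_subset_of_nonneg hsub fun x _ _ =>
        mul_nonneg (ind_nonneg _) (Finset.sum_nonneg fun _ _ => ind_nonneg _))
      refine Finset.sum_congr rfl fun x hx => ?_
      have hg : GoodStar u x := (Finset.mem_filter.1 (hsub hx)).2
      rw [ind_of ((starE_subset_iff hg).2
        (Fintype.mem_piFinset.1 (Finset.mem_filter.1 hx).1)), one_mul]
    refine le_trans ?_ h1
    have h2 := Finset.sum_filter_add_sum_filter_not T (fun x => Function.Injective x)
      (fun x => ∑ i, ind (φ (x i) = φ u))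
    have h3 : ∑ x ∈ T, ∑ i, ind (φ (x i) = φ u) = s * (d ^ (s - 1) * dI) := by
      rw [Finset.sum_comm, Finset.sum_congr rfl fun i _ =>
        sum_pi_eval (nbr G u) i (fun y => ind (φ y = φ u)), sum_ind]
      simp [hd, hdI]
    have h4 : ∑ x ∈ T.filter (fun x => ¬ Function.Injective x), ∑ i, ind (φ (x i) = φ u) ≤
        s ^ 2 * d ^ (s - 1) * s := by
      refine le_trans (Finset.sum_le_sum (g := fun _ => (s : ℝ)) fun x _ => ?_) ?_
      · refine (Finset.sum_le_card_nsmul _ _ 1 fun _ _ => ind_le_one _).trans (le_of_eq ?_)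
        simp
      · rw [Finset.sum_const, nsmul_eq_mul]
        exact mul_le_mul_of_nonneg_right (card_not_injective_le (nbr G u) s) hs0
    have h5 : D ^ (s - 1) ≤ d ^ (s - 1) := pow_le_pow_left₀ hD0 hD _
    have h6 : s * D ^ (s - 1) * (dI - s ^ 2) ≤ s * d ^ (s - 1) * (dI - s ^ 2) :=
      mul_le_mul_of_nonneg_right (mul_le_mul_of_nonneg_left h5 hs0) (by linarith)
    linarith

/-- In a typical graph, many stars contain internal edges of the canonical cut. -/
lemma Typ.sum_internal_leaves_ge {p ζ : ℝ} {G : EdgeSetGraph n} (h : Typ r p ζ G) (hp : 0 < p)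
    (hn : 0 < n) (hr : 1 ≤ r) (hζ : 0 ≤ ζ) (hζ1 : ζ ≤ 1) (hs : 1 ≤ s)
    (φ : Fin n → Fin r) {ρ : ℝ} (hρ : s * ζ + 2 * ζ + 1 / n + s ^ 2 / (n * p) ≤ ρ) :
    s * (n : ℝ) ^ (s + 1) * p ^ s * (1 / r - ρ) ≤
      ∑ u, ∑ x ∈ Finset.univ.filter (GoodStar (s := s) u),
        ind (starE u x ⊆ G) * ∑ i, ind (φ (x i) = φ u) := by
  have hn' : (0 : ℝ) < n := by exact_mod_cast hn
  have hr' : (1 : ℝ) ≤ r := by exact_mod_cast hr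
  have hs0 : (0 : ℝ) ≤ s := Nat.cast_nonneg _
  set W := ∑ u, ∑ x ∈ Finset.univ.filter (GoodStar (s := s) u),
        ind (starE u x ⊆ G) * ∑ i, ind (φ (x i) = φ u) with hW
  have hW0 : 0 ≤ W := Finset.sum_nonneg fun u _ => Finset.sum_nonneg fun x _ =>
    mul_nonneg (ind_nonneg _) (Finset.sum_nonneg fun _ _ => ind_nonneg _)
  set β : ℝ := 1 / r - 1 / n - 2 * ζ - s ^ 2 / (n * p) with hβ
  have hβρ : 1 / r - ρ ≤ β - s * ζ := by rw [hβ]; linarith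
  rcases le_or_gt (1 / r - ρ) 0 with hneg | hpos
  · exact le_trans (mul_nonpos_of_nonneg_of_nonpos (by positivity) hneg) hW0
  · have hsζ : 0 ≤ s * ζ := by positivity
    have hβ1 : β ≤ 1 := by
      have : 1 / (r : ℝ) ≤ 1 := by rw [div_le_one (by linarith)]; exact hr'
      have h2 : 0 ≤ (s : ℝ) ^ 2 / (n * p) := by positivity
      have h3 : 0 ≤ 1 / (n : ℝ) := by positivity
      rw [hβ]; linarith
    have hβ0 : 0 ≤ β := by linarith
    set D := (1 - ζ) * (n * p) with hD
    have hD0 : 0 ≤ D := mul_nonneg (by linarith) (by positivity)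
    have h1 : s * D ^ (s - 1) * (2 * (intE φ G).card - n * s ^ 2) ≤ W := by
      have := Finset.sum_le_sum fun (u : Fin n) (_ : u ∈ Finset.univ) =>
        _root_.sum_internal_leaves_ge (s := s) φ G u hD0 (h.deg u)
      rw [← Finset.mul_sum, Finset.sum_sub_distrib, sum_card_nbr_filter] at this
      simpa using this
    have h2 : n ^ 2 * p * β ≤ 2 * (intE φ G).card - n * s ^ 2 := by
      have a1 := h.int φ
      have a2 : (2 * (intE φ Finset.univ).card + n : ℝ) = ∑ k, ((cls φ k).card : ℝ) ^ 2 := by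
        exact_mod_cast two_mul_card_intE_univ φ
      have a3 : (n : ℝ) ^ 2 ≤ r * ∑ k, ((cls φ k).card : ℝ) ^ 2 := by
        exact_mod_cast sq_le_mul_sum_sq φ
      have a4 : (n : ℝ) ^ 2 / r ≤ 2 * (intE φ Finset.univ).card + n := by
        rw [a2, div_le_iff₀ (by linarith)]; linarith
      have a5 := mul_le_mul_of_nonneg_left a4 hp.le
      have a6 : n ^ 2 * p * β = p * (n ^ 2 / r) - n * p - 2 * ζ * (n ^ 2 * p) - n * s ^ 2 := by
        rw [hβ]; field_simp
      rw [a6]; linarith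
    have h3 : (n * p) ^ (s - 1) * (1 - s * ζ) ≤ D ^ (s - 1) := by
      rw [hD, mul_pow (1 - ζ), mul_comm (((n : ℝ) * p) ^ (s - 1))]
      refine mul_le_mul_of_nonneg_right ?_ (by positivity)
      have := one_add_mul_le_pow (show (-2 : ℝ) ≤ -ζ by linarith) (s - 1)
      have h4 : ((s - 1 : ℕ) : ℝ) ≤ s := by exact_mod_cast Nat.sub_le s 1
      have : 1 + ((s - 1 : ℕ) : ℝ) * -ζ ≤ (1 - ζ) ^ (s - 1) := by
        simpa [sub_eq_add_neg] using this
      nlinarith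
    have h4 : s * ((n * p) ^ (s - 1) * (1 - s * ζ)) * (n ^ 2 * p * β) ≤ W := by
      refine le_trans ?_ h1
      refine le_trans (mul_le_mul_of_nonneg_right (mul_le_mul_of_nonneg_left h3 hs0)
        (by positivity)) ?_
      exact mul_le_mul_of_nonneg_left h2 (by positivity)
    refine le_trans ?_ h4
    obtain ⟨t, rfl⟩ : ∃ t, s = t + 1 := ⟨s - 1, by omega⟩
    rw [Nat.add_sub_cancel]
    have e1 : ((t + 1 : ℕ) : ℝ) * ((n * p) ^ t * (1 - ((t + 1 : ℕ) : ℝ) * ζ)) * (n ^ 2 * p * β) =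
        ((t + 1 : ℕ) : ℝ) * (n : ℝ) ^ (t + 1 + 1) * p ^ (t + 1) *
          ((1 - ((t + 1 : ℕ) : ℝ) * ζ) * β) := by
      rw [mul_pow]; ring
    rw [e1]
    refine mul_le_mul_of_nonneg_left ?_ (by positivity)
    nlinarith

lemma maxCut_le_sdiff_add [NeZero r] {G : EdgeSetGraph n} {u : Fin n} {x : Fin s → Fin n}
    (hx : GoodStar u x) :
    (maxCut r G : ℝ) - maxCut r (G \ starE u x) ≤
      s - ∑ i, ind (canon r G (x i) = canon r G u) := by
  have h1 := cutE_sdiff_add (canon r G) G (starE u x)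
  rw [card_cutE_canon] at h1
  have h2 := card_cutE_le (canon r G) (G \ starE u x)
  have h3 : (maxCut r G : ℝ) ≤ maxCut r (G \ starE u x) + (cutE (canon r G) (starE u x)).card := by
    exact_mod_cast h1.trans (Nat.add_le_add_right h2 _)
  rw [card_cutE_star hx] at h3
  have h4 : ∑ i, ind (canon r G (x i) ≠ canon r G u) +
      ∑ i, ind (canon r G (x i) = canon r G u) = s := by
    rw [← Finset.sum_add_distrib, Finset.sum_congr rfl (g := fun _ => (1 : ℝ))]
    · simp
    · intro i _
      by_cases h : canon r G (x i) = canon r G u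
      · rw [ind_of h, ind_not (by simpa using h)]; ring
      · rw [ind_not h, ind_of h]; ring
  linarith

lemma maxCut_union_ge [NeZero r] {G : EdgeSetGraph n} {u : Fin n} {x : Fin s → Fin n}
    (hx : GoodStar u x) (φ : Fin n → Fin r) :
    ((cutE φ G).card : ℝ) + ∑ i, ind (φ (x i) ≠ φ u) - ∑ i, ind (x i ∈ nbr G u) ≤
      maxCut r (G ∪ starE u x) := by
  rw [← card_cutE_star hx, ← card_star_inter hx]
  have h1 := cutE_union_ge φ G (starE u x)
  have h2 := card_cutE_le φ (G ∪ starE u x)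
  have h3 : ((cutE φ G).card : ℝ) + (cutE φ (starE u x)).card ≤
      maxCut r (G ∪ starE u x) + (starE u x ∩ G).card := by
    exact_mod_cast h1.trans (Nat.add_le_add_right h2 _)
  linarith

/-- The gain of adding stars at an unstable vertex. -/
lemma sum_gain_ge [NeZero r] {p η : ℝ} {k L : ℕ} {G : EdgeSetGraph n} (h : Typ r p (η ^ 2) G)
    (hp : 0 < p) (hη : 0 ≤ η) (hL : 2 * L / p + n ≤ η ^ 2 * n ^ 2) (hk : 1 ≤ k)
    (hkη : 10 * k * (4 * η) ≤ 1 / (2 * r)) (hηL : 4 * η * k ^ 2 ≤ L)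
    (hLk : 5 * (L : ℝ) ≤ (1 - Real.exp (-(1 / (2 * r) / 10))) * k) (u : Fin n) :
    ∃ g : (Fin (k ^ 2) → Fin n) → ℝ, (∀ x, 0 ≤ g x) ∧
      ind (u ∈ unstable r L G) * ((n : ℝ) ^ (k ^ 2) * L) ≤ ∑ x, g x ∧
      (∀ x, ∑ i, ind (canon r G (x i) ≠ canon r G u) + g x ≤ ((k ^ 2 : ℕ) : ℝ)) ∧
      ∀ x, GoodStar u x → ∑ i, ind (canon r G (x i) ≠ canon r G u) + g x -
        ∑ i, ind (x i ∈ nbr G u) ≤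
        maxCut r (G ∪ starE u x) - maxCut r (G \ starE u x) := by
  have hr1 : 1 ≤ r := Nat.pos_of_ne_zero (NeZero.ne r)
  have hr' : (0 : ℝ) < r := by exact_mod_cast hr1
  set φ := canon r G with hφ
  have hmono : ∀ x : Fin (k ^ 2) → Fin n, (maxCut r (G \ starE u x) : ℝ) ≤ maxCut r G :=
    fun x => by exact_mod_cast maxCut_mono Finset.sdiff_subset
  have hcard : ∀ (f : Fin (k ^ 2) → ℝ), (∀ i, f i ≤ 1) → ∑ i, f i ≤ ((k ^ 2 : ℕ) : ℝ) := by
    intro f hf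
    refine (Finset.sum_le_card_nsmul _ _ 1 fun i _ => hf i).trans (le_of_eq ?_)
    rw [Finset.card_univ, Fintype.card_fin, nsmul_eq_mul, mul_one]
  have hbase : ∀ x : Fin (k ^ 2) → Fin n, GoodStar u x → ∑ i, ind (φ (x i) ≠ φ u) -
      ∑ i, ind (x i ∈ nbr G u) ≤ maxCut r (G ∪ starE u x) - maxCut r (G \ starE u x) := by
    intro x hx
    have h1 := maxCut_union_ge (G := G) hx φ
    have h2 := hmono x
    have h3 : ((cutE φ G).card : ℝ) = maxCut r G := by rw [hφ, card_cutE_canon]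
    linarith
  by_cases hu : u ∈ unstable r L G
  · obtain ⟨_, φ', hnear, hsym⟩ := Finset.mem_filter.1 hu
    have hs := h.sum_sq_le hp (sq_nonneg η) hL (φ := φ) (by rw [hφ, card_cutE_canon]; omega)
    have hs' := h.sum_sq_le hp (sq_nonneg η) hL (φ := φ') hnear
    set ξ : Fin n → ℝ := fun y => ind (φ y = φ u) - ind (φ' y = φ' u) with hξ
    have hξv : ∀ y, ξ y = 0 ∨ ξ y = 1 ∨ ξ y = -1 := by
      intro y
      simp only [hξ, ind]
      split_ifs <;> norm_num
    have hsum : ∑ y, ξ y = (cls φ (φ u)).card - (cls φ' (φ' u)).card := by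
      simp only [hξ, Finset.sum_sub_distrib, sum_ind]; rfl
    have hsq : ∑ y, ξ y ^ 2 =
        (symmDiff (cls φ' (φ' u)) (cls φ (φ u))).card := by
      have : ∀ y, ξ y ^ 2 = ind (y ∈ symmDiff (cls φ' (φ' u)) (cls φ (φ u))) := by
        intro y
        simp only [hξ, ind, Finset.mem_symmDiff, mem_cls]
        by_cases h1 : φ y = φ u <;> by_cases h2 : φ' y = φ' u <;> simp [h1, h2]
      rw [Finset.sum_congr rfl fun y _ => this y, sum_ind]
      congr 2
      ext y; simp
    refine ⟨fun x => max 0 (∑ i, ξ (x i) - L), fun x => le_max_left _ _, ?_, ?_, ?_⟩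
    · rw [ind_of hu, one_mul]
      have hw := sum_posPart_walk_ge ξ hξv hk (L := L) (c := 1 / (2 * r)) (ζ := 4 * η)
        (by positivity) ?_ ?_ hkη hηL hLk
      · rwa [Fintype.card_fin] at hw
      · rw [Fintype.card_fin, hsq]
        have : (n : ℝ) ≤ 2 * r * (symmDiff (cls φ' (φ' u)) (cls φ (φ u))).card := by
          exact_mod_cast hsym
        rw [one_div_mul_eq_div, div_le_iff₀ (by positivity)]
        linarith
      · rw [Fintype.card_fin, hsum]
        have a1 := abs_le.1 (abs_card_cls_sub_le hr1 hη hs (φ u))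
        have a2 := abs_le.1 (abs_card_cls_sub_le hr1 hη hs' (φ' u))
        rw [abs_le]
        constructor <;> linarith [a1.1, a1.2, a2.1, a2.2]
    · intro x
      rcases max_cases 0 (∑ i, ξ (x i) - (L : ℝ)) with ⟨h1, _⟩ | ⟨h1, _⟩
      · simp only [h1, add_zero]
        exact hcard _ fun i => ind_le_one _
      · simp only [h1]
        have : ∑ i, ind (φ (x i) ≠ φ u) + (∑ i, ξ (x i) - (L : ℝ)) ≤
            ∑ i, (ind (φ (x i) ≠ φ u) + ξ (x i)) := by
          rw [Finset.sum_add_distrib]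
          linarith [Nat.cast_nonneg (α := ℝ) L]
        refine this.trans (hcard _ fun i => ?_)
        simp only [hξ, ind]
        split_ifs <;> norm_num
    · intro x hx
      rcases max_cases 0 (∑ i, ξ (x i) - (L : ℝ)) with ⟨h1, _⟩ | ⟨h1, _⟩
      · simp only [h1, add_zero]
        exact hbase x hx
      · simp only [h1]
        have h2 := maxCut_union_ge (G := G) hx φ'
        have h3 := hmono x
        have h4 : (maxCut r G : ℝ) ≤ (cutE φ' G).card + L := by exact_mod_cast hnear
        have h5 : ∑ i, ind (φ (x i) ≠ φ u) + ∑ i, ξ (x i) = ∑ i, ind (φ' (x i) ≠ φ' u) := by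
          rw [← Finset.sum_add_distrib]
          refine Finset.sum_congr rfl fun i _ => ?_
          simp only [hξ, ind]
          by_cases h1 : φ (x i) = φ u <;> by_cases h2 : φ' (x i) = φ' u <;> simp [h1, h2]
        linarith
  · refine ⟨fun _ => 0, fun _ => le_rfl, ?_, ?_, ?_⟩
    · rw [ind_not hu]; simp
    · intro x
      rw [add_zero]
      exact hcard _ fun i => ind_le_one _
    · intro x hx
      rw [add_zero]
      exact hbase x hx

/-- Adding a random star to a typical graph increases the maximum cut substantially. -/
lemma Typ.sum_maxCut_union_ge [NeZero r] {p η : ℝ} {k L : ℕ} {G : EdgeSetGraph n}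
    (h : Typ r p (η ^ 2) G) (hn : 0 < n) (hp : 0 < p) (hη : 0 ≤ η) (hη1 : η ≤ 1)
    (hL : 2 * L / p + n ≤ η ^ 2 * n ^ 2) (hk : 1 ≤ k)
    (hkη : 10 * k * (4 * η) ≤ 1 / (2 * r)) (hηL : 4 * η * k ^ 2 ≤ L)
    (hLk : 5 * (L : ℝ) ≤ (1 - Real.exp (-(1 / (2 * r) / 10))) * k) (hs : s = k ^ 2) {ρ : ℝ}
    (hρ : 4 * η ^ 2 + 2 * p + (s ^ 2 + s) / n ≤ ρ) :
    s * (n : ℝ) ^ (s + 1) * (1 - 1 / r - ρ) + (unstable r L G).card * ((n : ℝ) ^ s * L) ≤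
      ∑ u, ∑ x ∈ Finset.univ.filter (GoodStar (s := s) u),
        ((maxCut r (G ∪ starE u x) : ℝ) - maxCut r (G \ starE u x)) := by
  subst hs
  set s := k ^ 2 with hs
  have hs1 : 1 ≤ s := Nat.one_le_pow _ _ hk
  have hn' : (0 : ℝ) < n := by exact_mod_cast hn
  have hs0 : (0 : ℝ) ≤ s := Nat.cast_nonneg _
  set φ := canon r G with hφ
  choose g hg0 hg1 hg2 hg3 using fun u => sum_gain_ge h hp hη hL hk hkη hηL hLk u
  have hsq := h.sum_sq_le hp (sq_nonneg η) hL (φ := φ) (by rw [hφ, card_cutE_canon]; omega)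
  have hu : ∀ u, (∑ x : Fin s → Fin n, (∑ i, ind (φ (x i) ≠ φ u) + g u x -
        ∑ i, ind (x i ∈ nbr G u))) - s * ((s ^ 2 + s) * (n : ℝ) ^ (s - 1)) ≤
      ∑ x ∈ Finset.univ.filter (GoodStar (s := s) u),
        ((maxCut r (G ∪ starE u x) : ℝ) - maxCut r (G \ starE u x)) := by
    intro u
    have a1 := Finset.sum_filter_add_sum_filter_not (Finset.univ : Finset (Fin s → Fin n))
      (fun x => GoodStar u x) (fun x => ∑ i, ind (φ (x i) ≠ φ u) + g u x -
        ∑ i, ind (x i ∈ nbr G u))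
    have a2 : ∑ x ∈ Finset.univ.filter (fun x : Fin s → Fin n => ¬ GoodStar u x),
        (∑ i, ind (φ (x i) ≠ φ u) + g u x - ∑ i, ind (x i ∈ nbr G u)) ≤
        s * ((s ^ 2 + s) * (n : ℝ) ^ (s - 1)) := by
      refine (Finset.sum_le_card_nsmul _ _ (s : ℝ) fun x _ => ?_).trans ?_
      · have b1 := hg2 u x
        have b2 : 0 ≤ ∑ i, ind (x i ∈ nbr G u) := Finset.sum_nonneg fun _ _ => ind_nonneg _
        linarith
      · rw [nsmul_eq_mul, mul_comm]
        exact mul_le_mul_of_nonneg_left (card_not_goodStar_le u s) hs0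
    have a3 : ∑ x ∈ Finset.univ.filter (GoodStar (s := s) u),
        (∑ i, ind (φ (x i) ≠ φ u) + g u x - ∑ i, ind (x i ∈ nbr G u)) ≤
        ∑ x ∈ Finset.univ.filter (GoodStar (s := s) u),
        ((maxCut r (G ∪ starE u x) : ℝ) - maxCut r (G \ starE u x)) :=
      Finset.sum_le_sum fun x hx => hg3 u x (Finset.mem_filter.1 hx).2
    linarith
  refine le_trans ?_ (Finset.sum_le_sum fun u _ => hu u)
  rw [Finset.sum_sub_distrib]
  simp only [Finset.sum_sub_distrib, Finset.sum_add_distrib]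
  have c1 : ∑ u, ∑ x : Fin s → Fin n, ∑ i, ind (φ (x i) ≠ φ u) =
      s * (n : ℝ) ^ (s - 1) * (n ^ 2 - ∑ k, ((cls φ k).card : ℝ) ^ 2) := by
    have : ∀ u, ∑ x : Fin s → Fin n, ∑ i, ind (φ (x i) ≠ φ u) =
        s * (n : ℝ) ^ (s - 1) * (n - (cls φ (φ u)).card) := by
      intro u
      rw [Finset.sum_comm, Finset.sum_congr rfl fun i _ =>
        sum_fun_eval i (fun y => ind (φ y ≠ φ u)), sum_ind]
      have e := Finset.card_filter_add_card_filter_not (s := (Finset.univ : Finset (Fin n)))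
        (fun y => φ y = φ u)
      rw [Finset.card_univ, Fintype.card_fin] at e
      have e' : ((Finset.univ.filter fun y => φ y ≠ φ u).card : ℝ) =
          n - (cls φ (φ u)).card := by
        rw [eq_sub_iff_add_eq, cls]
        rw [add_comm] at e
        exact_mod_cast e
      rw [e', Fintype.card_fin]
      simp; ring
    rw [Finset.sum_congr rfl fun u _ => this u, ← Finset.mul_sum, Finset.sum_sub_distrib]
    have e2 : ∑ u, ((cls φ (φ u)).card : ℝ) = ∑ k, ((cls φ k).card : ℝ) ^ 2 := by
      exact_mod_cast sum_card_cls_comp φ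
    rw [e2, Finset.sum_const, Finset.card_univ, Fintype.card_fin, nsmul_eq_mul, sq]
  have c2 : ∑ u, ∑ x : Fin s → Fin n, ∑ i, ind (x i ∈ nbr G u) =
      s * (n : ℝ) ^ (s - 1) * (2 * G.card) := by
    have : ∀ u, ∑ x : Fin s → Fin n, ∑ i, ind (x i ∈ nbr G u) =
        s * (n : ℝ) ^ (s - 1) * (nbr G u).card := by
      intro u
      rw [Finset.sum_comm, Finset.sum_congr rfl fun i _ =>
        sum_fun_eval i (fun y => ind (y ∈ nbr G u)), sum_ind]
      simp; ring
    rw [Finset.sum_congr rfl fun u _ => this u, ← Finset.mul_sum]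
    have e2 : ∑ u, ((nbr G u).card : ℝ) = 2 * G.card := by exact_mod_cast sum_card_nbr G
    rw [e2]
  have c3 : (unstable r L G).card * ((n : ℝ) ^ s * L) ≤ ∑ u, ∑ x, g u x := by
    refine le_trans (le_of_eq ?_) (Finset.sum_le_sum fun u _ => hg1 u)
    rw [← Finset.sum_mul, sum_ind, Finset.filter_univ_mem]
  rw [c1, c2]
  have hpow : (n : ℝ) ^ (s + 1) = n ^ (s - 1) * n ^ 2 := by
    rw [← pow_add]; congr 1; omega
  have hP : 0 ≤ s * (n : ℝ) ^ (s - 1) := by positivity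
  have c4 : s * (n : ℝ) ^ (s + 1) * (1 - 1 / r - ρ) ≤
      s * (n : ℝ) ^ (s - 1) * (n ^ 2 - ∑ k, ((cls φ k).card : ℝ) ^ 2) -
        s * (n : ℝ) ^ (s - 1) * (2 * G.card) - n * (s * ((s ^ 2 + s) * (n : ℝ) ^ (s - 1))) := by
    have d1 : s * (n : ℝ) ^ (s - 1) * (n ^ 2 - ∑ k, ((cls φ k).card : ℝ) ^ 2) -
        s * (n : ℝ) ^ (s - 1) * (2 * G.card) - n * (s * ((s ^ 2 + s) * (n : ℝ) ^ (s - 1))) =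
        s * (n : ℝ) ^ (s - 1) * (n ^ 2 - ∑ k, ((cls φ k).card : ℝ) ^ 2 - 2 * G.card -
          n * (s ^ 2 + s)) := by ring
    rw [d1, hpow, ← mul_assoc, mul_assoc]
    refine mul_le_mul_of_nonneg_left ?_ hP
    have d2 := h.tot
    have d3 : n ^ 2 * ((s ^ 2 + s) / n) = n * ((s : ℝ) ^ 2 + s) := by field_simp
    have d4 := mul_le_mul_of_nonneg_left hρ (sq_nonneg (n : ℝ))
    have d5 : (1 + η ^ 2) * (n ^ 2 * p) ≤ 2 * (n ^ 2 * p) :=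
      mul_le_mul_of_nonneg_right (by nlinarith) (by positivity)
    have d6 : (n : ℝ) ^ 2 * (1 - 1 / r - ρ) = n ^ 2 - n ^ 2 / r - n ^ 2 * ρ := by ring
    rw [d6]
    rw [mul_add, mul_add, d3] at d4
    linarith
  have c5 : ∑ _u : Fin n, s * ((s ^ 2 + s) * (n : ℝ) ^ (s - 1)) =
      n * (s * ((s ^ 2 + s) * (n : ℝ) ^ (s - 1))) := by simp
  rw [c5]
  linarith

/-- Rigidity: on average, few vertices are unstable. -/
theorem Ex_card_unstable_le [NeZero r] {p η : ℝ} {k L : ℕ} (hn : 0 < n) (hp : 0 < p)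
    (hp1 : p ≤ 1) (hη : 0 ≤ η) (hη1 : η ≤ 1)
    (hL : 2 * L / p + n ≤ η ^ 2 * n ^ 2) (hk : 1 ≤ k)
    (hkη : 10 * k * (4 * η) ≤ 1 / (2 * r)) (hηL : 4 * η * k ^ 2 ≤ L)
    (hLk : 5 * (L : ℝ) ≤ (1 - Real.exp (-(1 / (2 * r) / 10))) * k) (hs : s = k ^ 2) {ρ₁ ρ₂ : ℝ}
    (hρ₁ : 4 * η ^ 2 + 2 * p + (s ^ 2 + s) / n ≤ ρ₁)
    (hρ₂ : s * η ^ 2 + 2 * η ^ 2 + 1 / n + s ^ 2 / (n * p) ≤ ρ₂) :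
    L * Ex p (fun G : EdgeSetGraph n => ind (Typ r p (η ^ 2) G) * (unstable r L G).card) ≤
      s * n * (1 - Ex p (fun G : EdgeSetGraph n => ind (Typ r p (η ^ 2) G)) + ρ₁ + ρ₂) := by
  have hn' : (0 : ℝ) < n := by exact_mod_cast hn
  have hs1 : 1 ≤ s := by rw [hs]; exact Nat.one_le_pow _ _ hk
  have hs0 : (0 : ℝ) ≤ s := Nat.cast_nonneg _
  set X : EdgeSetGraph n → ℝ := fun G => ∑ u, ∑ x ∈ Finset.univ.filter (GoodStar (s := s) u),
        ((maxCut r (G ∪ starE u x) : ℝ) - maxCut r (G \ starE u x)) with hX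
  set Y : EdgeSetGraph n → ℝ := fun G => ∑ u, ∑ x ∈ Finset.univ.filter (GoodStar (s := s) u),
        ind (starE u x ⊆ G) * ((maxCut r G : ℝ) - maxCut r (G \ starE u x)) with hY
  set τ := Ex p (fun G : EdgeSetGraph n => ind (Typ r p (η ^ 2) G)) with hτ
  set z := Ex p (fun G : EdgeSetGraph n => ind (Typ r p (η ^ 2) G) * (unstable r L G).card) with hz
  have hτ0 : 0 ≤ τ := Ex_nonneg hp.le hp1 fun _ => ind_nonneg _
  have hτ1 : τ ≤ 1 := by
    refine (Ex_mono hp.le hp1 (g := fun _ => 1) fun G => ind_le_one _).trans (le_of_eq ?_)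
    exact Ex_const 1
  have hXY : p ^ s * Ex p X = Ex p Y := by
    rw [hX, hY, Ex_sum, Ex_sum, Finset.mul_sum]
    refine Finset.sum_congr rfl fun u _ => ?_
    rw [Ex_sum, Ex_sum, Finset.mul_sum]
    refine Finset.sum_congr rfl fun x hx => ?_
    have hgs := (Finset.mem_filter.1 hx).2
    rw [Ex_ind_subset_mul (starE u x) (fun G => (maxCut r G : ℝ) - maxCut r (G \ starE u x)),
      card_star hgs]
    congr 2
    funext G
    congr! 3
    · ext a
      simp only [Finset.mem_union]
    · refine (Finset.union_sdiff_right G (starE u x)).symm.trans ?_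
      congr!
  have hXlow : τ * (s * (n : ℝ) ^ (s + 1) * (1 - 1 / r - ρ₁)) + z * ((n : ℝ) ^ s * L) ≤
      Ex p X := by
    rw [hτ, hz, ← Ex_mul_right, ← Ex_mul_right, ← Ex_add]
    refine Ex_mono hp.le hp1 fun G => ?_
    by_cases hG : Typ r p (η ^ 2) G
    · simp only [ind_of hG, one_mul]
      exact hG.sum_maxCut_union_ge hn hp hη hη1 hL hk hkη hηL hLk hs hρ₁
    · simp only [ind_not hG, zero_mul, add_zero, hX]
      refine Finset.sum_nonneg fun u _ => Finset.sum_nonneg fun x _ => sub_nonneg.2 ?_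
      exact_mod_cast maxCut_mono (Finset.sdiff_subset.trans Finset.subset_union_left)
  have hYup : Ex p Y ≤ s * (n : ℝ) ^ (s + 1) * p ^ s -
      τ * (s * (n : ℝ) ^ (s + 1) * p ^ s * (1 / r - ρ₂)) := by
    set S : EdgeSetGraph n → ℝ := fun G =>
      ∑ u, ∑ x ∈ Finset.univ.filter (GoodStar (s := s) u), ind (starE u x ⊆ G) with hS
    have e1 : Ex p S ≤ (n : ℝ) ^ (s + 1) * p ^ s := by
      rw [hS, Ex_sum]
      refine (Finset.sum_le_card_nsmul _ _ ((n : ℝ) ^ s * p ^ s) fun u _ => ?_).trans ?_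
      · rw [Ex_sum]
        refine (Finset.sum_le_card_nsmul _ _ (p ^ s) fun x hx => ?_).trans ?_
        · rw [Ex_ind_subset, card_star (Finset.mem_filter.1 hx).2]
        · rw [nsmul_eq_mul]
          refine mul_le_mul_of_nonneg_right ?_ (by positivity)
          have := Finset.card_filter_le (Finset.univ : Finset (Fin s → Fin n)) (GoodStar u)
          rw [Finset.card_univ, Fintype.card_fun, Fintype.card_fin, Fintype.card_fin] at this
          exact_mod_cast this
      · rw [Finset.card_univ, Fintype.card_fin, nsmul_eq_mul, pow_succ]
        exact le_of_eq (by ring)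
    have e2 : Ex p Y ≤ s * Ex p S - τ * (s * (n : ℝ) ^ (s + 1) * p ^ s * (1 / r - ρ₂)) := by
      rw [hτ, ← Ex_mul_left, ← Ex_mul_right, ← Ex_sub]
      refine Ex_mono hp.le hp1 fun G => ?_
      have f1 : Y G ≤ s * S G - ∑ u, ∑ x ∈ Finset.univ.filter (GoodStar (s := s) u),
          ind (starE u x ⊆ G) * ∑ i, ind (canon r G (x i) = canon r G u) := by
        rw [hY, hS, Finset.mul_sum, ← Finset.sum_sub_distrib]
        refine Finset.sum_le_sum fun u _ => ?_
        rw [Finset.mul_sum, ← Finset.sum_sub_distrib]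
        refine Finset.sum_le_sum fun x hx => ?_
        have := mul_le_mul_of_nonneg_left (maxCut_le_sdiff_add (r := r) (G := G)
          (Finset.mem_filter.1 hx).2) (ind_nonneg (starE u x ⊆ G))
        linarith
      refine f1.trans (sub_le_sub_left ?_ _)
      by_cases hG : Typ r p (η ^ 2) G
      · rw [ind_of hG, one_mul]
        exact hG.sum_internal_leaves_ge hp hn (Nat.pos_of_ne_zero (NeZero.ne r)) (sq_nonneg η)
          (by nlinarith) hs1 _ hρ₂
      · rw [ind_not hG, zero_mul]
        exact Finset.sum_nonneg fun u _ => Finset.sum_nonneg fun x _ => mul_nonneg (ind_nonneg _)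
          (Finset.sum_nonneg fun _ _ => ind_nonneg _)
    have := mul_le_mul_of_nonneg_left e1 hs0
    linarith
  have hfin := mul_le_mul_of_nonneg_left hXlow (pow_nonneg hp.le s)
  rw [hXY] at hfin
  have hfin2 := hfin.trans hYup
  have hpos : 0 < p ^ s * (n : ℝ) ^ s := by positivity
  have hρ1 : 0 ≤ ρ₁ := le_trans (by positivity) hρ₁
  have hρ2 : 0 ≤ ρ₂ := le_trans (by positivity) hρ₂
  have key : p ^ s * (n : ℝ) ^ s * (L * z) ≤
      p ^ s * (n : ℝ) ^ s * (s * n * (1 - τ + τ * (ρ₁ + ρ₂))) := by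
    have e : p ^ s * (n : ℝ) ^ s * (s * n * (1 - τ + τ * (ρ₁ + ρ₂))) =
        s * (n : ℝ) ^ (s + 1) * p ^ s -
        τ * (s * (n : ℝ) ^ (s + 1) * p ^ s * (1 / r - ρ₂)) -
        p ^ s * (τ * (s * (n : ℝ) ^ (s + 1) * (1 - 1 / r - ρ₁))) := by
      rw [pow_succ]; ring
    rw [e]
    linarith
  have key2 := le_of_mul_le_mul_left key hpos
  refine key2.trans (mul_le_mul_of_nonneg_left ?_ (by positivity))
  nlinarith

end RigidityExpectation

section Interface

variable {n r : ℕ}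

lemma card_edgeType (n : ℕ) : Fintype.card (EdgeType n) = n.choose 2 := by
  have := Sym2.card_subtype_not_diag (α := Fin n)
  rw [Fintype.card_fin] at this
  rw [← this]

lemma prGnp_eq_Ex (n : ℕ) (p : ℝ) (A : EdgeSetGraph n → Prop) :
    prGnp n p A = Ex p (fun G : EdgeSetGraph n => ind (A G)) := by
  unfold prGnp Ex wt ind
  rw [Finset.sum_filter]
  refine Finset.sum_congr rfl fun G _ => ?_
  rw [card_edgeType]
  by_cases h : A G <;> simp [h]

variable {V : Type*}

/-- All largest `H`-free subgraphs of `G` are `r`-partite. -/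
def Bad {V : Type} (r : ℕ) (H : SimpleGraph V) (G : EdgeSetGraph n) : Prop :=
  ∀ F ⊆ G, HFree H F → (∀ F' ⊆ G, HFree H F' → F'.card ≤ F.card) → IsRPartite r F

lemma Bad.card_le {V : Type} {H : SimpleGraph V} {G F : EdgeSetGraph n} (h : Bad r H G)
    (hF : F ⊆ G) (hfree : HFree H F) : F.card ≤ maxCut r G := by
  obtain ⟨F', hF', hmax⟩ := Finset.exists_max_image
    (G.powerset.filter fun F => HFree H F) Finset.card
    ⟨F, Finset.mem_filter.2 ⟨Finset.mem_powerset.2 hF, hfree⟩⟩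
  obtain ⟨h1, h2⟩ := Finset.mem_filter.1 hF'
  have hsub := Finset.mem_powerset.1 h1
  have hall : ∀ F₂ ⊆ G, HFree H F₂ → F₂.card ≤ F'.card := fun F₂ a b =>
    hmax F₂ (Finset.mem_filter.2 ⟨Finset.mem_powerset.2 a, b⟩)
  exact (hall F hF hfree).trans ((h F' hsub h2 hall).card_le_maxCut hsub)

variable [Fintype V]

/-- The edges of a graph as a finset. -/
def ed (H : SimpleGraph V) : Finset (Sym2 V) := Finset.univ.filter fun d => d ∈ H.edgeSet

lemma mem_ed {H : SimpleGraph V} {d : Sym2 V} : d ∈ ed H ↔ d ∈ H.edgeSet := by simp [ed]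

lemma card_ed (H : SimpleGraph V) : (ed H).card = H.edgeSet.ncard := by
  have : H.edgeSet = (ed H : Set (Sym2 V)) := by ext d; simp [mem_ed]
  rw [this, Set.ncard_coe_finset]

lemma ed_not_isDiag {H : SimpleGraph V} {d : Sym2 V} (h : d ∈ ed H) : ¬ d.IsDiag :=
  H.not_isDiag_of_mem_edgeSet (mem_ed.1 h)

lemma containsCopy_iff {V : Type} [Fintype V] {H : SimpleGraph V} {G : EdgeSetGraph n} :
    ContainsCopy H G ↔ ∃ ψ : V ↪ Fin n, im (ed H) ψ ⊆ G := by
  constructor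
  · rintro ⟨f, hf⟩
    refine ⟨⟨f, hf⟩, fun e he => ?_⟩
    obtain ⟨d, hd, h⟩ := mem_im.1 he
    rw [mem_ed] at hd
    induction d using Sym2.ind with
    | _ a b =>
      have hadj : (SimpleGraph.fromEdgeSet _).Adj _ _ := f.map_adj hd
      rw [SimpleGraph.fromEdgeSet_adj] at hadj
      obtain ⟨⟨e', he', h'⟩, _⟩ := hadj
      have : e = e' := Subtype.ext (by rw [h', ← h]; rfl)
      rwa [this]
  · rintro ⟨ψ, hψ⟩
    refine ⟨⟨ψ, ?_⟩, ψ.injective⟩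
    intro a b hab
    have hne : ψ a ≠ ψ b := fun h => hab.ne (ψ.injective h)
    refine (SimpleGraph.fromEdgeSet_adj _).2 ?_
    refine ⟨⟨mkE hne, hψ (mem_im.2 ⟨s(a, b), mem_ed.2 hab, rfl⟩), rfl⟩, hne⟩

/-- An embedding of a graph that is not `r`-colourable has a monochromatic edge. -/
lemma exists_not_crosses {H : SimpleGraph V} (hr : ¬ H.Colorable r) (φ : Fin n → Fin r)
    (ψ : V ↪ Fin n) : ∃ e ∈ im (ed H) ψ, ¬ Crosses φ e := by
  by_contra hcon
  push Not at hcon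
  refine hr ⟨SimpleGraph.Coloring.mk (fun a => φ (ψ a)) ?_⟩
  intro a b hab
  have hne : ψ a ≠ ψ b := fun h => hab.ne (ψ.injective h)
  exact (crosses_mkE φ hne).1 (hcon (mkE hne) (mem_im.2 ⟨s(a, b), mem_ed.2 hab, rfl⟩))

/-- The embeddings that become copies of `H` when the internal edge `e` is added to the cut. -/
def compls (H : SimpleGraph V) (φ : Fin n → Fin r) (G : EdgeSetGraph n) (e : EdgeType n) :
    Finset (V ↪ Fin n) :=
  Finset.univ.filter fun ψ => im (ed H) ψ ⊆ G ∧ e ∈ im (ed H) ψ ∧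
    ∀ e' ∈ im (ed H) ψ, e' ≠ e → Crosses φ e'

lemma mem_compls {H : SimpleGraph V} {φ : Fin n → Fin r} {G : EdgeSetGraph n} {e : EdgeType n}
    {ψ : V ↪ Fin n} : ψ ∈ compls H φ G e ↔ im (ed H) ψ ⊆ G ∧ e ∈ im (ed H) ψ ∧
      ∀ e' ∈ im (ed H) ψ, e' ≠ e → Crosses φ e' := by
  unfold compls
  rw [Finset.mem_filter]
  exact ⟨fun h => h.2, fun h => ⟨Finset.mem_univ _, h⟩⟩

/-- Internal edges that can be added to the cut without creating a copy of `H`. -/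
def unc (H : SimpleGraph V) (φ : Fin n → Fin r) (G : EdgeSetGraph n) : EdgeSetGraph n :=
  (intE φ G).filter fun e => compls H φ G e = ∅

lemma Bad.unc_eq_empty {V : Type} [Fintype V] [NeZero r] {H : SimpleGraph V}
    (hr : ¬ H.Colorable r) {G : EdgeSetGraph n} (h : Bad r H G) :
    unc H (canon r G) G = ∅ := by
  by_contra hne
  obtain ⟨e, he⟩ := Finset.nonempty_iff_ne_empty.2 hne
  obtain ⟨h1, h2⟩ := Finset.mem_filter.1 he
  obtain ⟨heG, hinner⟩ := Finset.mem_filter.1 h1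
  set φ := canon r G with hφ
  have hnot : e ∉ cutE φ G := fun hh => hinner (Finset.mem_filter.1 hh).2
  have hsub : insert e (cutE φ G) ⊆ G :=
    Finset.insert_subset heG (Finset.filter_subset _ _)
  have hfree : HFree H (insert e (cutE φ G)) := by
    intro hc
    obtain ⟨ψ, hψ⟩ := containsCopy_iff.1 hc
    obtain ⟨e', he', hcr⟩ := exists_not_crosses hr φ ψ
    have hee : e' = e := by
      rcases Finset.mem_insert.1 (hψ he') with h3 | h3
      · exact h3
      · exact absurd (Finset.mem_filter.1 h3).2 hcr
    have : ψ ∈ compls H φ G e := by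
      refine mem_compls.2 ⟨hψ.trans hsub, hee ▸ he', fun e'' he'' hn => ?_⟩
      rcases Finset.mem_insert.1 (hψ he'') with h3 | h3
      · exact absurd h3 hn
      · exact (Finset.mem_filter.1 h3).2
    rw [h2] at this
    exact Finset.notMem_empty _ this
  have := h.card_le hsub hfree
  rw [Finset.card_insert_of_notMem hnot, hφ, card_cutE_canon] at this
  omega

lemma exists_card_le_cnt {ι E : Type*} [Fintype ι] (A : ι → Finset E) (G : Finset E) (g : ι → E) :
    ∃ T : Finset E, T.card ≤ cnt A Finset.univ G ∧ ∀ i, A i ⊆ G → g i ∈ T :=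
  ⟨(Finset.univ.filter fun i => A i ⊆ G).image g, Finset.card_image_le,
    fun _ hi => Finset.mem_image_of_mem g (Finset.mem_filter.2 ⟨Finset.mem_univ _, hi⟩)⟩

/-- If the maximum cut is optimal then there are many copies of `H`. -/
lemma Bad.card_intE_le_cnt {V : Type} [Fintype V] [NeZero r] {H : SimpleGraph V}
    (hed : (ed H).Nonempty) {G : EdgeSetGraph n} (h : Bad r H G) :
    (intE (canon r G) G).card ≤
      cnt (fun ψ : V ↪ Fin n => im (ed H) ψ) Finset.univ G := by
  have hne : ∀ ψ : V ↪ Fin n, ∃ e : EdgeType n, e ∈ im (ed H) ψ := by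
    intro ψ
    obtain ⟨d, hd⟩ := hed
    exact ⟨⟨Sym2.map ψ d, not_isDiag_map ψ (ed_not_isDiag hd)⟩, mem_im.2 ⟨d, hd, rfl⟩⟩
  choose g hg using hne
  obtain ⟨T, hTc, hT⟩ : ∃ T : EdgeSetGraph n,
      T.card ≤ cnt (fun ψ : V ↪ Fin n => im (ed H) ψ) Finset.univ G ∧
      ∀ ψ : V ↪ Fin n, im (ed H) ψ ⊆ G → g ψ ∈ T :=
    exists_card_le_cnt _ G g
  have hfree : HFree H (G \ T) := by
    intro hc
    obtain ⟨ψ, hψ⟩ := containsCopy_iff.1 hc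
    exact (Finset.mem_sdiff.1 (hψ (hg ψ))).2 (hT ψ (hψ.trans Finset.sdiff_subset))
  have h1 := h.card_le Finset.sdiff_subset hfree
  have h2 : G.card - T.card ≤ (G \ T).card := Finset.le_card_sdiff T G
  have h3 := card_cutE_add_card_intE (canon r G) G
  rw [card_cutE_canon] at h3
  refine le_trans ?_ hTc
  exact Nat.le_of_add_le_add_left (a := maxCut r G) (by
    rw [h3]
    exact (Nat.sub_le_iff_le_add.1 (h2.trans h1)))

lemma card_intE_univ_ge (φ : Fin n → Fin r) (hr : 1 ≤ r) (hn : 2 * r ≤ n) :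
    (n : ℝ) ^ 2 / (4 * r) ≤ (intE φ (Finset.univ : EdgeSetGraph n)).card := by
  have hr' : (0 : ℝ) < r := by exact_mod_cast hr
  have a2 : (2 * (intE φ Finset.univ).card + n : ℝ) = ∑ k, ((cls φ k).card : ℝ) ^ 2 := by
    exact_mod_cast two_mul_card_intE_univ φ
  have a3 : (n : ℝ) ^ 2 ≤ r * ∑ k, ((cls φ k).card : ℝ) ^ 2 := by
    exact_mod_cast sq_le_mul_sum_sq φ
  have hn' : (2 * r : ℝ) ≤ n := by exact_mod_cast hn
  rw [div_le_iff₀ (by positivity)]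
  rw [← a2] at a3
  nlinarith

lemma card_intE_univ_le (φ : Fin n → Fin r) :
    ((intE φ (Finset.univ : EdgeSetGraph n)).card : ℝ) ≤ (n : ℝ) ^ 2 / 2 := by
  have h1 : (intE φ (Finset.univ : EdgeSetGraph n)).card ≤ n.choose 2 := by
    rw [← card_edgeType]; exact Finset.card_le_univ _
  have h2 : ((n.choose 2 : ℕ) : ℝ) ≤ (n : ℝ) ^ 2 / 2 := by
    rw [Nat.cast_choose_two]
    nlinarith [Nat.cast_nonneg (α := ℝ) n]
  exact le_trans (by exact_mod_cast h1) h2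

lemma intE_univ_inter (φ : Fin n → Fin r) (G : EdgeSetGraph n) :
    intE φ Finset.univ ∩ G = intE φ G := by
  ext e; simp [intE, and_comm]

lemma Ex_intE_lower_tail {p : ℝ} (h0 : 0 ≤ p) (h1 : p ≤ 1) (φ : Fin n → Fin r) {B t : ℝ}
    (ht : 0 < t) (hB : p * (intE φ (Finset.univ : EdgeSetGraph n)).card ≤ B) :
    Ex p (fun G : EdgeSetGraph n => ind (((intE φ G).card : ℝ) ≤
      p * (intE φ (Finset.univ : EdgeSetGraph n)).card - t)) ≤ Real.exp (-(t ^ 2 / (8 * B))) := by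
  refine le_trans (le_of_eq ?_) (Ex_inter_lower_tail h0 h1 (intE φ Finset.univ) ht hB)
  congr 1
  funext G
  rw [← intE_univ_inter]
  congr!

/-- The sparse regime. -/
theorem Ex_bad_le_sparse {V : Type} [Fintype V] [NeZero r] {H : SimpleGraph V} {p : ℝ}
    (hp : 0 < p) (hp1 : p ≤ 1) (hn : 2 * r ≤ n) (hed : 1 ≤ (ed H).card)
    (hV : 2 ≤ Fintype.card V) :
    Ex p (fun G : EdgeSetGraph n => ind (Bad r H G)) ≤
      (r : ℝ) ^ n * Real.exp (-(n ^ 2 * p / (256 * r ^ 2))) +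
        8 * r * ((n : ℝ) ^ (Fintype.card V - 2) * p ^ ((ed H).card - 1)) := by
  have hr1 : 1 ≤ r := Nat.pos_of_ne_zero (NeZero.ne r)
  have hr' : (0 : ℝ) < r := by exact_mod_cast hr1
  have hn' : (0 : ℝ) < n := by
    have : 0 < n := by omega
    exact_mod_cast this
  set a : ℝ := n ^ 2 * p / (8 * r) with ha
  have ha0 : 0 < a := by positivity
  set A := fun ψ : V ↪ Fin n => im (ed H) ψ with hA
  have h1 : ∀ G : EdgeSetGraph n, ind (Bad r H G) ≤
      ind (∃ φ ∈ (Finset.univ : Finset (Fin n → Fin r)),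
        ((intE φ G).card : ℝ) ≤ p * (intE φ Finset.univ).card - a) +
      ind (a ≤ (cnt A Finset.univ G : ℝ)) := by
    intro G
    refine ind_le_of (add_nonneg (ind_nonneg _) (ind_nonneg _)) fun hG => ?_
    by_cases hc : a ≤ (cnt A Finset.univ G : ℝ)
    · rw [ind_of hc]; linarith [ind_nonneg (∃ φ ∈ (Finset.univ : Finset (Fin n → Fin r)),
        ((intE φ G).card : ℝ) ≤ p * (intE φ Finset.univ).card - a)]
    · rw [ind_of (P := ∃ φ ∈ (Finset.univ : Finset (Fin n → Fin r)), _)]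
      · linarith [ind_nonneg (a ≤ (cnt A Finset.univ G : ℝ))]
      · refine ⟨canon r G, Finset.mem_univ _, ?_⟩
        push Not at hc
        have h2 : ((intE (canon r G) G).card : ℝ) ≤ cnt A Finset.univ G := by
          exact_mod_cast hG.card_intE_le_cnt (Finset.card_pos.1 hed)
        have h3 := mul_le_mul_of_nonneg_left (card_intE_univ_ge (canon r G) hr1 hn) hp.le
        have h4 : p * ((n : ℝ) ^ 2 / (4 * r)) = 2 * a := by rw [ha]; field_simp; norm_num
        linarith
  refine (Ex_mono hp.le hp1 h1).trans ?_
  rw [Ex_add]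
  refine add_le_add ?_ ?_
  · refine (Ex_ind_exists_le hp.le hp1 _ _).trans ?_
    refine (Finset.sum_le_card_nsmul _ _ (Real.exp (-(n ^ 2 * p / (256 * r ^ 2))))
      fun φ _ => ?_).trans ?_
    · refine (Ex_intE_lower_tail hp.le hp1 φ ha0
        (B := n ^ 2 * p / 2) ?_).trans (le_of_eq ?_)
      · have := mul_le_mul_of_nonneg_left (card_intE_univ_le φ) hp.le
        linarith
      · congr 2
        rw [ha]; field_simp; norm_num
    · rw [Finset.card_univ, Fintype.card_fun, Fintype.card_fin, Fintype.card_fin, nsmul_eq_mul]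
      push_cast
      exact le_rfl
  · refine (Ex_markov hp.le hp1 (fun G => Nat.cast_nonneg _) ha0).trans ?_
    rw [Ex_cnt, div_le_iff₀ ha0]
    rw [Finset.sum_congr rfl (g := fun _ => p ^ (ed H).card) fun ψ _ => by
      rw [hA, card_im fun d hd => ed_not_isDiag hd]]
    rw [Finset.sum_const, nsmul_eq_mul, Finset.card_univ]
    refine (mul_le_mul_of_nonneg_right card_embedding_le (by positivity)).trans (le_of_eq ?_)
    obtain ⟨v, hv⟩ : ∃ v, Fintype.card V = v + 2 := ⟨Fintype.card V - 2, by omega⟩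
    obtain ⟨h, hh⟩ : ∃ h, (ed H).card = h + 1 := ⟨(ed H).card - 1, by omega⟩
    rw [hv, hh, ha, Nat.add_sub_cancel, Nat.add_sub_cancel]
    field_simp
    ring

end Interface

section AbstractSwitching

variable {E : Type*} [Fintype E] [DecidableEq E]

lemma wt_eq_sdiff_mul {p : ℝ} (hp1 : p < 1) {G T : Finset E} (hT : T ⊆ G) :
    wt p G = wt p (G \ T) * (p / (1 - p)) ^ T.card := by
  have h1 : (0 : ℝ) < 1 - p := by linarith
  have h2 : (G \ T).card + T.card = G.card := Finset.card_sdiff_add_card_eq_card hT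
  have h3 : G.card ≤ Fintype.card E := Finset.card_le_univ _
  unfold wt
  obtain ⟨x, hx⟩ : ∃ x, Fintype.card E = G.card + x := ⟨Fintype.card E - G.card, by omega⟩
  have h4 : Fintype.card E - G.card = x := by omega
  have h5 : Fintype.card E - (G \ T).card = x + T.card := by omega
  have h6 : (1 - p) ^ T.card ≠ 0 := (pow_pos h1 _).ne'
  rw [h4, h5, ← h2, div_pow, pow_add, pow_add]
  generalize (1 - p) ^ T.card = a at *
  rw [mul_div_assoc', eq_div_iff h6]
  ring

/-- If every marked edge `e` of a set `G` can be recovered, up to few choices, after deleting a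
set `T G e`, and `T G e` lies in a small set known after the deletion, then there are few marked
edges on average. -/
theorem Ex_card_switch {p : ℝ} (hp : 0 ≤ p) (hp1 : p < 1) (Good : Finset E → Finset E)
    (T : Finset E → E → Finset E) (hT : ∀ G, ∀ e ∈ Good G, T G e ⊆ G)
    (X : Finset E → E → Finset E) (hX : ∀ G, ∀ e ∈ Good G, T G e ⊆ X (G \ T G e) e)
    (U : Finset E → Finset E) (hU : ∀ G, ∀ e ∈ Good G, e ∈ U (G \ T G e)) {Y : ℕ} {M : ℝ}
    (hY : ∀ G, ∀ e ∈ Good G, (U (G \ T G e)).card ≤ Y) (hM0 : 0 ≤ M)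
    (hM : ∀ G, ∀ e ∈ Good G, (1 + p / (1 - p)) ^ (X (G \ T G e) e).card ≤ M) :
    Ex p (fun G => ((Good G).card : ℝ)) ≤ Y * M := by
  have h1 : (0 : ℝ) < 1 - p := by linarith
  set ρ : ℝ := p / (1 - p) with hρ
  have hρ0 : 0 ≤ ρ := by positivity
  set R : Finset E → E → Prop := fun G' e => ∃ G, e ∈ Good G ∧ G \ T G e = G' with hR
  set P : Finset (Finset E × E) := Finset.univ.filter fun x => x.2 ∈ Good x.1 with hP
  set Q : Finset (Finset E × E × Finset E) := Finset.univ.filter fun y =>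
    y.2.1 ∈ (U y.1).filter (R y.1) ∧ y.2.2 ∈ (X y.1 y.2.1).powerset with hQ
  set i : Finset E × E → Finset E × E × Finset E := fun x =>
    (x.1 \ T x.1 x.2, x.2, T x.1 x.2) with hi
  set g : Finset E × E × Finset E → ℝ := fun y => wt p y.1 * ρ ^ y.2.2.card with hg
  have hw : ∀ G : Finset E, 0 ≤ wt p G := fun G => wt_nonneg hp hp1.le G
  have e1 : Ex p (fun G => ((Good G).card : ℝ)) = ∑ x ∈ P, wt p x.1 := by
    rw [hP, Finset.sum_filter, Fintype.sum_prod_type]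
    unfold Ex
    refine Finset.sum_congr rfl fun G _ => ?_
    rw [← Finset.sum_filter]
    change wt p G * ((Good G).card : ℝ) = ∑ e ∈ Finset.univ.filter (fun e => e ∈ Good G), wt p G
    have hf : (Finset.univ.filter fun e => e ∈ Good G) = Good G := by ext e; simp
    rw [hf, Finset.sum_const, nsmul_eq_mul, mul_comm]
  have e2 : ∑ x ∈ P, wt p x.1 = ∑ y ∈ P.image i, g y := by
    rw [Finset.sum_image]
    · refine Finset.sum_congr rfl fun x hx => ?_
      exact wt_eq_sdiff_mul hp1 (hT _ _ (Finset.mem_filter.1 hx).2)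
    · intro x hx x' hx' h
      have hx2 := hT _ _ (Finset.mem_filter.1 hx).2
      have hx2' := hT _ _ (Finset.mem_filter.1 hx').2
      simp only [hi, Prod.mk.injEq] at h
      refine Prod.ext ?_ h.2.1
      rw [← Finset.sdiff_union_of_subset hx2, ← Finset.sdiff_union_of_subset hx2', h.1, h.2.2]
  have e3 : ∑ y ∈ P.image i, g y ≤ ∑ y ∈ Q, g y := by
    refine Finset.sum_le_sum_of_subset_of_nonneg ?_ fun y _ _ => ?_
    · intro y hy
      obtain ⟨x, hx, rfl⟩ := Finset.mem_image.1 hy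
      have hx2 := (Finset.mem_filter.1 hx).2
      refine Finset.mem_filter.2 ⟨Finset.mem_univ _, Finset.mem_filter.2 ⟨hU _ _ hx2, ?_⟩,
        Finset.mem_powerset.2 (hX _ _ hx2)⟩
      exact ⟨x.1, hx2, rfl⟩
    · exact mul_nonneg (hw _) (by positivity)
  have e4 : ∑ y ∈ Q, g y = ∑ G', wt p G' * ∑ e ∈ (U G').filter (R G'),
      (1 + ρ) ^ (X G' e).card := by
    rw [hQ, Finset.sum_filter, Fintype.sum_prod_type]
    refine Finset.sum_congr rfl fun G' _ => ?_
    rw [Fintype.sum_prod_type, Finset.mul_sum]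
    rw [← Finset.sum_filter_add_sum_filter_not Finset.univ (fun e => e ∈ (U G').filter (R G'))]
    have z : ∑ e ∈ Finset.univ.filter (fun e => ¬ e ∈ (U G').filter (R G')),
        ∑ S : Finset E, (if e ∈ (U G').filter (R G') ∧ S ∈ (X G' e).powerset then
          g (G', e, S) else 0) = 0 := by
      refine Finset.sum_eq_zero fun e he => Finset.sum_eq_zero fun S _ => ?_
      rw [if_neg fun hc => (Finset.mem_filter.1 he).2 hc.1]
    rw [z, add_zero]
    have z2 : (Finset.univ.filter fun e => e ∈ (U G').filter (R G')) = (U G').filter (R G') := by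
      ext e; simp
    rw [z2]
    refine Finset.sum_congr rfl fun e he => ?_
    have := Finset.prod_one_add (s := X G' e) (f := fun _ => ρ)
    rw [Finset.prod_const] at this
    rw [this, Finset.mul_sum, ← Finset.sum_filter]
    refine Finset.sum_congr ?_ fun S hS => ?_
    · ext S
      simp only [Finset.mem_filter, Finset.mem_univ, true_and]
      exact ⟨fun h => h.2, fun h => ⟨Finset.mem_filter.1 he, h⟩⟩
    · rw [hg, Finset.prod_const]
  rw [e1, e2]
  refine e3.trans (e4.le.trans ?_)
  have e5 : ∀ G', wt p G' * ∑ e ∈ (U G').filter (R G'), (1 + ρ) ^ (X G' e).card ≤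
      wt p G' * (Y * M) := by
    intro G'
    refine mul_le_mul_of_nonneg_left ?_ (hw _)
    have hYM : (0 : ℝ) ≤ Y * M := by positivity
    rcases Finset.eq_empty_or_nonempty ((U G').filter (R G')) with h0 | ⟨e, he⟩
    · rw [h0, Finset.sum_empty]; exact hYM
    · obtain ⟨_, G, hG, rfl⟩ := Finset.mem_filter.1 he
      refine (Finset.sum_le_card_nsmul _ _ M fun e' he' => ?_).trans ?_
      · obtain ⟨_, G₂, hG₂, h₂⟩ := Finset.mem_filter.1 he'
        rw [← h₂]
        exact hM _ _ hG₂
      · rw [nsmul_eq_mul]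
        refine mul_le_mul_of_nonneg_right ?_ hM0
        have := (Finset.card_filter_le (U (G \ T G e)) (R (G \ T G e))).trans (hY _ _ hG)
        exact_mod_cast this
  refine (Finset.sum_le_sum fun G' _ => e5 G').trans (le_of_eq ?_)
  exact Ex_const (Y * M)

end AbstractSwitching

section GraphSwitching

variable {V : Type} [Fintype V] {n r : ℕ}

instance finite_graphIso {W W' : Type*} [Finite W] [Finite W'] (H : SimpleGraph W)
    (H' : SimpleGraph W') : Finite (H ≃g H') :=
  Finite.of_injective (fun σ : H ≃g H' => σ.toEquiv) RelIso.toEquiv_injective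

lemma im_comp_iso (H : SimpleGraph V) (σ : H ≃g H) (ψ : V ↪ Fin n) :
    im (ed H) (σ.toEquiv.toEmbedding.trans ψ) = im (ed H) ψ := by
  have key : ∀ (σ : H ≃g H), ∀ e ∈ im (ed H) (σ.toEquiv.toEmbedding.trans ψ), e ∈ im (ed H) ψ := by
    intro σ e he
    obtain ⟨d, hd, h⟩ := mem_im.1 he
    refine mem_im.2 ⟨Sym2.map σ d, ?_, ?_⟩
    · rw [mem_ed] at hd ⊢
      induction d using Sym2.ind with
      | _ a b => exact σ.map_adj_iff.2 hd
    · rw [← h, Sym2.map_map]; rfl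
  refine Finset.Subset.antisymm (key σ) fun e he => ?_
  obtain ⟨d, hd, h⟩ := mem_im.1 he
  refine mem_im.2 ⟨Sym2.map σ.symm d, ?_, ?_⟩
  · rw [mem_ed] at hd ⊢
    induction d using Sym2.ind with
    | _ a b => exact σ.symm.map_adj_iff.2 hd
  · rw [← h, Sym2.map_map]
    congr 1
    funext x
    exact congrArg ψ (σ.apply_symm_apply x)

lemma card_iso_mul_card_image_le (H : SimpleGraph V) (A : Finset (V ↪ Fin n))
    (hA : ∀ ψ ψ', im (ed H) ψ = im (ed H) ψ' → ψ ∈ A → ψ' ∈ A) :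
    Nat.card (H ≃g H) * (A.image (im (ed H))).card ≤ A.card := by
  refine Finset.mul_card_image_le_card _ _ fun S hS => ?_
  obtain ⟨ψ, hψ, rfl⟩ := Finset.mem_image.1 hS
  have := Fintype.ofFinite (H ≃g H)
  rw [Nat.card_eq_fintype_card, ← Finset.card_univ]
  refine Finset.card_le_card_of_injOn (fun σ => σ.toEquiv.toEmbedding.trans ψ) ?_ ?_
  · intro σ _
    exact Finset.mem_coe.2 (Finset.mem_filter.2
      ⟨hA ψ _ (im_comp_iso H σ ψ).symm hψ, im_comp_iso H σ ψ⟩)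
  · intro σ _ σ' _ h
    refine RelIso.toEquiv_injective (Equiv.ext fun x => ψ.injective ?_)
    exact DFunLike.congr_fun h x

/-- A designated element of `S` other than `e`. -/
def tgt {E : Type*} (S : Finset E) (e : E) : E :=
  if h : ∃ e' ∈ S, e' ≠ e then h.choose else e

lemma tgt_spec {E : Type*} {S : Finset E} (hS : 2 ≤ S.card) (e : E) :
    tgt S e ∈ S ∧ tgt S e ≠ e := by
  have h : ∃ e' ∈ S, e' ≠ e := Finset.exists_mem_ne (by omega) e
  unfold tgt
  rw [dif_pos h]
  exact h.choose_spec

/-- Embeddings in which `e` is the only edge not crossing `φ` (apart possibly from edges equal to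
`e`) and all edges other than the designated one belong to `G`. -/
def lab (H : SimpleGraph V) (φ : Fin n → Fin r) (G : EdgeSetGraph n) (e : EdgeType n) :
    Finset (V ↪ Fin n) :=
  Finset.univ.filter fun ψ => e ∈ im (ed H) ψ ∧
    (∀ e' ∈ im (ed H) ψ, e' ≠ e → Crosses φ e') ∧
    ∀ e' ∈ im (ed H) ψ, e' ≠ tgt (im (ed H) ψ) e → e' ∈ G

lemma mem_lab {H : SimpleGraph V} {φ : Fin n → Fin r} {G : EdgeSetGraph n} {e : EdgeType n}
    {ψ : V ↪ Fin n} : ψ ∈ lab H φ G e ↔ e ∈ im (ed H) ψ ∧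
    (∀ e' ∈ im (ed H) ψ, e' ≠ e → Crosses φ e') ∧
    ∀ e' ∈ im (ed H) ψ, e' ≠ tgt (im (ed H) ψ) e → e' ∈ G := by
  unfold lab
  rw [Finset.mem_filter]
  exact ⟨fun h => h.2, fun h => ⟨Finset.mem_univ _, h⟩⟩

lemma lab_mono (H : SimpleGraph V) (φ : Fin n → Fin r) {G G' : EdgeSetGraph n} (hG : G' ⊆ G)
    (e : EdgeType n) : lab H φ G' e ⊆ lab H φ G e := by
  intro ψ hψ
  rw [mem_lab] at hψ ⊢
  exact ⟨hψ.1, hψ.2.1, fun e' h1 h2 => hG (hψ.2.2 e' h1 h2)⟩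

/-- Pairs of intersecting copies of `H`, the first one through `e`. -/
def prs (H : SimpleGraph V) (G : EdgeSetGraph n) (e : EdgeType n) :
    Finset ((V ↪ Fin n) × (V ↪ Fin n)) :=
  Finset.univ.filter fun x => im (ed H) x.1 ⊆ G ∧ im (ed H) x.2 ⊆ G ∧ e ∈ im (ed H) x.1 ∧
    ∃ e' ∈ im (ed H) x.1, e' ∈ im (ed H) x.2

lemma mem_prs {H : SimpleGraph V} {G : EdgeSetGraph n} {e : EdgeType n}
    {x : (V ↪ Fin n) × (V ↪ Fin n)} : x ∈ prs H G e ↔ im (ed H) x.1 ⊆ G ∧ im (ed H) x.2 ⊆ G ∧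
      e ∈ im (ed H) x.1 ∧ ∃ e' ∈ im (ed H) x.1, e' ∈ im (ed H) x.2 := by
  unfold prs
  rw [Finset.mem_filter]
  exact ⟨fun h => h.2, fun h => ⟨Finset.mem_univ _, h⟩⟩

/-- Internal edges suitable for the switching. -/
structure GoodEdge (r : ℕ) [NeZero r] (H : SimpleGraph V) (L : ℕ) (a : ℝ) (G : EdgeSetGraph n)
    (e : EdgeType n) : Prop where
  mem : e ∈ intE (canon r G) G
  card_prs : (prs H G e).card ≤ L
  eq_of_mem : ∀ ψ ψ' : V ↪ Fin n, im (ed H) ψ ⊆ G → im (ed H) ψ' ⊆ G → e ∈ im (ed H) ψ →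
    e ∈ im (ed H) ψ' → im (ed H) ψ ≠ im (ed H) ψ' → ∀ e' ∈ im (ed H) ψ, e' ∈ im (ed H) ψ' → e' = e
  stable : ∀ ψ : V ↪ Fin n, im (ed H) ψ ⊆ G → e ∈ im (ed H) ψ → ∀ e' ∈ im (ed H) ψ,
    ∀ u ∈ e'.1, u ∉ unstable r L G
  card_lab : ((lab H (canon r G) G e).card : ℝ) ≤ a

lemma canon_eq_of_maxCuts_eq [NeZero r] {G G' : EdgeSetGraph n}
    (h : maxCuts r G = maxCuts r G') : canon r G = canon r G' := by
  unfold canon; rw [h]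

/-- The designated edges of the copies of `H` completing `e`. -/
def cutSet (r : ℕ) [NeZero r] (H : SimpleGraph V) (G : EdgeSetGraph n) (e : EdgeType n) :
    EdgeSetGraph n :=
  (compls H (canon r G) G e).image fun ψ => tgt (im (ed H) ψ) e

lemma mem_cutSet [NeZero r] {H : SimpleGraph V} {G : EdgeSetGraph n} {e t : EdgeType n} :
    t ∈ cutSet r H G e ↔ ∃ ψ ∈ compls H (canon r G) G e, tgt (im (ed H) ψ) e = t := by
  unfold cutSet
  rw [Finset.mem_image]

lemma card_im_ed (H : SimpleGraph V) (ψ : V ↪ Fin n) : (im (ed H) ψ).card = (ed H).card :=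
  card_im (fun _ hd => ed_not_isDiag hd) ψ

variable [NeZero r] {H : SimpleGraph V} {L : ℕ} {a : ℝ} {G : EdgeSetGraph n} {e : EdgeType n}

omit [NeZero r] in
lemma not_crosses_of_mem_intE {φ : Fin n → Fin r} (h : e ∈ intE φ G) : e ∈ G ∧ ¬ Crosses φ e :=
  Finset.mem_filter.1 h

lemma cutSet_spec (h2 : 2 ≤ (ed H).card) {t : EdgeType n} (ht : t ∈ cutSet r H G e) :
    t ∈ G ∧ Crosses (canon r G) t ∧
      ∃ ψ ∈ compls H (canon r G) G e, t ∈ im (ed H) ψ ∧ t ≠ e ∧ tgt (im (ed H) ψ) e = t := by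
  obtain ⟨ψ, hψ, rfl⟩ := mem_cutSet.1 ht
  have h1 := mem_compls.1 hψ
  have h3 := tgt_spec (S := im (ed H) ψ) (by rw [card_im_ed]; exact h2) e
  exact ⟨h1.1 h3.1, h1.2.2 _ h3.1 h3.2, ψ, hψ, h3.1, h3.2, rfl⟩

lemma cutSet_subset (h2 : 2 ≤ (ed H).card) : cutSet r H G e ⊆ G := fun _ ht =>
  (cutSet_spec h2 ht).1

lemma GoodEdge.card_cutSet_le (h : GoodEdge r H L a G e) : (cutSet r H G e).card ≤ L := by
  refine le_trans Finset.card_image_le (le_trans ?_ h.card_prs)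
  refine Finset.card_le_card_of_injOn (fun ψ => (ψ, ψ)) ?_ fun _ _ _ _ h => (Prod.ext_iff.1 h).1
  intro ψ hψ
  have := mem_compls.1 (Finset.mem_coe.1 hψ)
  exact Finset.mem_coe.2 (mem_prs.2 ⟨this.1, this.1, this.2.1, e, this.2.1, this.2.1⟩)

lemma GoodEdge.maxCuts_eq {p η : ℝ} (hn : 0 < n) (h2 : 2 ≤ (ed H).card)
    (hT : Typ r p (η ^ 2) G) (hp : 0 < p) (hη : 0 ≤ η) (hηr : 4 * η * r ≤ 1)
    (hL : 2 * L / p + n ≤ η ^ 2 * n ^ 2) (h : GoodEdge r H L a G e) :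
    maxCuts r (G \ cutSet r H G e) = maxCuts r G := by
  refine maxCuts_sdiff hn hT hp hη hηr hL (cutSet_subset h2) h.card_cutSet_le
    (fun t ht => (cutSet_spec h2 ht).2.1) fun t ht => ?_
  obtain ⟨_, _, ψ, hψ, h4, _, _⟩ := cutSet_spec h2 ht
  have := mem_compls.1 hψ
  exact h.stable ψ this.1 this.2.1 t h4

lemma GoodEdge.cutSet_subset_image (h2 : 2 ≤ (ed H).card) (h : GoodEdge r H L a G e) :
    cutSet r H G e ⊆ (lab H (canon r G) (G \ cutSet r H G e) e).image
      fun ψ => tgt (im (ed H) ψ) e := by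
  intro t ht
  obtain ⟨ψ, hψ, rfl⟩ := mem_cutSet.1 ht
  have h1 := mem_compls.1 hψ
  refine Finset.mem_image_of_mem _ (mem_lab.2 ⟨h1.2.1, h1.2.2, fun e' he' hne => ?_⟩)
  refine Finset.mem_sdiff.2 ⟨h1.1 he', fun hc => ?_⟩
  obtain ⟨_, _, ψ', hψ', h4, h5, h6⟩ := cutSet_spec h2 hc
  have h1' := mem_compls.1 hψ'
  by_cases hi : im (ed H) ψ = im (ed H) ψ'
  · rw [hi] at hne; exact hne h6.symm
  · exact h5 (h.eq_of_mem ψ ψ' h1.1 h1'.1 h1.2.1 h1'.2.1 hi e' he' h4)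

lemma GoodEdge.mem_unc (h2 : 2 ≤ (ed H).card) (h : GoodEdge r H L a G e) :
    e ∈ unc H (canon r G) (G \ cutSet r H G e) := by
  obtain ⟨he, hc⟩ := not_crosses_of_mem_intE h.mem
  have hT : e ∉ cutSet r H G e := fun hh => hc (cutSet_spec h2 hh).2.1
  refine Finset.mem_filter.2 ⟨Finset.mem_filter.2 ⟨Finset.mem_sdiff.2 ⟨he, hT⟩, hc⟩, ?_⟩
  refine Finset.eq_empty_of_forall_notMem fun ψ hψ => ?_
  have h1 := mem_compls.1 hψ
  have h3 : ψ ∈ compls H (canon r G) G e :=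
    mem_compls.2 ⟨h1.1.trans Finset.sdiff_subset, h1.2⟩
  have h4 := tgt_spec (S := im (ed H) ψ) (by rw [card_im_ed]; exact h2) e
  exact (Finset.mem_sdiff.1 (h1.1 h4.1)).2 (mem_cutSet.2 ⟨ψ, h3, rfl⟩)

lemma GoodEdge.compls_nonempty (hun : unc H (canon r G) G = ∅) (h : GoodEdge r H L a G e) :
    (compls H (canon r G) G e).Nonempty := by
  rw [Finset.nonempty_iff_ne_empty]
  intro hc
  have : e ∈ unc H (canon r G) G := Finset.mem_filter.2 ⟨h.mem, hc⟩
  rw [hun] at this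
  exact Finset.notMem_empty _ this

lemma GoodEdge.card_unc_le (h2 : 2 ≤ (ed H).card) (hr : ¬ H.Colorable r) (hb : Bad r H G)
    (h : GoodEdge r H L a G e) :
    (unc H (canon r G) (G \ cutSet r H G e)).card ≤ L := by
  refine le_trans ?_ h.card_prs
  have hun := hb.unc_eq_empty hr
  have key : ∀ e' : EdgeType n, ∃ x : (V ↪ Fin n) × (V ↪ Fin n),
      e' ∈ unc H (canon r G) (G \ cutSet r H G e) → x ∈ prs H G e ∧
        x.2 ∈ compls H (canon r G) G e' := by
    intro e'
    by_cases he' : e' ∈ unc H (canon r G) (G \ cutSet r H G e)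
    swap
    · obtain ⟨ψ, _⟩ := h.compls_nonempty hun
      exact ⟨(ψ, ψ), fun hh => absurd hh he'⟩
    obtain ⟨h3, h4⟩ := Finset.mem_filter.1 he'
    obtain ⟨h5, h6⟩ := not_crosses_of_mem_intE h3
    have h7 : e' ∈ intE (canon r G) G := Finset.mem_filter.2 ⟨(Finset.mem_sdiff.1 h5).1, h6⟩
    have h8 : (compls H (canon r G) G e').Nonempty := by
      rw [Finset.nonempty_iff_ne_empty]
      intro hc
      have : e' ∈ unc H (canon r G) G := Finset.mem_filter.2 ⟨h7, hc⟩
      rw [hun] at this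
      exact Finset.notMem_empty _ this
    obtain ⟨ψ', hψ'⟩ := h8
    have h9 := mem_compls.1 hψ'
    have h10 : ∃ t ∈ im (ed H) ψ', t ∈ cutSet r H G e := by
      by_contra hc
      push Not at hc
      have : ψ' ∈ compls H (canon r G) (G \ cutSet r H G e) e' :=
        mem_compls.2 ⟨fun t ht => Finset.mem_sdiff.2 ⟨h9.1 ht, hc t ht⟩, h9.2⟩
      rw [h4] at this
      exact Finset.notMem_empty _ this
    obtain ⟨t, ht, ht'⟩ := h10
    obtain ⟨_, _, ψ, hψ, h11, _, _⟩ := cutSet_spec h2 ht'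
    have h12 := mem_compls.1 hψ
    exact ⟨(ψ, ψ'), fun _ => ⟨mem_prs.2 ⟨h12.1, h9.1, h12.2.1, t, h11, ht⟩, hψ'⟩⟩
  choose f hf using key
  refine Finset.card_le_card_of_injOn f (fun e' he' => (hf e' he').1) ?_
  intro e₁ he₁ e₂ he₂ heq
  have g1 := mem_compls.1 (hf e₁ he₁).2
  have g2 := mem_compls.1 (hf e₂ he₂).2
  rw [heq] at g1
  by_contra hne
  have := g2.2.2 e₁ g1.2.1 hne
  exact (not_crosses_of_mem_intE (Finset.mem_filter.1 he₁).1).2 this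

/-- There are few good edges on average. -/
theorem Ex_card_good_le {p η : ℝ} (hn : 0 < n) (h2 : 2 ≤ (ed H).card) (hr : ¬ H.Colorable r)
    (hp : 0 < p) (hp1 : p < 1) (hη : 0 ≤ η) (hηr : 4 * η * r ≤ 1)
    (hL : 2 * L / p + n ≤ η ^ 2 * n ^ 2) :
    Ex p (fun G : EdgeSetGraph n => ((Finset.univ.filter fun e =>
      Bad r H G ∧ Typ r p (η ^ 2) G ∧ GoodEdge r H L a G e).card : ℝ)) ≤
      L * Real.exp (p / (1 - p) * (a / Nat.card (H ≃g H))) := by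
  have h1 : (0 : ℝ) < 1 - p := by linarith
  have hα : (0 : ℝ) < Nat.card (H ≃g H) := by
    have : Nonempty (H ≃g H) := ⟨RelIso.refl _⟩
    exact_mod_cast Nat.card_pos
  refine Ex_card_switch hp.le hp1 (fun G => Finset.univ.filter fun e =>
      Bad r H G ∧ Typ r p (η ^ 2) G ∧ GoodEdge r H L a G e) (cutSet r H)
    (fun G e _ => cutSet_subset h2)
    (fun G' e => (lab H (canon r G') G' e).image fun ψ => tgt (im (ed H) ψ) e) ?_
    (fun G' => unc H (canon r G') G') ?_ ?_ (Real.exp_pos _).le ?_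
  · intro G e he
    obtain ⟨_, hb, hT, hg⟩ := Finset.mem_filter.1 he
    have hc := canon_eq_of_maxCuts_eq (hg.maxCuts_eq hn h2 hT hp hη hηr hL)
    simp only [hc]
    exact hg.cutSet_subset_image h2
  · intro G e he
    obtain ⟨_, hb, hT, hg⟩ := Finset.mem_filter.1 he
    have hc := canon_eq_of_maxCuts_eq (hg.maxCuts_eq hn h2 hT hp hη hηr hL)
    simp only [hc]
    exact hg.mem_unc h2
  · intro G e he
    obtain ⟨_, hb, hT, hg⟩ := Finset.mem_filter.1 he
    have hc := canon_eq_of_maxCuts_eq (hg.maxCuts_eq hn h2 hT hp hη hηr hL)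
    simp only [hc]
    exact hg.card_unc_le h2 hr hb
  · intro G e he
    obtain ⟨_, hb, hT, hg⟩ := Finset.mem_filter.1 he
    have hc := canon_eq_of_maxCuts_eq (hg.maxCuts_eq hn h2 hT hp hη hηr hL)
    simp only [hc]
    set G' := G \ cutSet r H G e with hG'
    have k1 : ((lab H (canon r G) G' e).image fun ψ => tgt (im (ed H) ψ) e).card ≤
        ((lab H (canon r G) G' e).image (im (ed H))).card := by
      have : ((lab H (canon r G) G' e).image fun ψ => tgt (im (ed H) ψ) e) =
          ((lab H (canon r G) G' e).image (im (ed H))).image fun S => tgt S e := by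
        ext t; simp
      rw [this]
      exact Finset.card_image_le
    have k2 := card_iso_mul_card_image_le H (lab H (canon r G) G' e) fun ψ ψ' h hψ => by
      rw [mem_lab] at hψ ⊢
      rwa [← h]
    have k3 : (lab H (canon r G) G' e).card ≤ (lab H (canon r G) G e).card :=
      Finset.card_le_card (lab_mono H _ Finset.sdiff_subset e)
    have k4 : (Nat.card (H ≃g H) : ℝ) * ((lab H (canon r G) G' e).image
        fun ψ => tgt (im (ed H) ψ) e).card ≤ a := by
      refine le_trans ?_ hg.card_lab
      have k6 := (Nat.mul_le_mul_left (Nat.card (H ≃g H)) k1).trans (k2.trans k3)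
      rw [← Nat.cast_mul]
      exact Nat.cast_le.2 k6
    have k5 : (((lab H (canon r G) G' e).image fun ψ => tgt (im (ed H) ψ) e).card : ℝ) ≤
        a / Nat.card (H ≃g H) := by
      rw [le_div_iff₀ hα]; linarith
    have hρ : 0 ≤ p / (1 - p) := by positivity
    calc _ ≤ Real.exp (p / (1 - p)) ^ ((lab H (canon r G) G' e).image
          fun ψ => tgt (im (ed H) ψ) e).card :=
          pow_le_pow_left₀ (by positivity) (by linarith [Real.add_one_le_exp (p / (1 - p))]) _
      _ = Real.exp (p / (1 - p) * ((lab H (canon r G) G' e).image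
          fun ψ => tgt (im (ed H) ψ) e).card) := by
          rw [← Real.exp_nat_mul, mul_comm]
      _ ≤ _ := Real.exp_le_exp.2 (mul_le_mul_of_nonneg_left k5 hρ)

end GraphSwitching

section Counting

lemma sum_card_filter_le {ι E : Type*} (s : Finset E) (t : Finset ι) (R : ι → E → Prop) {h : ℕ}
    [∀ i, DecidablePred (R i)] [∀ e, DecidablePred fun i => R i e]
    (hR : ∀ i ∈ t, (s.filter (R i)).card ≤ h) :
    ∑ e ∈ s, (t.filter fun i => R i e).card ≤ h * t.card := by
  have := Finset.sum_card_bipartiteAbove_eq_sum_card_bipartiteBelow (s := t) (t := s) R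
  unfold Finset.bipartiteAbove Finset.bipartiteBelow at this
  refine le_trans (le_of_eq ?_) ((Finset.sum_le_card_nsmul t _ h hR).trans (le_of_eq ?_))
  · exact this.symm
  · rw [smul_eq_mul, mul_comm]

lemma card_filter_exists_le {ι E : Type*} [Fintype E] (t : Finset ι) (A : ι → Finset E) {h : ℕ}
    (hA : ∀ i ∈ t, (A i).card ≤ h) (P : E → Prop) [DecidablePred P]
    (hP : ∀ e, P e → ∃ i ∈ t, e ∈ A i) :
    (Finset.univ.filter P).card ≤ h * t.card := by
  refine le_trans (Finset.card_le_card (t := t.biUnion A) fun e he => ?_)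
    (le_trans Finset.card_biUnion_le ?_)
  · exact Finset.mem_biUnion.2 (hP e (Finset.mem_filter.1 he).2)
  · refine (Finset.sum_le_card_nsmul t _ h hA).trans (le_of_eq ?_)
    rw [smul_eq_mul, mul_comm]

lemma mul_card_filter_le_sum {E : Type*} (s : Finset E) (f : E → ℕ) {a : ℝ}
    (P : E → Prop) [DecidablePred P] (hP : ∀ e, P e → e ∈ s ∧ a ≤ f e) [Fintype E] :
    a * (Finset.univ.filter P).card ≤ ((∑ e ∈ s, f e : ℕ) : ℝ) := by
  push_cast
  calc a * ((Finset.univ.filter P).card : ℝ) = ∑ e ∈ Finset.univ.filter P, a := by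
        rw [Finset.sum_const, nsmul_eq_mul, mul_comm]
    _ ≤ ∑ e ∈ Finset.univ.filter P, (f e : ℝ) :=
        Finset.sum_le_sum fun e he => (hP e (Finset.mem_filter.1 he).2).2
    _ ≤ ∑ e ∈ s, (f e : ℝ) := Finset.sum_le_sum_of_subset_of_nonneg
        (fun e he => (hP e (Finset.mem_filter.1 he).2).1) fun _ _ _ => Nat.cast_nonneg _

/-- The indices in `I` of members of the family `A` contained in `S`. -/
def cset {ι E : Type*} (A : ι → Finset E) (I : Finset ι) (S : Finset E) : Finset ι :=
  I.filter fun i => A i ⊆ S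

lemma mem_cset {ι E : Type*} {A : ι → Finset E} {I : Finset ι} {S : Finset E} {i : ι} :
    i ∈ cset A I S ↔ i ∈ I ∧ A i ⊆ S := Finset.mem_filter

lemma cnt_eq {ι E : Type*} (A : ι → Finset E) (I : Finset ι) (S : Finset E) :
    cnt A I S = (cset A I S).card := rfl

variable {V : Type} [Fintype V] {n r : ℕ}

/-- The union of the edge sets of a pair of embeddings. -/
def im₂ (H : SimpleGraph V) (x : (V ↪ Fin n) × (V ↪ Fin n)) : EdgeSetGraph n :=
  im (ed H) x.1 ∪ im (ed H) x.2

lemma im₂_subset {H : SimpleGraph V} {x : (V ↪ Fin n) × (V ↪ Fin n)} {G : EdgeSetGraph n} :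
    im₂ H x ⊆ G ↔ im (ed H) x.1 ⊆ G ∧ im (ed H) x.2 ⊆ G := Finset.union_subset_iff

/-- Pairs of embeddings whose shared edges satisfy `𝓢`. -/
def pairs (n : ℕ) (H : SimpleGraph V) (𝓢 : Finset (Sym2 V) → Prop) :
    Finset ((V ↪ Fin n) × (V ↪ Fin n)) :=
  Finset.univ.filter fun x => 𝓢 (shared (ed H) x.1 x.2)

lemma mem_pairs {H : SimpleGraph V} {𝓢 : Finset (Sym2 V) → Prop}
    {x : (V ↪ Fin n) × (V ↪ Fin n)} : x ∈ pairs n H 𝓢 ↔ 𝓢 (shared (ed H) x.1 x.2) := by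
  unfold pairs
  rw [Finset.mem_filter]
  exact ⟨fun h => h.2, fun h => ⟨Finset.mem_univ _, h⟩⟩

omit [Fintype V] in
lemma mem_shared {D : Finset (Sym2 V)} {ψ ψ' : V ↪ Fin n} {d : Sym2 V} :
    d ∈ shared D ψ ψ' ↔ d ∈ D ∧ ∃ e ∈ im D ψ, Sym2.map ψ' d = e.1 := by
  unfold shared
  rw [Finset.mem_filter]

lemma exists_shared {H : SimpleGraph V} {ψ ψ' : V ↪ Fin n} {e : EdgeType n}
    (h : e ∈ im (ed H) ψ) (h' : e ∈ im (ed H) ψ') :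
    ∃ d ∈ shared (ed H) ψ ψ', Sym2.map ψ' d = e.1 := by
  obtain ⟨d, hd, hh⟩ := mem_im.1 h'
  exact ⟨d, mem_shared.2 ⟨hd, e, h, hh⟩, hh⟩

/-- The number of pairs of copies in `G` whose shared edges satisfy `𝓢`. -/
def nPairs (H : SimpleGraph V) (𝓢 : Finset (Sym2 V) → Prop) (G : EdgeSetGraph n) : ℕ :=
  cnt (im₂ H) (pairs n H 𝓢) G

/-- The number of embeddings into `G` touching the vertex set `Z`. -/
def nTouch (H : SimpleGraph V) (Z : Finset (Fin n)) (G : EdgeSetGraph n) : ℕ :=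
  cnt (fun ψ : V ↪ Fin n => im (ed H) ψ) (Finset.univ.filter fun ψ => ∃ w, ψ w ∈ Z) G

/-- The colouring `φ` has `ε` as its only monochromatic edge, with designated edge `d`. -/
def MonoAt (H : SimpleGraph V) (φ : Fin n → Fin r) (ε d : Sym2 V) (ψ : V ↪ Fin n) : Prop :=
  ∃ e : EdgeType n, Sym2.map ψ ε = e.1 ∧ ¬ Crosses φ e ∧
    (∀ e' ∈ im (ed H) ψ, e' ≠ e → Crosses φ e') ∧ (tgt (im (ed H) ψ) e).1 = Sym2.map ψ d

lemma sum_card_prs_le (H : SimpleGraph V) (G : EdgeSetGraph n) :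
    ∑ e, (prs H G e).card ≤ (ed H).card * nPairs H Finset.Nonempty G := by
  have := sum_card_filter_le (Finset.univ : Finset (EdgeType n))
    (cset (im₂ H) (pairs n H Finset.Nonempty) G) (fun x e => e ∈ im (ed H) x.1)
    (h := (ed H).card) fun x _ => by
      rw [← card_im_ed H x.1]
      exact Finset.card_le_card fun e he => (Finset.mem_filter.1 he).2
  rw [nPairs, cnt_eq]
  refine le_trans (Finset.sum_le_sum fun e _ => Finset.card_le_card fun x hx => ?_) this
  obtain ⟨h1, h2, h3, e', h4, h5⟩ := mem_prs.1 hx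
  obtain ⟨d, hd, _⟩ := exists_shared h4 h5
  exact Finset.mem_filter.2 ⟨mem_cset.2 ⟨mem_pairs.2 ⟨d, hd⟩, im₂_subset.2 ⟨h1, h2⟩⟩, h3⟩

lemma shared_ne_of_im_ne {H : SimpleGraph V} {ψ ψ' : V ↪ Fin n}
    (h : im (ed H) ψ ≠ im (ed H) ψ') : shared (ed H) ψ ψ' ≠ ed H := by
  intro hs
  refine h (Finset.eq_of_subset_of_card_le (fun e he => ?_) (by rw [card_im_ed, card_im_ed])).symm
  obtain ⟨d, hd, h1⟩ := mem_im.1 he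
  rw [← hs] at hd
  obtain ⟨_, e', he', h2⟩ := mem_shared.1 hd
  have : e = e' := Subtype.ext (h1.symm.trans h2)
  rwa [this]

lemma card_overlap_le (H : SimpleGraph V) (G : EdgeSetGraph n) :
    (Finset.univ.filter fun e : EdgeType n => ∃ ψ ψ' : V ↪ Fin n, im (ed H) ψ ⊆ G ∧
      im (ed H) ψ' ⊆ G ∧ e ∈ im (ed H) ψ ∧ e ∈ im (ed H) ψ' ∧ im (ed H) ψ ≠ im (ed H) ψ' ∧
      ∃ e' ∈ im (ed H) ψ, e' ∈ im (ed H) ψ' ∧ e' ≠ e).card ≤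
      (ed H).card * nPairs H (fun F => 2 ≤ F.card ∧ F ≠ ed H) G := by
  rw [nPairs, cnt_eq]
  refine card_filter_exists_le (cset (im₂ H) (pairs n H fun F => 2 ≤ F.card ∧ F ≠ ed H) G)
    (fun x => im (ed H) x.1) (fun x _ => (card_im_ed H x.1).le) _ ?_
  rintro e ⟨ψ, ψ', h1, h2, h3, h4, h5, e', h6, h7, h8⟩
  refine ⟨(ψ, ψ'), mem_cset.2 ⟨mem_pairs.2 ⟨?_, shared_ne_of_im_ne h5⟩,
    im₂_subset.2 ⟨h1, h2⟩⟩, h3⟩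
  obtain ⟨d, hd, hdd⟩ := exists_shared h3 h4
  obtain ⟨d', hd', hdd'⟩ := exists_shared h6 h7
  refine Finset.one_lt_card.2 ⟨d, hd, d', hd', fun hc => h8 (Subtype.ext ?_)⟩
  rw [← hdd, ← hdd', hc]

lemma card_touch_le (H : SimpleGraph V) (Z : Finset (Fin n)) (G : EdgeSetGraph n) :
    (Finset.univ.filter fun e : EdgeType n => ∃ ψ : V ↪ Fin n, im (ed H) ψ ⊆ G ∧
      e ∈ im (ed H) ψ ∧ ∃ e' ∈ im (ed H) ψ, ∃ u ∈ e'.1, u ∈ Z).card ≤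
      (ed H).card * nTouch H Z G := by
  rw [nTouch, cnt_eq]
  refine card_filter_exists_le (cset (fun ψ => im (ed H) ψ)
    ((Finset.univ : Finset (V ↪ Fin n)).filter fun ψ => ∃ w, ψ w ∈ Z) G) (fun ψ => im (ed H) ψ)
    (fun ψ _ => (card_im_ed H ψ).le) _ ?_
  rintro e ⟨ψ, h1, h2, e', h3, u, hu, hZ⟩
  refine ⟨ψ, mem_cset.2 ⟨Finset.mem_filter.2 ⟨Finset.mem_univ _, ?_⟩, h1⟩, h2⟩
  obtain ⟨d, _, hd⟩ := mem_im.1 h3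
  rw [← hd, Sym2.mem_map] at hu
  obtain ⟨w, _, rfl⟩ := hu
  exact ⟨w, hZ⟩

lemma sum_card_lab_le {H : SimpleGraph V} (h2 : 2 ≤ (ed H).card) (φ : Fin n → Fin r)
    (G : EdgeSetGraph n) :
    ∑ e ∈ intE φ G, (lab H φ G e).card ≤ ∑ x ∈ ed H ×ˢ ed H,
      cnt (fun ψ : V ↪ Fin n => im ((ed H).erase x.2) ψ)
        (Finset.univ.filter (MonoAt H φ x.1 x.2)) G := by
  rw [← Finset.card_sigma]
  simp only [cnt_eq]
  rw [← Finset.card_sigma]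
  have key : ∀ y : (_ : EdgeType n) × (V ↪ Fin n), ∃ x : Sym2 V × Sym2 V,
      y ∈ (intE φ G).sigma (fun e => lab H φ G e) →
      x ∈ ed H ×ˢ ed H ∧ Sym2.map y.2 x.1 = y.1.1 ∧
        (tgt (im (ed H) y.2) y.1).1 = Sym2.map y.2 x.2 := by
    rintro ⟨e, ψ⟩
    have h3 := tgt_spec (S := im (ed H) ψ) (by rw [card_im_ed]; exact h2) e
    obtain ⟨d, hd, hdd⟩ := mem_im.1 h3.1
    by_cases hy : e ∈ im (ed H) ψ
    · obtain ⟨ε, hε, hεe⟩ := mem_im.1 hy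
      exact ⟨(ε, d), fun _ => ⟨Finset.mem_product.2 ⟨hε, hd⟩, hεe, hdd.symm⟩⟩
    · exact ⟨(d, d), fun h => absurd (mem_lab.1 (Finset.mem_sigma.1 h).2).1 hy⟩
  choose f hf using key
  refine Finset.card_le_card_of_injOn (fun y => ⟨f y, y.2⟩) ?_ ?_
  · rintro ⟨e, ψ⟩ hy
    have hy' := Finset.mem_coe.1 hy
    obtain ⟨h3, h4, h5⟩ := hf _ hy'
    obtain ⟨h6, h7⟩ := Finset.mem_sigma.1 hy'
    have h8 := mem_lab.1 h7
    refine Finset.mem_coe.2 (Finset.mem_sigma.2 ⟨h3, mem_cset.2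
      ⟨Finset.mem_filter.2 ⟨Finset.mem_univ _, e, h4, (not_crosses_of_mem_intE h6).2, h8.2.1, h5⟩,
        ?_⟩⟩)
    intro e' he'
    obtain ⟨d', hd', hdd'⟩ := mem_im.1 he'
    obtain ⟨h9, h10⟩ := Finset.mem_erase.1 hd'
    refine h8.2.2 e' (mem_im.2 ⟨d', h10, hdd'⟩) fun hc => h9 ?_
    refine Sym2.map.injective ψ.injective ?_
    rw [hdd', hc]
    exact h5
  · rintro ⟨e, ψ⟩ hy ⟨e', ψ'⟩ hy' heq
    obtain ⟨_, h4, _⟩ := hf _ (Finset.mem_coe.1 hy)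
    obtain ⟨_, h4', _⟩ := hf _ (Finset.mem_coe.1 hy')
    simp only [Sigma.mk.injEq, heq_eq_eq] at heq
    obtain ⟨h5, rfl⟩ := heq
    have : e = e' := Subtype.ext (by rw [← h4, ← h4', h5])
    rw [this]

/-- The colourings of the vertices of `H` with exactly one monochromatic edge. -/
def oneMono (r : ℕ) (H : SimpleGraph V) : Finset (V → Fin r) :=
  Finset.univ.filter fun χ => ∃ ε ∈ ed H, (Sym2.map χ ε).IsDiag ∧
    ∀ ε' ∈ ed H, (Sym2.map χ ε').IsDiag → ε' = ε

lemma sum_card_monoAt_le {H : SimpleGraph V} (φ : Fin n → Fin r) {m : ℝ}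
    (hm : ∀ k, ((cls φ k).card : ℝ) ≤ m) :
    ∑ x ∈ ed H ×ˢ ed H, (((Finset.univ : Finset (V ↪ Fin n)).filter
      (MonoAt H φ x.1 x.2)).card : ℝ) ≤ (oneMono r H).card * m ^ Fintype.card V := by
  have h1 : ∑ x ∈ ed H ×ˢ ed H, ((Finset.univ : Finset (V ↪ Fin n)).filter
      (MonoAt H φ x.1 x.2)).card ≤
      (Finset.univ.filter fun ψ : V ↪ Fin n => φ ∘ ψ ∈ oneMono r H).card := by
    rw [← Finset.card_sigma]
    have huniq : ∀ (ψ : V ↪ Fin n) (ε d : Sym2 V), ε ∈ ed H → MonoAt H φ ε d ψ →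
        (Sym2.map (φ ∘ ψ) ε).IsDiag ∧ ∀ ε' ∈ ed H, (Sym2.map (φ ∘ ψ) ε').IsDiag → ε' = ε := by
      rintro ψ ε d hε ⟨e, h1, h2, h3, h4⟩
      constructor
      · rw [← Sym2.map_map, h1]
        exact not_not.1 h2
      · intro ε' hε' hd
        by_contra hne
        have h5 := h3 ⟨Sym2.map ψ ε', not_isDiag_map ψ (ed_not_isDiag hε')⟩
          (mem_im.2 ⟨ε', hε', rfl⟩) fun hc => hne (Sym2.map.injective ψ.injective (by
            rw [h1, ← hc]))
        rw [← Sym2.map_map] at hd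
        exact h5 hd
    refine Finset.card_le_card_of_injOn (fun y => y.2) ?_ ?_
    · rintro ⟨⟨ε, d⟩, ψ⟩ hy
      obtain ⟨h2, h3⟩ := Finset.mem_sigma.1 (Finset.mem_coe.1 hy)
      have hε := (Finset.mem_product.1 h2).1
      have := huniq ψ ε d hε (Finset.mem_filter.1 h3).2
      exact Finset.mem_coe.2 (Finset.mem_filter.2 ⟨Finset.mem_univ _,
        Finset.mem_filter.2 ⟨Finset.mem_univ _, ε, hε, this.1, this.2⟩⟩)
    · rintro ⟨⟨ε, d⟩, ψ⟩ hy ⟨⟨ε', d'⟩, ψ'⟩ hy' heq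
      obtain ⟨h2, h3⟩ := Finset.mem_sigma.1 (Finset.mem_coe.1 hy)
      obtain ⟨h2', h3'⟩ := Finset.mem_sigma.1 (Finset.mem_coe.1 hy')
      have heq' : ψ = ψ' := heq
      subst heq'
      have hε := (Finset.mem_product.1 h2).1
      have hε' := (Finset.mem_product.1 h2').1
      have h4 := (Finset.mem_filter.1 h3).2
      have h4' := (Finset.mem_filter.1 h3').2
      have h5 : ε' = ε := (huniq ψ ε d hε h4).2 ε' hε' (huniq ψ ε' d' hε' h4').1
      obtain ⟨e, g1, _, _, g4⟩ := h4
      obtain ⟨e', g1', _, _, g4'⟩ := h4'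
      have h6 : e' = e := Subtype.ext (by
        rw [← g1, ← g1']
        change Sym2.map ψ ε' = Sym2.map ψ ε
        rw [h5])
      have h7 : d' = d := Sym2.map.injective ψ.injective (by
        have k1 : _ = Sym2.map ψ d := g4
        have k2 : _ = Sym2.map ψ d' := g4'
        rw [← k1, ← k2, h6])
      rw [h5, h7]
  have h2 : (Finset.univ.filter fun ψ : V ↪ Fin n => φ ∘ ψ ∈ oneMono r H).card ≤
      ∑ χ ∈ oneMono r H, ∏ w, (cls φ (χ w)).card := by
    refine (Finset.card_eq_sum_card_fiberwise (f := fun ψ : V ↪ Fin n => φ ∘ ψ)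
      (t := oneMono r H) fun ψ hψ => Finset.mem_coe.2
        (Finset.mem_filter.1 (Finset.mem_coe.1 hψ)).2).le.trans ?_
    refine Finset.sum_le_sum fun χ _ => ?_
    rw [← Fintype.card_piFinset]
    refine Finset.card_le_card_of_injOn (fun ψ => (ψ : V → Fin n)) ?_ ?_
    · intro ψ hψ
      have := (Finset.mem_filter.1 (Finset.mem_coe.1 hψ)).2
      refine Finset.mem_coe.2 (Fintype.mem_piFinset.2 fun w => mem_cls.2 ?_)
      exact congrFun this w
    · intro ψ _ ψ' _ h
      exact DFunLike.coe_injective h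
  calc _ ≤ ((∑ χ ∈ oneMono r H, ∏ w, (cls φ (χ w)).card : ℕ) : ℝ) := by
        exact_mod_cast h1.trans h2
    _ ≤ ∑ χ ∈ oneMono r H, m ^ Fintype.card V := by
        push_cast
        refine Finset.sum_le_sum fun χ _ => ?_
        refine (Finset.prod_le_prod (fun w _ => Nat.cast_nonneg _) fun w _ => hm (χ w)).trans ?_
        rw [Finset.prod_const, Finset.card_univ]
    _ = _ := by rw [Finset.sum_const, nsmul_eq_mul]

/-- Most internal edges are good in a typical graph. -/
lemma card_intE_le_card_good [NeZero r] (H : SimpleGraph V) (L : ℕ) {a : ℝ} (ha : 0 < a)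
    (hL : 0 < L) (h2 : 2 ≤ (ed H).card) (G : EdgeSetGraph n) :
    ((intE (canon r G) G).card : ℝ) ≤
      (Finset.univ.filter (GoodEdge r H L a G)).card +
      ((ed H).card * nPairs H Finset.Nonempty G / L +
       (ed H).card * nPairs H (fun F => 2 ≤ F.card ∧ F ≠ ed H) G +
       (ed H).card * nTouch H (unstable r L G) G +
       (∑ x ∈ ed H ×ˢ ed H, cnt (fun ψ : V ↪ Fin n => im ((ed H).erase x.2) ψ)
        (Finset.univ.filter (MonoAt H (canon r G) x.1 x.2)) G : ℕ) / a) := by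
  have hL' : (0 : ℝ) < L := by exact_mod_cast hL
  set φ := canon r G with hφ
  set P1 : EdgeType n → Prop := fun e => L < (prs H G e).card with hP1
  set P2 : EdgeType n → Prop := fun e => ∃ ψ ψ' : V ↪ Fin n, im (ed H) ψ ⊆ G ∧
      im (ed H) ψ' ⊆ G ∧ e ∈ im (ed H) ψ ∧ e ∈ im (ed H) ψ' ∧ im (ed H) ψ ≠ im (ed H) ψ' ∧
      ∃ e' ∈ im (ed H) ψ, e' ∈ im (ed H) ψ' ∧ e' ≠ e with hP2
  set P3 : EdgeType n → Prop := fun e => ∃ ψ : V ↪ Fin n, im (ed H) ψ ⊆ G ∧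
      e ∈ im (ed H) ψ ∧ ∃ e' ∈ im (ed H) ψ, ∃ u ∈ e'.1, u ∈ unstable r L G with hP3
  set P4 : EdgeType n → Prop := fun e => e ∈ intE φ G ∧ a < (lab H φ G e).card with hP4
  have hsub : intE φ G ⊆ Finset.univ.filter (GoodEdge r H L a G) ∪ (Finset.univ.filter P1 ∪
      (Finset.univ.filter P2 ∪ (Finset.univ.filter P3 ∪ Finset.univ.filter P4))) := by
    intro e he
    by_contra hc
    simp only [Finset.mem_union, Finset.mem_filter, Finset.mem_univ, true_and, not_or] at hc
    obtain ⟨c0, c1, c2, c3, c4⟩ := hc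
    refine c0 ⟨he, not_lt.1 c1, ?_, ?_, ?_⟩
    · intro ψ ψ' k1 k2 k3 k4 k5 e' k6 k7
      by_contra k8
      exact c2 ⟨ψ, ψ', k1, k2, k3, k4, k5, e', k6, k7, k8⟩
    · intro ψ k1 k2 e' k3 u k4 k5
      exact c3 ⟨ψ, k1, k2, e', k3, u, k4, k5⟩
    · by_contra k
      exact c4 ⟨he, not_le.1 k⟩
  have b0 := (Finset.card_le_card hsub).trans ((Finset.card_union_le _ _).trans
    (Nat.add_le_add_left ((Finset.card_union_le _ _).trans
      (Nat.add_le_add_left ((Finset.card_union_le _ _).trans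
        (Nat.add_le_add_left (Finset.card_union_le _ _) _)) _)) _))
  have b0' : ((intE φ G).card : ℝ) ≤ (Finset.univ.filter (GoodEdge r H L a G)).card +
      ((Finset.univ.filter P1).card + ((Finset.univ.filter P2).card +
        ((Finset.univ.filter P3).card + (Finset.univ.filter P4).card))) := by exact_mod_cast b0
  have b1 : ((Finset.univ.filter P1).card : ℝ) ≤
      (ed H).card * nPairs H Finset.Nonempty G / L := by
    rw [le_div_iff₀ hL', mul_comm]
    refine (mul_card_filter_le_sum (a := L) Finset.univ (fun e => (prs H G e).card) P1
      fun e he => ⟨Finset.mem_univ _, Nat.cast_le.2 (le_of_lt he)⟩).trans ?_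
    exact_mod_cast sum_card_prs_le H G
  have b2 : ((Finset.univ.filter P2).card : ℝ) ≤
      (ed H).card * nPairs H (fun F => 2 ≤ F.card ∧ F ≠ ed H) G := by
    exact_mod_cast card_overlap_le H G
  have b3 : ((Finset.univ.filter P3).card : ℝ) ≤ (ed H).card * nTouch H (unstable r L G) G := by
    exact_mod_cast card_touch_le H (unstable r L G) G
  have b4 : ((Finset.univ.filter P4).card : ℝ) ≤ (∑ x ∈ ed H ×ˢ ed H,
      cnt (fun ψ : V ↪ Fin n => im ((ed H).erase x.2) ψ)
        (Finset.univ.filter (MonoAt H φ x.1 x.2)) G : ℕ) / a := by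
    rw [le_div_iff₀ ha, mul_comm]
    refine (mul_card_filter_le_sum (intE φ G) (fun e => (lab H φ G e).card) P4
      fun e he => ⟨he.1, le_of_lt he.2⟩).trans ?_
    exact_mod_cast sum_card_lab_le h2 φ G
  linarith

end Counting

section CopyCount

variable {V W : Type*}

/-- The image of `H` under a function, as a subgraph, if the function is a homomorphism. -/
def imgSub (H : SimpleGraph V) (G : SimpleGraph W) (f : V → W) : G.Subgraph :=
  if h : ∀ a b, H.Adj a b → G.Adj (f a) (f b) then
    { verts := Set.range f
      Adj := fun x y => ∃ a b, H.Adj a b ∧ f a = x ∧ f b = y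
      adj_sub := by rintro x y ⟨a, b, hab, rfl, rfl⟩; exact h a b hab
      edge_vert := by rintro x y ⟨a, b, _, rfl, rfl⟩; exact ⟨a, rfl⟩
      symm := by
        constructor
        rintro x y ⟨a, b, hab, rfl, rfl⟩
        exact ⟨b, a, hab.symm, rfl, rfl⟩ }
  else ⊥

lemma imgSub_verts {H : SimpleGraph V} {G : SimpleGraph W} {f : V → W}
    (h : ∀ a b, H.Adj a b → G.Adj (f a) (f b)) : (imgSub H G f).verts = Set.range f := by
  unfold imgSub; rw [dif_pos h]

lemma imgSub_adj {H : SimpleGraph V} {G : SimpleGraph W} {f : V → W}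
    (hf : Function.Injective f) (h : ∀ a b, H.Adj a b → G.Adj (f a) (f b)) {a b : V} :
    (imgSub H G f).Adj (f a) (f b) ↔ H.Adj a b := by
  unfold imgSub; rw [dif_pos h]
  constructor
  · rintro ⟨a', b', h1, h2, h3⟩
    rwa [hf h2, hf h3] at h1
  · intro h1
    exact ⟨a, b, h1, rfl, rfl⟩

lemma nonempty_iso_imgSub {H : SimpleGraph V} {G : SimpleGraph W} {f : V → W}
    (hf : Function.Injective f) (h : ∀ a b, H.Adj a b → G.Adj (f a) (f b)) :
    Nonempty ((imgSub H G f).coe ≃g H) := by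
  have hm : ∀ a, f a ∈ (imgSub H G f).verts := fun a => by
    rw [imgSub_verts h]; exact ⟨a, rfl⟩
  have hb : Function.Bijective fun a => (⟨f a, hm a⟩ : (imgSub H G f).verts) := by
    refine ⟨fun a b hab => hf (congrArg Subtype.val hab), ?_⟩
    rintro ⟨x, hx⟩
    have hx' := hx
    rw [imgSub_verts h] at hx'
    obtain ⟨a, rfl⟩ := hx'
    exact ⟨a, rfl⟩
  refine ⟨RelIso.symm ⟨Equiv.ofBijective _ hb, ?_⟩⟩
  intro a b
  exact imgSub_adj hf h

variable [Fintype V] [Fintype W]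

/-- Injective homomorphisms, as functions. -/
def injHoms (H : SimpleGraph V) (G : SimpleGraph W) : Finset (V → W) :=
  Finset.univ.filter fun f => Function.Injective f ∧ ∀ a b, H.Adj a b → G.Adj (f a) (f b)

lemma mem_injHoms {H : SimpleGraph V} {G : SimpleGraph W} {f : V → W} :
    f ∈ injHoms H G ↔ Function.Injective f ∧ ∀ a b, H.Adj a b → G.Adj (f a) (f b) := by
  unfold injHoms
  rw [Finset.mem_filter]
  exact ⟨fun h => h.2, fun h => ⟨Finset.mem_univ _, h⟩⟩

lemma card_injHoms_le (H : SimpleGraph V) (G : SimpleGraph W) :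
    (injHoms H G).card ≤ Nat.card (H ≃g H) * copCount H G := by
  have hfin := Fintype.ofFinite (H ≃g H)
  refine (Finset.card_le_mul_card_image (f := imgSub H G) _ (Nat.card (H ≃g H)) ?_).trans ?_
  · intro S hS
    obtain ⟨f₀, hf₀, rfl⟩ := Finset.mem_image.1 hS
    obtain ⟨i₀, h₀⟩ := mem_injHoms.1 hf₀
    rw [Nat.card_eq_fintype_card, ← Finset.card_univ]
    have key : ∀ f : V → W, ∃ σ : H ≃g H, f ∈ (injHoms H G).filter
        (fun f => imgSub H G f = imgSub H G f₀) → ∀ a, f₀ (σ a) = f a := by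
      intro f
      by_cases hf : f ∈ (injHoms H G).filter (fun f => imgSub H G f = imgSub H G f₀)
      swap
      · exact ⟨RelIso.refl _, fun h => absurd h hf⟩
      obtain ⟨hf1, hf2⟩ := Finset.mem_filter.1 hf
      obtain ⟨i, h⟩ := mem_injHoms.1 hf1
      have hr : Set.range f = Set.range f₀ := by
        rw [← imgSub_verts h, ← imgSub_verts h₀, hf2]
      set σ : V ≃ V := (Equiv.ofInjective f i).trans ((Equiv.setCongr hr).trans
        (Equiv.ofInjective f₀ i₀).symm) with hσ
      have hσa : ∀ a, f₀ (σ a) = f a := by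
        intro a
        have := Equiv.apply_symm_apply (Equiv.ofInjective f₀ i₀)
          (Equiv.setCongr hr (Equiv.ofInjective f i a))
        exact congrArg Subtype.val this
      refine ⟨⟨σ, ?_⟩, fun _ => hσa⟩
      intro a b
      rw [← imgSub_adj i₀ h₀, hσa, hσa, ← hf2, imgSub_adj i h]
    choose g hg using key
    refine Finset.card_le_card_of_injOn g (fun _ _ => Finset.mem_coe.2 (Finset.mem_univ _)) ?_
    intro f hf f' hf' heq
    funext a
    rw [← hg f (Finset.mem_coe.1 hf) a, ← hg f' (Finset.mem_coe.1 hf') a, heq]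
  · refine Nat.mul_le_mul_left _ ?_
    rw [← Set.ncard_coe_finset]
    refine Set.ncard_le_ncard ?_ (Set.toFinite _)
    intro S hS
    obtain ⟨f, hf, rfl⟩ := Finset.mem_image.1 (Finset.mem_coe.1 hS)
    obtain ⟨i, h⟩ := mem_injHoms.1 hf
    exact nonempty_iso_imgSub i h

end CopyCount

section PlusGraph

variable {V : Type} [Fintype V] {r : ℕ}

/-- The colourings with exactly one monochromatic edge, that edge having colour `0`. -/
def oneMonoZero (r : ℕ) [NeZero r] (H : SimpleGraph V) : Finset (V → Fin r) :=
  Finset.univ.filter fun χ => ∃ a b, H.Adj a b ∧ χ a = 0 ∧ χ b = 0 ∧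
    ∀ a' b', H.Adj a' b' → χ a' = χ b' → s(a', b') = s(a, b)

lemma card_oneMono_le [NeZero r] (H : SimpleGraph V) :
    (oneMono r H).card ≤ r * (oneMonoZero r H).card := by
  have key : ∀ χ : V → Fin r, ∃ k : Fin r, χ ∈ oneMono r H →
      (fun w => Equiv.swap 0 k (χ w)) ∈ oneMonoZero r H := by
    intro χ
    by_cases hχ : χ ∈ oneMono r H
    swap
    · exact ⟨0, fun h => absurd h hχ⟩
    obtain ⟨_, ε, hε, h1, h2⟩ := Finset.mem_filter.1 hχ
    rw [mem_ed] at hε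
    induction ε using Sym2.ind with
    | _ a b =>
      have hab : χ a = χ b := by simpa using h1
      refine ⟨χ a, fun _ => Finset.mem_filter.2 ⟨Finset.mem_univ _, a, b, hε, ?_, ?_, ?_⟩⟩
      · exact Equiv.swap_apply_right _ _
      · change Equiv.swap 0 (χ a) (χ b) = 0
        rw [← hab]; exact Equiv.swap_apply_right _ _
      · intro a' b' hadj heq
        have h3 : χ a' = χ b' := (Equiv.swap 0 (χ a)).injective heq
        exact h2 s(a', b') (mem_ed.2 hadj) (by simpa using h3)
  choose k hk using key
  have h := Finset.card_le_card_of_injOn (s := oneMono r H)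
    (t := (Finset.univ : Finset (Fin r)) ×ˢ oneMonoZero r H)
    (fun χ => (k χ, fun w => Equiv.swap 0 (k χ) (χ w)))
    (fun χ hχ => Finset.mem_coe.2 (Finset.mem_product.2
      ⟨Finset.mem_univ _, hk χ (Finset.mem_coe.1 hχ)⟩)) (by
    intro χ _ χ' _ heq
    simp only [Prod.mk.injEq] at heq
    obtain ⟨h1, h2⟩ := heq
    funext w
    have := congrFun h2 w
    rw [h1] at this
    exact (Equiv.swap 0 (k χ')).injective this)
  rwa [Finset.card_product, Finset.card_univ, Fintype.card_fin] at h

lemma card_injHoms_fibre_ge [NeZero r] {H : SimpleGraph V} (k : ℕ) {χ : V → Fin r}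
    (hχ : χ ∈ oneMonoZero r H) :
    2 * k.descFactorial (Fintype.card V - 2) ≤
      ((injHoms H (KrmPlus r (k + 2))).filter fun f => (fun w => (f w).1) = χ).card := by
  obtain ⟨_, a, b, hab, ha, hb, hother⟩ := Finset.mem_filter.1 hχ
  have hne := hab.ne
  have hcard : Fintype.card {w : V // w ≠ a ∧ w ≠ b} = Fintype.card V - 2 := by
    rw [Fintype.card_subtype]
    have : (Finset.univ.filter fun w : V => w ≠ a ∧ w ≠ b) = Finset.univ \ {a, b} := by
      ext w; simp
    rw [this, Finset.card_sdiff_of_subset (Finset.subset_univ _), Finset.card_pair hne,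
      Finset.card_univ]
  have hc : Fintype.card (Bool × ({w : V // w ≠ a ∧ w ≠ b} ↪ Fin k)) =
      2 * k.descFactorial (Fintype.card V - 2) := by
    rw [Fintype.card_prod, Fintype.card_bool, Fintype.card_embedding_eq, Fintype.card_fin, hcard]
  rw [← hc, ← Finset.card_univ]
  set s : Bool × ({w : V // w ≠ a ∧ w ≠ b} ↪ Fin k) → V → Fin (k + 2) := fun x w =>
    if h : w ≠ a ∧ w ≠ b then (x.2 ⟨w, h⟩).addNat 2 else if decide (w = a) = x.1 then 0 else 1
    with hs
  have hor : ∀ w, ¬(w ≠ a ∧ w ≠ b) → w = a ∨ w = b := fun w h => by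
    by_contra h'
    exact h (not_or.1 h')
  have hadd : ∀ y z : Fin k, y.addNat 2 = z.addNat 2 → y = z := fun y z h => by
    have := congrArg Fin.val h
    simp only [Fin.val_addNat] at this
    exact Fin.ext (by omega)
  have hs1 : ∀ x w (h : w ≠ a ∧ w ≠ b), s x w = (x.2 ⟨w, h⟩).addNat 2 := fun x w h => by
    simp only [hs]; rw [dif_pos h]
  have hsa : ∀ x, s x a = if x.1 = true then 0 else 1 := fun x => by
    simp only [hs]; rw [dif_neg (by simp)]; cases x.1 <;> simp
  have hsb : ∀ x, s x b = if x.1 = true then 1 else 0 := fun x => by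
    simp only [hs]; rw [dif_neg (by simp)]; cases x.1 <;> simp [hne.symm]
  have hlow : ∀ x w, w = a ∨ w = b → (s x w).val ≤ 1 := by
    rintro x w (rfl | rfl)
    · rw [hsa]; split_ifs <;> simp
    · rw [hsb]; split_ifs <;> simp
  have hab' : ∀ x, s x a ≠ s x b := fun x => by
    rw [hsa, hsb]; split_ifs <;> simp
  have hhigh : ∀ x w, w ≠ a ∧ w ≠ b → 2 ≤ (s x w).val := fun x w h => by
    rw [hs1 x w h]; simp
  have hinj : ∀ x, Function.Injective (s x) := by
    intro x w w' h
    by_cases h1 : w ≠ a ∧ w ≠ b <;> by_cases h2 : w' ≠ a ∧ w' ≠ b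
    · rw [hs1 x w h1, hs1 x w' h2] at h
      have h3 := x.2.injective (hadd _ _ h)
      exact congrArg Subtype.val h3
    · have h3 := hhigh x w h1
      have h4 := hlow x w' (hor w' h2)
      rw [h] at h3; omega
    · have h3 := hhigh x w' h2
      have h4 := hlow x w (hor w h1)
      rw [h] at h4; omega
    · have h3 := hor w h1
      have h4 := hor w' h2
      rcases h3 with h3 | h3 <;> rcases h4 with h4 | h4 <;> rw [h3, h4] <;> rw [h3, h4] at h
      · exact absurd h (hab' x)
      · exact absurd h.symm (hab' x)
  refine Finset.card_le_card_of_injOn (fun x w => (χ w, s x w)) ?_ ?_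
  · intro x _
    refine Finset.mem_coe.2 (Finset.mem_filter.2 ⟨mem_injHoms.2 ⟨?_, ?_⟩, rfl⟩)
    · intro w w' h
      exact hinj x (Prod.ext_iff.1 h).2
    · intro w w' h
      refine ⟨fun hc => h.ne (hinj x (Prod.ext_iff.1 hc).2), ?_⟩
      by_cases hm : χ w = χ w'
      · right
        have h0 := hother w w' h hm
        rw [Sym2.eq_iff] at h0
        have hw : w = a ∨ w = b := h0.imp And.left And.left
        have hw' : w' = a ∨ w' = b := h0.symm.imp And.right And.right
        refine ⟨?_, ?_, hlow x w hw, hlow x w' hw'⟩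
        · rcases hw with hw | hw <;> rw [hw] <;> simp [ha, hb]
        · rcases hw' with hw' | hw' <;> rw [hw'] <;> simp [ha, hb]
      · exact Or.inl hm
  · intro x _ y _ h
    have hxy : ∀ w, s x w = s y w := fun w => (Prod.ext_iff.1 (congrFun h w)).2
    refine Prod.ext ?_ ?_
    · have := hxy a
      rw [hsa, hsa] at this
      cases hx : x.1 <;> cases hy : y.1 <;> simp [hx, hy] at this ⊢
    · ext w
      have := hxy w.1
      rw [hs1 x _ w.2, hs1 y _ w.2] at this
      exact congrArg Fin.val (hadd _ _ this)

lemma card_injHoms_krmPlus_ge [NeZero r] (H : SimpleGraph V) (k : ℕ) :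
    (oneMonoZero r H).card * (2 * k.descFactorial (Fintype.card V - 2)) ≤
      (injHoms H (KrmPlus r (k + 2))).card := by
  have h1 : ∑ χ ∈ oneMonoZero r H, ((injHoms H (KrmPlus r (k + 2))).filter
      fun f => (fun w => (f w).1) = χ).card ≤ (injHoms H (KrmPlus r (k + 2))).card := by
    rw [← Finset.card_biUnion]
    · exact Finset.card_le_card (Finset.biUnion_subset.2 fun χ _ => Finset.filter_subset _ _)
    · intro χ _ χ' _ hne
      refine Finset.disjoint_left.2 fun f hf hf' => hne ?_
      rw [← (Finset.mem_filter.1 hf).2, (Finset.mem_filter.1 hf').2]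
  refine le_trans ?_ h1
  rw [← smul_eq_mul]
  exact Finset.card_nsmul_le_sum _ _ _ fun χ hχ => card_injHoms_fibre_ge k hχ

/-- The asymptotic copy count in `KrmPlus` dominates the number of colourings with exactly one
monochromatic edge. -/
theorem card_oneMono_le_piH [NeZero r] (H : SimpleGraph V) {piH : ℝ}
    (hpi : Tendsto (fun m : ℕ =>
        (copCount H (KrmPlus r m) : ℝ) / (m : ℝ) ^ (Fintype.card V - 2)) atTop (nhds piH)) :
    2 * ((oneMono r H).card : ℝ) ≤ r * (Nat.card (H ≃g H) * piH) := by
  set v := Fintype.card V - 2 with hv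
  set c0 : ℝ := ((oneMonoZero r H).card : ℝ) with hc0
  have key : 2 * c0 ≤ Nat.card (H ≃g H) * piH := by
    have t1 : Tendsto (fun m : ℕ => 2 * c0 * (1 - (v + 2 : ℝ) / m) ^ v) atTop
        (nhds (2 * c0 * (1 - 0) ^ v)) := by
      refine Tendsto.const_mul _ (Tendsto.pow ?_ _)
      exact tendsto_const_nhds.sub (tendsto_const_div_atTop_nhds_zero_nat _)
    rw [sub_zero, one_pow, mul_one] at t1
    refine le_of_tendsto_of_tendsto t1 (hpi.const_mul (Nat.card (H ≃g H) : ℝ)) ?_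
    filter_upwards [eventually_ge_atTop (v + 2)] with m hm
    obtain ⟨j, rfl⟩ : ∃ j, m = j + v + 2 := ⟨m - (v + 2), by omega⟩
    have h1 := (card_injHoms_krmPlus_ge (r := r) H (j + v)).trans (card_injHoms_le H _)
    rw [← hv] at h1
    have h2 : j ^ v ≤ (j + v).descFactorial v :=
      le_trans (Nat.pow_le_pow_left (by omega) _) (Nat.pow_sub_le_descFactorial (j + v) v)
    have h3 : c0 * (2 * (j : ℝ) ^ v) ≤
        Nat.card (H ≃g H) * (copCount H (KrmPlus r (j + v + 2)) : ℝ) := by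
      have := (Nat.mul_le_mul_left (oneMonoZero r H).card (Nat.mul_le_mul_left 2 h2)).trans h1
      rw [hc0]
      exact_mod_cast this
    have hpos : (0 : ℝ) < ((j + v + 2 : ℕ) : ℝ) := by positivity
    have h4 : 1 - (v + 2 : ℝ) / ((j + v + 2 : ℕ) : ℝ) = j / ((j + v + 2 : ℕ) : ℝ) := by
      rw [eq_div_iff hpos.ne', sub_mul, div_mul_cancel₀ _ hpos.ne']
      push_cast; ring
    rw [h4, div_pow, mul_div_assoc', mul_div_assoc']
    exact div_le_div_of_nonneg_right (by linarith) (by positivity)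
  have h5 : ((oneMono r H).card : ℝ) ≤ r * c0 := by
    rw [hc0]; exact_mod_cast card_oneMono_le (r := r) H
  have hr : (0 : ℝ) ≤ r := Nat.cast_nonneg _
  have := mul_le_mul_of_nonneg_left key hr
  linarith

end PlusGraph

section Density

variable {V : Type} [Fintype V] {H : SimpleGraph V}

lemma not_colorable_of_chromaticNumber {V : Type*} {H : SimpleGraph V} {r : ℕ}
    (h : H.chromaticNumber = (r + 1 : ℕ)) : ¬ H.Colorable r := by
  intro hc
  have := hc.chromaticNumber_le
  rw [h] at this
  have := ENat.natCast_le_natCast.1 this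
  omega

omit [Fintype V] in
lemma exists_cycle_of_not_colorable (hnon : ¬ H.Colorable 2) :
    ∃ (u : V) (c : H.Walk u u), c.IsCycle := by
  by_contra hcon
  push Not at hcon
  exact hnon (SimpleGraph.IsAcyclic.colorable_two fun u c => hcon u c)

omit [Fintype V] in
lemma ncard_verts_cycle {u : V} {c : H.Walk u u} (hc : c.IsCycle) :
    c.toSubgraph.verts.ncard = c.length := by
  have h1 : c.toSubgraph.verts = (c.support.tail.toFinset : Set V) := by
    ext w
    rw [SimpleGraph.Walk.mem_verts_toSubgraph, List.coe_toFinset, Set.mem_ofPred_eq]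
    constructor
    · intro hw
      rw [SimpleGraph.Walk.mem_support_iff] at hw
      rcases hw with rfl | hw
      · exact SimpleGraph.Walk.end_mem_tail_support hc.not_nil
      · exact hw
    · exact List.mem_of_mem_tail
  rw [h1, Set.ncard_coe_finset, List.toFinset_card_of_nodup hc.support_nodup, List.length_tail,
    SimpleGraph.Walk.length_support]
  rfl

omit [Fintype V] in
lemma ncard_edges_cycle {u : V} {c : H.Walk u u} (hc : c.IsCycle) :
    c.toSubgraph.edgeSet.ncard = c.length := by
  have h1 : c.toSubgraph.edgeSet = (c.edges.toFinset : Set (Sym2 V)) := by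
    ext w
    rw [SimpleGraph.Walk.mem_edges_toSubgraph, List.coe_toFinset, Set.mem_ofPred_eq]
  rw [h1, Set.ncard_coe_finset, List.toFinset_card_of_nodup hc.isTrail.edges_nodup,
    SimpleGraph.Walk.length_edges]

lemma three_le_card_of_not_colorable (hnon : ¬ H.Colorable 2) : 3 ≤ Fintype.card V := by
  by_contra hlt
  exact hnon ((H.colorable_of_fintype).mono (by omega))

/-- A strictly 2-balanced nonbipartite graph has 2-density greater than one. -/
lemma one_lt_m2 (hnon : ¬ H.Colorable 2) (hbal : StrictlyTwoBalanced H) : 1 < m2 H := by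
  obtain ⟨u, c, hc⟩ := exists_cycle_of_not_colorable hnon
  have h3 := hc.three_le_length
  have h3' : (3 : ℝ) ≤ c.length := by exact_mod_cast h3
  have hv := ncard_verts_cycle hc
  have he := ncard_edges_cycle hc
  have hlt : (1 : ℝ) < ((c.toSubgraph.edgeSet.ncard : ℝ) - 1) /
      ((c.toSubgraph.verts.ncard : ℝ) - 2) := by
    rw [hv, he, lt_div_iff₀ (by linarith)]
    linarith
  by_cases htop : c.toSubgraph = ⊤
  · rw [htop, SimpleGraph.Subgraph.edgeSet_top, SimpleGraph.Subgraph.verts_top,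
      Set.ncard_univ, Nat.card_eq_fintype_card, ← hbal.2.1] at hlt
    exact hlt
  · exact hlt.trans (hbal.2.2 _ (by rw [he]; omega) htop)

lemma m2_mul (hnon : ¬ H.Colorable 2) (hbal : StrictlyTwoBalanced H) :
    m2 H * ((Fintype.card V : ℝ) - 2) = ((ed H).card : ℝ) - 1 := by
  have h3 : (3 : ℝ) ≤ Fintype.card V := by
    exact_mod_cast three_le_card_of_not_colorable hnon
  rw [hbal.2.1, card_ed, div_mul_cancel₀]
  linarith

lemma three_le_card_ed (hnon : ¬ H.Colorable 2) :
    3 ≤ (ed H).card := by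
  obtain ⟨u, c, hc⟩ := exists_cycle_of_not_colorable hnon
  rw [card_ed]
  refine hc.three_le_length.trans ?_
  rw [← ncard_edges_cycle hc]
  exact Set.ncard_le_ncard (SimpleGraph.Subgraph.edgeSet_subset _) (Set.toFinite _)

lemma mem_cov {F : Finset (Sym2 V)} {w : V} : w ∈ cov F ↔ ∃ d ∈ F, w ∈ d := by
  unfold cov
  rw [Finset.mem_filter]
  exact ⟨fun h => h.2, fun h => ⟨Finset.mem_univ _, h⟩⟩

lemma two_le_card_cov {F : Finset (Sym2 V)} (hF : ∀ d ∈ F, ¬ d.IsDiag) (hne : F.Nonempty) :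
    2 ≤ (cov F).card := by
  obtain ⟨d, hd⟩ := hne
  have hdd := hF d hd
  induction d using Sym2.ind with
  | _ a b =>
    have hab : a ≠ b := by simpa using hdd
    rw [← Finset.card_pair hab]
    refine Finset.card_le_card fun w hw => mem_cov.2 ⟨_, hd, ?_⟩
    simpa using hw

lemma three_le_card_cov {F : Finset (Sym2 V)} (hF : ∀ d ∈ F, ¬ d.IsDiag) (h2 : 2 ≤ F.card) :
    3 ≤ (cov F).card := by
  by_contra hlt
  have hc : (cov F).card = 2 := by
    have := two_le_card_cov hF (Finset.card_pos.1 (by omega))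
    omega
  obtain ⟨a, b, hab, hcov⟩ := Finset.card_eq_two.1 hc
  have : F ⊆ {s(a, b)} := by
    intro d hd
    have hdd := hF d hd
    have hsub : ∀ w ∈ d, w = a ∨ w = b := fun w hw => by
      have : w ∈ cov F := mem_cov.2 ⟨d, hd, hw⟩
      rw [hcov] at this
      simpa using this
    rw [Finset.mem_singleton]
    induction d using Sym2.ind with
    | _ x y =>
      have hxy : x ≠ y := by simpa using hdd
      have hx := hsub x (Sym2.mem_mk_left _ _)
      have hy := hsub y (Sym2.mem_mk_right _ _)
      rw [Sym2.eq_iff]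
      rcases hx with rfl | rfl <;> rcases hy with rfl | rfl
      · exact absurd rfl hxy
      · exact Or.inl ⟨rfl, rfl⟩
      · exact Or.inr ⟨rfl, rfl⟩
      · exact absurd rfl hxy
  have := Finset.card_le_card this
  rw [Finset.card_singleton] at this
  omega

/-- The subgraph spanned by a set of edges. -/
def spanned (H : SimpleGraph V) (F : Finset (Sym2 V)) (hF : F ⊆ ed H) : H.Subgraph where
  verts := cov F
  Adj a b := s(a, b) ∈ F
  adj_sub h := mem_ed.1 (hF h)
  edge_vert h := Finset.mem_coe.2 (mem_cov.2 ⟨_, h, Sym2.mem_mk_left _ _⟩)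
  symm := ⟨fun a b h => by rwa [Sym2.eq_swap]⟩

lemma edgeSet_spanned (F : Finset (Sym2 V)) (hF : F ⊆ ed H) :
    (spanned H F hF).edgeSet = F := by
  ext d
  induction d using Sym2.ind with
  | _ a b => rfl

lemma card_sub_one_lt {F : Finset (Sym2 V)} (hbal : StrictlyTwoBalanced H) (hF : F ⊆ ed H)
    (h2 : 2 ≤ F.card) (hne : F ≠ ed H) :
    (F.card : ℝ) - 1 < m2 H * ((cov F).card - 2) := by
  have hcov : (3 : ℝ) ≤ (cov F).card := by
    exact_mod_cast three_le_card_cov (fun d hd => ed_not_isDiag (hF hd)) h2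
  have hE : (spanned H F hF).edgeSet.ncard = F.card := by
    rw [edgeSet_spanned, Set.ncard_coe_finset]
  have hV : (spanned H F hF).verts.ncard = (cov F).card := Set.ncard_coe_finset _
  have := hbal.2.2 (spanned H F hF) (by rwa [hE]) (by
    intro h
    apply hne
    have h3 := edgeSet_spanned F hF
    rw [h, SimpleGraph.Subgraph.edgeSet_top] at h3
    ext d
    rw [mem_ed, h3, Finset.mem_coe])
  rw [hE, hV, div_lt_iff₀ (by linarith)] at this
  exact this

lemma card_sub_one_le {F : Finset (Sym2 V)} (hnon : ¬ H.Colorable 2)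
    (hbal : StrictlyTwoBalanced H) (hF : F ⊆ ed H)
    (hne : F.Nonempty) : (F.card : ℝ) - 1 ≤ m2 H * ((cov F).card - 2) := by
  have hm : 1 < m2 H := one_lt_m2 hnon hbal
  have hnd : ∀ d ∈ F, ¬ d.IsDiag := fun d hd => ed_not_isDiag (hF hd)
  by_cases h2 : 2 ≤ F.card
  · by_cases he : F = ed H
    · by_cases ht : spanned H F hF = ⊤
      · have hV : (spanned H F hF).verts.ncard = (cov F).card := Set.ncard_coe_finset _
        rw [ht, SimpleGraph.Subgraph.verts_top, Set.ncard_univ, Nat.card_eq_fintype_card] at hV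
        rw [← hV, m2_mul hnon hbal, he]
      · have hcov : (3 : ℝ) ≤ (cov F).card := by
          exact_mod_cast three_le_card_cov hnd h2
        have hE : (spanned H F hF).edgeSet.ncard = F.card := by
          rw [edgeSet_spanned, Set.ncard_coe_finset]
        have hV : (spanned H F hF).verts.ncard = (cov F).card := Set.ncard_coe_finset _
        have := hbal.2.2 (spanned H F hF) (by rwa [hE]) ht
        rw [hE, hV, div_lt_iff₀ (by linarith)] at this
        exact this.le
    · exact (card_sub_one_lt hbal hF h2 he).le
  · have h1 : F.card = 1 := by
      have := hne.card_pos
      omega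
    have hcov : (2 : ℝ) ≤ (cov F).card := by exact_mod_cast two_le_card_cov hnd hne
    rw [h1]
    push_cast
    nlinarith

lemma exists_density_gap (hbal : StrictlyTwoBalanced H) :
    ∃ γ > 0, ∀ F ⊆ ed H, 2 ≤ F.card → F ≠ ed H →
      (F.card : ℝ) - 1 + γ ≤ m2 H * ((cov F).card - 2) := by
  set T := (ed H).powerset.filter fun F => 2 ≤ F.card ∧ F ≠ ed H with hT
  rcases T.eq_empty_or_nonempty with h | h
  · refine ⟨1, one_pos, fun F hF h2 hne => ?_⟩
    have : F ∈ T := Finset.mem_filter.2 ⟨Finset.mem_powerset.2 hF, h2, hne⟩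
    rw [h] at this
    exact absurd this (Finset.notMem_empty _)
  · obtain ⟨F₀, hF₀, hmin⟩ := T.exists_min_image
      (fun F => m2 H * ((cov F).card - 2) - ((F.card : ℝ) - 1)) h
    obtain ⟨h1, h2, h3⟩ := Finset.mem_filter.1 hF₀
    refine ⟨_, sub_pos.2 (card_sub_one_lt hbal (Finset.mem_powerset.1 h1) h2 h3),
      fun F hF h2 hne => ?_⟩
    have := hmin F (Finset.mem_filter.2 ⟨Finset.mem_powerset.2 hF, h2, hne⟩)
    linarith

/-- Lower bound on the expected number of extensions of an edge to a copy of a graph. -/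
lemma rpow_le_pow_mul_pow {n : ℕ} {p c m γ : ℝ} {a b h : ℕ} (hn : 1 ≤ n) (hm : 0 < m)
    (hc : 0 < c) (hc1 : c ≤ 1) (hp : c * (n : ℝ) ^ (-(1 / m)) ≤ p) (hab : (b : ℝ) + γ ≤ m * a)
    (hbh : b ≤ h) : c ^ h * (n : ℝ) ^ (γ / m) ≤ (n : ℝ) ^ a * p ^ b := by
  have hn0 : (0 : ℝ) < n := by exact_mod_cast hn
  have hn1 : (1 : ℝ) ≤ n := by exact_mod_cast hn
  calc c ^ h * (n : ℝ) ^ (γ / m) ≤ c ^ b * (n : ℝ) ^ ((a : ℝ) - b / m) := by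
        refine mul_le_mul (pow_le_pow_of_le_one hc.le hc1 hbh)
          (Real.rpow_le_rpow_of_exponent_le hn1 ?_) (by positivity) (by positivity)
        rw [div_le_iff₀ hm, sub_mul, div_mul_cancel₀ _ hm.ne']
        linarith
    _ = (n : ℝ) ^ a * (c * (n : ℝ) ^ (-(1 / m))) ^ b := by
        rw [mul_pow, ← Real.rpow_natCast (n ^ (-(1 / m)) : ℝ) b, ← Real.rpow_mul hn0.le,
          sub_eq_add_neg, Real.rpow_add hn0, Real.rpow_natCast]
        rw [show -((b : ℝ) / m) = -(1 / m) * b by ring]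
        ring
    _ ≤ (n : ℝ) ^ a * p ^ b := by
        gcongr

end Density

section Moments

variable {V : Type} [Fintype V] {H : SimpleGraph V} {n : ℕ} {p : ℝ}

/-- The expected number of extensions of an edge to a copy of `H`, up to constants. -/
def lam (H : SimpleGraph V) (n : ℕ) (p : ℝ) : ℝ :=
  (n : ℝ) ^ (Fintype.card V - 2) * p ^ ((ed H).card - 1)

/-- The constant in the second-moment estimates. -/
def ovl (H : SimpleGraph V) : ℝ := 2 ^ (ed H).card * (Fintype.card V : ℝ) ^ Fintype.card V

lemma ovl_nonneg (H : SimpleGraph V) : 0 ≤ ovl H := by unfold ovl; positivity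

/-- Every rooted subgraph of `H` has many expected extensions. -/
structure Rooted (H : SimpleGraph V) (n : ℕ) (p C ν : ℝ) : Prop where
  one : ∀ F ⊆ ed H, F.Nonempty →
    1 ≤ C * ((n : ℝ) ^ ((cov F).card - 2) * p ^ (F.card - 1))
  gap : ∀ F ⊆ ed H, 2 ≤ F.card → F ≠ ed H →
    ν ≤ C * ((n : ℝ) ^ ((cov F).card - 2) * p ^ (F.card - 1))

lemma ext_of_rpow {c γ : ℝ} (hnon : ¬ H.Colorable 2) (hbal : StrictlyTwoBalanced H)
    (hgap : ∀ F ⊆ ed H, 2 ≤ F.card → F ≠ ed H →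
      (F.card : ℝ) - 1 + γ ≤ m2 H * ((cov F).card - 2))
    (hn : 1 ≤ n) (hc : 0 < c) (hc1 : c ≤ 1) (hp : c * (n : ℝ) ^ (-(1 / m2 H)) ≤ p) :
    Rooted H n p (1 / c ^ (ed H).card) ((n : ℝ) ^ (γ / m2 H)) := by
  have hm : 0 < m2 H := zero_lt_one.trans (one_lt_m2 hnon hbal)
  have hcp : 0 < c ^ (ed H).card := by positivity
  have key : ∀ F ⊆ ed H, F.Nonempty → ∀ δ : ℝ,
      (F.card : ℝ) - 1 + δ ≤ m2 H * ((cov F).card - 2) →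
      (n : ℝ) ^ (δ / m2 H) ≤
        1 / c ^ (ed H).card * ((n : ℝ) ^ ((cov F).card - 2) * p ^ (F.card - 1)) := by
    intro F hF hne δ hδ
    have h1 : 1 ≤ F.card := hne.card_pos
    have h2 : 2 ≤ (cov F).card := two_le_card_cov (fun d hd => ed_not_isDiag (hF hd)) hne
    have := rpow_le_pow_mul_pow (γ := δ) (a := (cov F).card - 2) (b := F.card - 1)
      (h := (ed H).card) hn hm hc hc1 hp (by
        rw [Nat.cast_sub h1, Nat.cast_sub h2]
        push_cast
        exact hδ) ((Nat.sub_le _ _).trans (Finset.card_le_card hF))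
    rw [one_div, ← div_eq_inv_mul, le_div_iff₀ hcp, mul_comm]
    exact this
  refine ⟨fun F hF hne => ?_, fun F hF h2 hne => ?_⟩
  · have := key F hF hne 0 (by rw [add_zero]; exact card_sub_one_le hnon hbal hF hne)
    rwa [zero_div, Real.rpow_zero] at this
  · exact key F hF (Finset.card_pos.1 (by omega)) γ (hgap F hF h2 hne)

lemma pow_mul_pow_split {D F : Finset (Sym2 V)} (hD : D ⊆ ed H) (hF : F ⊆ D)
    (hne : F.Nonempty) :
    (n : ℝ) ^ (Fintype.card V - (cov F).card) * p ^ (D.card - F.card) *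
      ((n : ℝ) ^ ((cov F).card - 2) * p ^ (F.card - 1)) =
      (n : ℝ) ^ (Fintype.card V - 2) * p ^ (D.card - 1) := by
  have h1 : 1 ≤ F.card := hne.card_pos
  have h2 : 2 ≤ (cov F).card := two_le_card_cov (fun d hd => ed_not_isDiag (hD (hF hd))) hne
  have h3 : (cov F).card ≤ Fintype.card V := Finset.card_le_univ _
  have h4 := Finset.card_le_card hF
  rw [show Fintype.card V - 2 = (Fintype.card V - (cov F).card) + ((cov F).card - 2) by omega,
    show D.card - 1 = (D.card - F.card) + (F.card - 1) by omega, pow_add, pow_add]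
  ring

lemma mul_le_of_ext {D F : Finset (Sym2 V)} {C ν : ℝ} (h0 : 0 ≤ p) (hD : D ⊆ ed H) (hF : F ⊆ D)
    (hne : F.Nonempty)
    (h : ν ≤ C * ((n : ℝ) ^ ((cov F).card - 2) * p ^ (F.card - 1))) :
    (n : ℝ) ^ (Fintype.card V - (cov F).card) * p ^ (D.card - F.card) * ν ≤
      C * ((n : ℝ) ^ (Fintype.card V - 2) * p ^ (D.card - 1)) := by
  rw [← pow_mul_pow_split hD hF hne]
  have : 0 ≤ (n : ℝ) ^ (Fintype.card V - (cov F).card) * p ^ (D.card - F.card) := by positivity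
  calc _ ≤ _ := mul_le_mul_of_nonneg_left h this
    _ = _ := by ring

lemma card_pow_eq (h3 : 2 ≤ Fintype.card V) (h1 : 1 ≤ (ed H).card) :
    (n : ℝ) ^ Fintype.card V * p ^ (ed H).card = (n : ℝ) ^ 2 * p * lam H n p := by
  unfold lam
  rw [show (n : ℝ) ^ Fintype.card V = (n : ℝ) ^ 2 * (n : ℝ) ^ (Fintype.card V - 2) by
      rw [← pow_add]; congr 1; omega,
    show p ^ (ed H).card = p * p ^ ((ed H).card - 1) by
      rw [← pow_succ']; congr 1; omega]
  ring

lemma sum_pairs_eq (h0 : 0 ≤ p) (𝓢 : Finset (Sym2 V) → Prop) {B : ℝ} (hB0 : 0 ≤ B)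
    (hB : ∀ F ⊆ ed H, 𝓢 F →
      (n : ℝ) ^ (Fintype.card V - (cov F).card) * p ^ ((ed H).card - F.card) ≤ B) :
    Ex p (fun G : EdgeSetGraph n => (nPairs H 𝓢 G : ℝ)) ≤
      (n : ℝ) ^ Fintype.card V * p ^ (ed H).card * (ovl H * B) := by
  unfold nPairs
  rw [Ex_cnt]
  refine le_trans (le_of_eq ?_) (double_pair_sum_le h0 (fun d hd => ed_not_isDiag hd) 𝓢 hB hB0)
  unfold pairs im₂
  rw [Finset.sum_filter, Fintype.sum_prod_type]
  refine Finset.sum_congr rfl fun ψ _ => ?_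
  rw [Finset.sum_filter]

lemma Ex_nPairs_nonempty_le {C ν : ℝ} (h0 : 0 ≤ p) (hC : 0 ≤ C) (h2 : 2 ≤ Fintype.card V)
    (h1 : 1 ≤ (ed H).card) (hext : Rooted H n p C ν) :
    Ex p (fun G : EdgeSetGraph n => (nPairs H Finset.Nonempty G : ℝ)) ≤
      ovl H * C * ((n : ℝ) ^ 2 * p * lam H n p ^ 2) := by
  have hl : 0 ≤ lam H n p := by unfold lam; positivity
  refine (sum_pairs_eq h0 _ (B := C * lam H n p) (by positivity) fun F hF hne => ?_).trans
    (le_of_eq ?_)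
  · have := mul_le_of_ext h0 subset_rfl hF hne (hext.one F hF hne)
    rwa [mul_one] at this
  · rw [card_pow_eq h2 h1]; ring

lemma Ex_nPairs_overlap_le {C ν : ℝ} (h0 : 0 ≤ p) (hC : 0 ≤ C) (h2 : 2 ≤ Fintype.card V)
    (h1 : 1 ≤ (ed H).card) (hν : 0 < ν) (hext : Rooted H n p C ν) :
    Ex p (fun G : EdgeSetGraph n => (nPairs H (fun F => 2 ≤ F.card ∧ F ≠ ed H) G : ℝ)) ≤
      ovl H * C * ((n : ℝ) ^ 2 * p * lam H n p ^ 2) / ν := by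
  have hl : 0 ≤ lam H n p := by unfold lam; positivity
  refine (sum_pairs_eq h0 _ (B := C * lam H n p / ν) (by positivity) fun F hF hne => ?_).trans
    (le_of_eq ?_)
  · rw [le_div_iff₀ hν]
    exact mul_le_of_ext h0 subset_rfl hF (Finset.card_pos.1 (by omega)) (hext.gap F hF hne.1 hne.2)
  · rw [card_pow_eq h2 h1]; ring

lemma variance_le {C ν : ℝ} (h0 : 0 ≤ p) (hC : 0 ≤ C) (hext : Rooted H n p C ν)
    {D : Finset (Sym2 V)} (hD : D ⊆ ed H) :
    ∑ ψ : V ↪ Fin n, ∑ ψ' ∈ Finset.univ.filter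
      (fun ψ' : V ↪ Fin n => ¬ Disjoint (im D ψ) (im D ψ')), p ^ (im D ψ ∪ im D ψ').card ≤
      (n : ℝ) ^ Fintype.card V * p ^ D.card *
        (ovl H * (C * ((n : ℝ) ^ (Fintype.card V - 2) * p ^ (D.card - 1)))) := by
  have h := double_pair_sum_le (n := n) h0 (D := D) (fun d hd => ed_not_isDiag (hD hd))
    Finset.Nonempty (B := C * ((n : ℝ) ^ (Fintype.card V - 2) * p ^ (D.card - 1)))
    (fun F hF hne => by
      have := mul_le_of_ext h0 hD hF hne (hext.one F (hF.trans hD) hne)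
      rwa [mul_one] at this) (by positivity)
  refine le_trans (le_of_eq ?_) (le_trans h ?_)
  · refine Finset.sum_congr rfl fun ψ _ => Finset.sum_congr ?_ fun ψ' _ => by congr!
    ext ψ'
    constructor
    · intro hm
      have h2 := (not_disjoint_im_iff D ψ ψ').1 (Finset.mem_filter.1 hm).2
      simp only [Finset.mem_filter, Finset.mem_univ, true_and]
      exact h2
    · intro hm
      simp only [Finset.mem_filter, Finset.mem_univ, true_and] at hm ⊢
      exact (not_disjoint_im_iff D ψ ψ').2 hm
  have h2 : (2 : ℝ) ^ D.card ≤ 2 ^ (ed H).card :=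
    pow_le_pow_right₀ (by norm_num) (Finset.card_le_card hD)
  have h3 : (2 : ℝ) ^ D.card * (Fintype.card V : ℝ) ^ Fintype.card V ≤ ovl H :=
    mul_le_mul_of_nonneg_right h2 (by positivity)
  exact mul_le_mul_of_nonneg_left (mul_le_mul_of_nonneg_right h3 (by positivity))
    (by positivity)

lemma mean_le {D : Finset (Sym2 V)} (h0 : 0 ≤ p) (hD : D ⊆ ed H) :
    ∑ ψ : V ↪ Fin n, p ^ (im D ψ).card ≤ (n : ℝ) ^ Fintype.card V * p ^ D.card := by
  have : ∀ ψ : V ↪ Fin n, p ^ (im D ψ).card = p ^ D.card := fun ψ => by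
    rw [card_im (fun d hd => ed_not_isDiag (hD hd))]
  simp only [this]
  rw [Finset.sum_const, nsmul_eq_mul, Finset.card_univ]
  exact mul_le_mul_of_nonneg_right card_embedding_le (by positivity)

/-- Uniform upper tail for the embeddings of a subgraph of `H` selected by a parameter. -/
lemma Ex_uniform_embeddings {C ν : ℝ} (h0 : 0 ≤ p) (h1 : p ≤ 1) (hC : 0 ≤ C)
    (hext : Rooted H n p C ν) {D : Finset (Sym2 V)} (hD : D ⊆ ed H) {Θ : Type*} [Fintype Θ]
    (Q : Θ → (V ↪ Fin n) → Prop) {B t t' : ℝ} (ht : 0 < t) (ht' : 0 < t')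
    (hB1 : (n : ℝ) ^ Fintype.card V * p ^ D.card ≤ B)
    (hB2 : (n : ℝ) ^ Fintype.card V * p ^ D.card *
        (ovl H * (C * ((n : ℝ) ^ (Fintype.card V - 2) * p ^ (D.card - 1)))) ≤ B) :
    Ex p (fun G : EdgeSetGraph n => ind (∃ θ,
      p ^ D.card * ((Finset.univ : Finset (V ↪ Fin n)).filter (Q θ)).card + 2 * t ≤
        (cnt (fun ψ : V ↪ Fin n => im D ψ) (Finset.univ.filter (Q θ)) G : ℝ))) ≤
      (t' + B * Real.exp (-(t' ^ 2 / (8 * B)))) / t +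
        Fintype.card Θ * Real.exp (-(t ^ 2 / (8 * B))) := by
  have := Ex_uniform_upper h0 h1 (fun ψ : V ↪ Fin n => im D ψ) Finset.univ Q ht ht'
    ((mean_le h0 hD).trans hB1) (by
      refine le_trans (le_of_eq ?_) ((variance_le h0 hC hext hD).trans hB2)
      congr!)
  refine le_trans (le_of_eq ?_) this
  congr 1
  funext G
  congr 1
  refine propext (exists_congr fun θ => ?_)
  have hs : ∑ i ∈ Finset.univ.filter (Q θ), p ^ (im D i).card =
      p ^ D.card * ((Finset.univ : Finset (V ↪ Fin n)).filter (Q θ)).card := by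
    have : ∀ ψ : V ↪ Fin n, p ^ (im D ψ).card = p ^ D.card := fun ψ => by
      rw [card_im (fun d hd => ed_not_isDiag (hD hd))]
    simp only [this]
    rw [Finset.sum_const, nsmul_eq_mul, mul_comm]
  rw [hs]

lemma card_touch_embeddings_le (Z : Finset (Fin n)) :
    (((Finset.univ : Finset (V ↪ Fin n)).filter fun ψ => ∃ w, ψ w ∈ Z).card : ℝ) ≤
      Fintype.card V * (Z.card * (n : ℝ) ^ (Fintype.card V - 1)) := by
  have h1 : ((Finset.univ : Finset (V ↪ Fin n)).filter fun ψ => ∃ w, ψ w ∈ Z).card ≤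
      ∑ w : V, ((Finset.univ : Finset (V ↪ Fin n)).filter fun ψ => ψ w ∈ Z).card := by
    refine le_trans (Finset.card_le_card fun ψ hψ => ?_) Finset.card_biUnion_le
    obtain ⟨_, w, hw⟩ := Finset.mem_filter.1 hψ
    exact Finset.mem_biUnion.2 ⟨w, Finset.mem_univ _,
      Finset.mem_filter.2 ⟨Finset.mem_univ _, hw⟩⟩
  have h2 : ∀ w : V, ((Finset.univ : Finset (V ↪ Fin n)).filter fun ψ => ψ w ∈ Z).card ≤
      Z.card * n ^ (Fintype.card V - 1) := by
    intro w
    set S : V → Finset (Fin n) := fun u => if u = w then Z else Finset.univ with hS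
    have h3 : ((Finset.univ : Finset (V ↪ Fin n)).filter fun ψ => ψ w ∈ Z).card ≤
        (Fintype.piFinset S).card := by
      refine Finset.card_le_card_of_injOn (fun ψ => (ψ : V → Fin n)) ?_ ?_
      · intro ψ hψ
        have h4 : ψ w ∈ Z := (Finset.mem_filter.1 (Finset.mem_coe.1 hψ)).2
        refine Finset.mem_coe.2 (Fintype.mem_piFinset.2 fun u => ?_)
        simp only [hS]
        split_ifs with h
        · rw [h]; exact h4
        · exact Finset.mem_univ _
      · intro ψ _ ψ' _ h
        exact DFunLike.coe_injective h
    rw [Fintype.card_piFinset, ← Finset.mul_prod_erase _ _ (Finset.mem_univ w)] at h3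
    have h5 : ∏ u ∈ Finset.univ.erase w, (S u).card = n ^ (Fintype.card V - 1) := by
      rw [Finset.prod_congr rfl (g := fun _ => n)]
      · rw [Finset.prod_const, Finset.card_erase_of_mem (Finset.mem_univ w), Finset.card_univ]
      · intro u hu
        simp [hS, Finset.ne_of_mem_erase hu]
    rw [h5] at h3
    simpa [hS] using h3
  have h3 := h1.trans (Finset.sum_le_sum fun w _ => h2 w)
  rw [Finset.sum_const, smul_eq_mul, Finset.card_univ] at h3
  exact_mod_cast h3

end Moments

section Typical

variable {n r : ℕ} {p : ℝ}

lemma exp_neg_mul_le {q : ℝ} (hq : 0 < q) (k : ℕ) : Real.exp (-(k * q)) ≤ 1 / q ^ k := by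
  rw [Real.exp_neg, Real.exp_nat_mul, one_div]
  have : q ≤ Real.exp q := by linarith [Real.add_one_le_exp q]
  exact inv_anti₀ (by positivity) (pow_le_pow_left₀ hq.le this k)

lemma exp_neg_le_of_mul_le {q x : ℝ} (hq : 0 < q) (k : ℕ) (hx : k * q ≤ x) :
    Real.exp (-x) ≤ 1 / q ^ k :=
  (Real.exp_le_exp.2 (neg_le_neg hx)).trans (exp_neg_mul_le hq k)

lemma Ex_ind_or_le {E : Type*} [Fintype E] {p : ℝ} (h0 : 0 ≤ p) (h1 : p ≤ 1)
    (P Q : Finset E → Prop) :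
    Ex p (fun G => ind (P G ∨ Q G)) ≤ Ex p (fun G => ind (P G)) + Ex p (fun G => ind (Q G)) := by
  rw [← Ex_add]
  refine Ex_mono h0 h1 fun G => ind_le_of (add_nonneg (ind_nonneg _) (ind_nonneg _)) ?_
  rintro (h | h)
  · rw [ind_of h]; linarith [ind_nonneg (Q G)]
  · rw [ind_of h]; linarith [ind_nonneg (P G)]

lemma card_nbr_univ (u : Fin n) : (nbr (Finset.univ : EdgeSetGraph n) u).card + 1 = n := by
  have : insert u (nbr (Finset.univ : EdgeSetGraph n) u) = Finset.univ := by
    ext v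
    simp only [Finset.mem_insert, Finset.mem_univ, iff_true, mem_nbr]
    by_cases h : v = u
    · exact Or.inl h
    · exact Or.inr ⟨fun h' => h h'.symm, trivial⟩
  have h2 : u ∉ nbr (Finset.univ : EdgeSetGraph n) u := fun h => (mem_nbr.1 h).1 rfl
  rw [← Finset.card_insert_of_notMem h2, this, Finset.card_univ, Fintype.card_fin]

lemma Ex_nbr_lower_tail (h0 : 0 ≤ p) (h1 : p ≤ 1) (u : Fin n) {t B : ℝ} (ht : 0 < t)
    (hB : n * p ≤ B) :
    Ex p (fun G : EdgeSetGraph n => ind (((nbr G u).card : ℝ) ≤ p * (n - 1) - t)) ≤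
      Real.exp (-(t ^ 2 / (8 * B))) := by
  have hc : (((Finset.univ : EdgeSetGraph n).filter fun e => u ∈ e.1).card : ℝ) = n - 1 := by
    rw [← card_nbr, eq_sub_iff_add_eq]
    exact_mod_cast card_nbr_univ u
  have := Ex_inter_lower_tail h0 h1 ((Finset.univ : EdgeSetGraph n).filter fun e => u ∈ e.1)
    (B := B) ht (by rw [hc]; nlinarith)
  refine le_trans (le_of_eq ?_) this
  congr 1
  funext G
  have h2 : (((Finset.univ : EdgeSetGraph n).filter fun e => u ∈ e.1) ∩ G).card =
      (nbr G u).card := by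
    rw [card_nbr]
    congr 1
    ext e
    constructor
    · intro h
      obtain ⟨h3, h4⟩ := Finset.mem_inter.1 h
      exact Finset.mem_filter.2 ⟨h4, (Finset.mem_filter.1 h3).2⟩
    · intro h
      obtain ⟨h3, h4⟩ := Finset.mem_filter.1 h
      exact Finset.mem_inter.2 ⟨Finset.mem_filter.2 ⟨Finset.mem_univ _, h4⟩, h3⟩
  rw [← hc, ← h2]
  congr!

lemma Ex_card_upper_tail (h0 : 0 ≤ p) (h1 : p ≤ 1) {t t' : ℝ} (ht : 0 < t) (ht' : 0 < t') :
    Ex p (fun G : EdgeSetGraph n => ind (p * n ^ 2 / 2 + t ≤ (G.card : ℝ))) ≤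
      (t' + n ^ 2 * p * Real.exp (-(t' ^ 2 / (8 * (n ^ 2 * p))))) / t := by
  have hcard : (Fintype.card (EdgeType n) : ℝ) ≤ n ^ 2 / 2 := by
    rw [card_edgeType]
    have : 2 * n.choose 2 ≤ n ^ 2 := by
      rw [Nat.choose_two_right]
      calc 2 * (n * (n - 1) / 2) ≤ n * (n - 1) := Nat.mul_div_le _ _
        _ ≤ n ^ 2 := by rw [sq]; exact Nat.mul_le_mul_left _ (Nat.sub_le _ _)
    have h2 : (2 : ℝ) * n.choose 2 ≤ n ^ 2 := by exact_mod_cast this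
    linarith
  have hμ : ∑ i : EdgeType n, p ^ ({i} : Finset (EdgeType n)).card =
      p * Fintype.card (EdgeType n) := by
    simp [mul_comm]
  have hle : p * Fintype.card (EdgeType n) ≤ p * n ^ 2 / 2 := by
    rw [mul_div_assoc]; exact mul_le_mul_of_nonneg_left hcard h0
  have hB : p * Fintype.card (EdgeType n) ≤ n ^ 2 * p := by nlinarith [sq_nonneg (n : ℝ)]
  have hpair : ∀ i : EdgeType n, ∑ j ∈ Finset.univ.filter
      (fun j : EdgeType n => ¬ Disjoint ({i} : Finset (EdgeType n)) {j}),
      p ^ ((({i} : Finset (EdgeType n)) ∪ {j}).card) = p := by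
    intro i
    have : (Finset.univ.filter fun j : EdgeType n =>
        ¬ Disjoint ({i} : Finset (EdgeType n)) {j}) = {i} := by
      ext j
      simp [eq_comm]
    rw [this, Finset.sum_singleton, Finset.union_self, Finset.card_singleton, pow_one]
  have := Ex_total_upper h0 h1 (fun e : EdgeType n => ({e} : Finset (EdgeType n))) Finset.univ
    (B := n ^ 2 * p) ht ht' (by rw [hμ]; exact hB) (by
      refine le_trans (le_of_eq ?_) hB
      rw [← hμ]
      refine Finset.sum_congr rfl fun i _ => ?_
      rw [Finset.card_singleton, pow_one]
      refine Eq.trans ?_ (hpair i)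
      congr!)
  refine le_trans (Ex_mono h0 h1 fun G => ind_mono fun h => ?_) this
  have hcnt : cnt (fun e : EdgeType n => ({e} : Finset (EdgeType n))) Finset.univ G = G.card := by
    rw [cnt_eq]
    congr 1
    ext e
    rw [mem_cset]
    simp
  rw [hcnt, hμ]
  linarith

/-- A random graph is typical with high probability. -/
lemma Ex_not_typ_le {q : ℝ} (h0 : 0 < p) (h1 : p ≤ 1) (hq : 1000 * ((r : ℝ) + 1) ≤ q)
    (hn : (n : ℝ) ≤ Real.exp q) (hnp : q ^ 400 ≤ n * p) :
    Ex p (fun G : EdgeSetGraph n => ind (¬ Typ r p ((1 / q ^ 30) ^ 2) G)) ≤ 1 / q ^ 20 := by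
  have hr0 : (0 : ℝ) ≤ r := Nat.cast_nonneg _
  have hq1000 : 1000 ≤ q := by linarith
  have hq0 : 0 < q := by linarith
  have hq1 : 1 ≤ q := by linarith
  have hn1 : q ^ 400 ≤ n := hnp.trans (mul_le_of_le_one_right (Nat.cast_nonneg _) h1)
  have hn0 : (0 : ℝ) < n := lt_of_lt_of_le (by positivity) hn1
  have hnq : q ≤ n := (le_self_pow₀ hq1 (by norm_num)).trans hn1
  set ζ := (1 / q ^ 30) ^ 2 with hζ
  have hζe : ζ = 1 / q ^ 60 := by rw [hζ]; ring
  have hζ0 : 0 < ζ := by positivity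
  set μ := (n : ℝ) * p with hμ
  have hμ0 : 0 < μ := mul_pos hn0 h0
  have e2 : (n : ℝ) ^ 2 * p = n * μ := by rw [hμ]; ring
  -- degrees
  have hdeg : Ex p (fun G : EdgeSetGraph n =>
      ind (∃ u ∈ (Finset.univ : Finset (Fin n)), ((nbr G u).card : ℝ) ≤ p * (n - 1) - ζ * μ / 2)) ≤
      1 / q ^ 21 := by
    refine (Ex_ind_exists_le h0.le h1 _ _).trans ?_
    have hone : ∀ u ∈ (Finset.univ : Finset (Fin n)), Ex p (fun G : EdgeSetGraph n =>
        ind (((nbr G u).card : ℝ) ≤ p * (n - 1) - ζ * μ / 2)) ≤ Real.exp (-(22 * q)) := by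
      intro u _
      refine (Ex_nbr_lower_tail h0.le h1 u (by positivity) le_rfl).trans
        (Real.exp_le_exp.2 (neg_le_neg ?_))
      rw [← hμ, le_div_iff₀ (by positivity)]
      have : 22 * q * 32 * q ^ 120 ≤ μ := by
        refine le_trans ?_ hnp
        calc 22 * q * 32 * q ^ 120 = 704 * q ^ 121 := by ring
          _ ≤ q * q ^ 121 := by gcongr; linarith
          _ = q ^ 122 := by ring
          _ ≤ q ^ 400 := pow_le_pow_right₀ hq1 (by norm_num)
      calc 22 * q * (8 * μ) = (22 * q * 32 * q ^ 120) * μ / (4 * q ^ 120) := by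
            field_simp; ring
        _ ≤ μ * μ / (4 * q ^ 120) := by gcongr
        _ = (ζ * μ / 2) ^ 2 := by rw [hζe]; field_simp; ring
    refine (Finset.sum_le_sum hone).trans ?_
    rw [Finset.sum_const, nsmul_eq_mul, Finset.card_univ, Fintype.card_fin]
    calc (n : ℝ) * Real.exp (-(22 * q)) ≤ Real.exp q * Real.exp (-(22 * q)) := by gcongr
      _ = Real.exp (-((21 : ℕ) * q)) := by rw [← Real.exp_add]; congr 1; push_cast; ring
      _ ≤ 1 / q ^ 21 := exp_neg_mul_le hq0 21
  have hinner : Ex p (fun G : EdgeSetGraph n =>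
      ind (∃ φ ∈ (Finset.univ : Finset (Fin n → Fin r)), ((intE φ G).card : ℝ) ≤
        p * (intE φ (Finset.univ : EdgeSetGraph n)).card - ζ * (n ^ 2 * p))) ≤ 1 / q ^ 21 := by
    refine (Ex_ind_exists_le h0.le h1 _ _).trans ?_
    have hone : ∀ φ ∈ (Finset.univ : Finset (Fin n → Fin r)), Ex p (fun G : EdgeSetGraph n =>
        ind (((intE φ G).card : ℝ) ≤
        p * (intE φ (Finset.univ : EdgeSetGraph n)).card - ζ * (n ^ 2 * p))) ≤
        Real.exp (-(n * (r + 21 * q))) := by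
      intro φ _
      refine (Ex_intE_lower_tail h0.le h1 φ (B := n ^ 2 * p) (by positivity) ?_).trans
        (Real.exp_le_exp.2 (neg_le_neg ?_))
      · have := card_intE_univ_le φ
        nlinarith [sq_nonneg (n : ℝ)]
      rw [e2, le_div_iff₀ (by positivity)]
      have : 8 * (r + 21 * q) * q ^ 120 ≤ μ := by
        refine le_trans ?_ hnp
        calc 8 * (r + 21 * q) * q ^ 120 ≤ (q * q) * q ^ 120 :=
              mul_le_mul_of_nonneg_right (by nlinarith) (by positivity)
          _ = q ^ 122 := by ring
          _ ≤ q ^ 400 := pow_le_pow_right₀ hq1 (by norm_num)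
      calc n * (r + 21 * q) * (8 * (n * μ))
          = n ^ 2 * μ * (8 * (r + 21 * q) * q ^ 120) / q ^ 120 := by
            field_simp
        _ ≤ n ^ 2 * μ * μ / q ^ 120 := by gcongr
        _ = (ζ * (n * μ)) ^ 2 := by rw [hζe]; field_simp
    refine (Finset.sum_le_sum hone).trans ?_
    rw [Finset.sum_const, nsmul_eq_mul, Finset.card_univ, Fintype.card_fun, Fintype.card_fin,
      Fintype.card_fin]
    push_cast
    calc (r : ℝ) ^ n * Real.exp (-(n * (r + 21 * q)))
        ≤ Real.exp r ^ n * Real.exp (-(n * (r + 21 * q))) := by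
          gcongr
          linarith [Real.add_one_le_exp (r : ℝ)]
      _ = Real.exp (-(n * (21 * q))) := by
          rw [← Real.exp_nat_mul, ← Real.exp_add]; congr 1; ring
      _ ≤ 1 / q ^ 21 := exp_neg_le_of_mul_le hq0 21 (by push_cast; nlinarith)
  have htot : Ex p (fun G : EdgeSetGraph n => ind (p * n ^ 2 / 2 + ζ * (n ^ 2 * p) / 2 ≤
      (G.card : ℝ))) ≤ 4 / q ^ 60 := by
    refine (Ex_card_upper_tail h0.le h1 (t := ζ * (n ^ 2 * p) / 2) (t' := ζ ^ 2 * (n ^ 2 * p) / 2)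
      (by positivity) (by positivity)).trans ?_
    have hexp : Real.exp (-((ζ ^ 2 * (n ^ 2 * p) / 2) ^ 2 / (8 * (n ^ 2 * p)))) ≤ 1 / q ^ 121 := by
      refine exp_neg_le_of_mul_le hq0 121 ?_
      rw [e2, le_div_iff₀ (by positivity)]
      have : 121 * q * 8 * (4 * q ^ 240) ≤ n * μ := by
        refine le_trans ?_ (hnp.trans (le_mul_of_one_le_left hμ0.le (by linarith)))
        calc 121 * q * 8 * (4 * q ^ 240) = 3872 * q ^ 241 := by ring
          _ ≤ q ^ 2 * q ^ 241 := by gcongr; nlinarith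
          _ = q ^ 243 := by ring
          _ ≤ q ^ 400 := pow_le_pow_right₀ hq1 (by norm_num)
      calc ((121 : ℕ) : ℝ) * q * (8 * (n * μ)) =
          (121 * q * 8 * (4 * q ^ 240)) * (n * μ) / (4 * q ^ 240) := by
            push_cast; field_simp
        _ ≤ (n * μ) * (n * μ) / (4 * q ^ 240) := by gcongr
        _ = (ζ ^ 2 * (n * μ) / 2) ^ 2 := by rw [hζe]; field_simp; ring
    rw [div_le_iff₀ (by positivity)]
    calc ζ ^ 2 * (n ^ 2 * p) / 2 +
        n ^ 2 * p * Real.exp (-((ζ ^ 2 * (n ^ 2 * p) / 2) ^ 2 / (8 * (n ^ 2 * p))))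
        ≤ ζ ^ 2 * (n ^ 2 * p) / 2 + n ^ 2 * p * (1 / q ^ 121) := by gcongr
      _ ≤ ζ ^ 2 * (n ^ 2 * p) / 2 + n ^ 2 * p * (1 / q ^ 120) := by
          gcongr
          norm_num
      _ = (3 / 2) * (n ^ 2 * p) / q ^ 120 := by rw [hζe]; field_simp; ring
      _ ≤ 2 * (n ^ 2 * p) / q ^ 120 := by gcongr; norm_num
      _ = 4 / q ^ 60 * (ζ * (n ^ 2 * p) / 2) := by rw [hζe]; field_simp; ring
  have hζμ : p ≤ ζ * μ / 2 := by
    have : 2 * q ^ 60 ≤ (n : ℝ) := by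
      refine le_trans ?_ hn1
      calc 2 * q ^ 60 ≤ q * q ^ 60 := by gcongr; linarith
        _ = q ^ 61 := by ring
        _ ≤ q ^ 400 := pow_le_pow_right₀ hq1 (by norm_num)
    rw [hζe, hμ, le_div_iff₀ two_pos, one_div, ← div_eq_inv_mul, le_div_iff₀ (by positivity)]
    nlinarith
  have hsum : 1 / q ^ 21 + (1 / q ^ 21 + 4 / q ^ 60) ≤ 1 / q ^ 20 := by
    have h5 : 4 / q ^ 60 ≤ 4 / q ^ 21 := by
      gcongr
      norm_num
    have h6 : 1 / q ^ 20 = q / q ^ 21 := by field_simp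
    have h7 : 6 / q ^ 21 ≤ q / q ^ 21 := by gcongr; linarith
    rw [h6]
    have h8 : 1 / q ^ 21 + (1 / q ^ 21 + 4 / q ^ 21) = 6 / q ^ 21 := by ring
    linarith
  refine le_trans ?_ hsum
  refine le_trans ?_ (add_le_add hdeg ((Ex_ind_or_le h0.le h1 _ _).trans (add_le_add hinner htot)))
  refine le_trans (Ex_mono h0.le h1 fun G => ind_mono fun h => ?_) (Ex_ind_or_le h0.le h1 _ _)
  by_contra hcon
  push Not at hcon
  obtain ⟨c1, c2, c3⟩ := hcon
  refine h ⟨fun u => ?_, fun φ => (c2 φ (Finset.mem_univ _)).le, ?_⟩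
  · have := c1 u (Finset.mem_univ _)
    rw [← hμ]
    have h9 : p * (n - 1) = μ - p := by rw [hμ]; ring
    linarith
  · linarith

/-- There are few unstable vertices with high probability. -/
lemma Ex_unstable_le [NeZero r] {q : ℕ} (h0 : 0 < p) (hn0 : 0 < n)
    (hq : 1000 * ((r : ℝ) + 1) ≤ q)
    (hqr : 5 ≤ (1 - Real.exp (-(1 / (2 * (r : ℝ)) / 10))) * q)
    (hn : (n : ℝ) ≤ Real.exp q) (hnp : (q : ℝ) ^ 400 ≤ n * p) (hp : p * (q : ℝ) ^ 100 ≤ 1) :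
    Ex p (fun G : EdgeSetGraph n => ind (Typ r p ((1 / (q : ℝ) ^ 30) ^ 2) G ∧
      (n : ℝ) / q ^ 3 ≤ (unstable r (q ^ 4) G).card)) ≤ 1 / q := by
  have hr1 : (1 : ℝ) ≤ r := by exact_mod_cast Nat.pos_of_ne_zero (NeZero.ne r)
  have hq1000 : (1000 : ℝ) ≤ q := by linarith
  have hqp : (0 : ℝ) < q := by linarith
  have hq1 : (1 : ℝ) ≤ q := by linarith
  have hqn : 1 ≤ q := by exact_mod_cast hq1
  have h1 : p ≤ 1 := by
    have : (1 : ℝ) ≤ (q : ℝ) ^ 100 := one_le_pow₀ hq1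
    nlinarith
  have hn1 : (q : ℝ) ^ 400 ≤ n := hnp.trans (mul_le_of_le_one_right (Nat.cast_nonneg _) h1)
  have hnpos : (0 : ℝ) < n := by exact_mod_cast hn0
  have hnt := Ex_not_typ_le (r := r) h0 h1 hq hn hnp
  set η : ℝ := 1 / (q : ℝ) ^ 30 with hη
  have hη0 : 0 ≤ η := by positivity
  have hpow : ∀ {a b : ℕ}, a ≤ b → (q : ℝ) ^ a ≤ (q : ℝ) ^ b := fun h => pow_le_pow_right₀ hq1 h
  have hinv : ∀ {a b : ℕ}, a ≤ b → 1 / (q : ℝ) ^ b ≤ 1 / (q : ℝ) ^ a := fun h =>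
    one_div_le_one_div_of_le (by positivity) (hpow h)
  have hρ1 : 4 * η ^ 2 + 2 * p + (((q ^ 10 : ℕ) : ℝ) ^ 2 + ((q ^ 10 : ℕ) : ℝ)) / n ≤
      8 / (q : ℝ) ^ 20 := by
    have a1 : η ^ 2 ≤ 1 / (q : ℝ) ^ 20 := by
      rw [hη, div_pow, one_pow, ← pow_mul]; exact hinv (by norm_num)
    have a2 : p ≤ 1 / (q : ℝ) ^ 20 := by
      rw [le_div_iff₀ (by positivity)]
      exact (mul_le_mul_of_nonneg_left (hpow (by norm_num)) h0.le).trans hp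
    have a3 : (((q ^ 10 : ℕ) : ℝ) ^ 2 + ((q ^ 10 : ℕ) : ℝ)) / n ≤ 2 / (q : ℝ) ^ 20 := by
      push_cast
      rw [div_le_div_iff₀ hnpos (by positivity)]
      calc ((((q : ℝ) ^ 10) ^ 2 + (q : ℝ) ^ 10)) * (q : ℝ) ^ 20
          = (q : ℝ) ^ 40 + (q : ℝ) ^ 30 := by ring
        _ ≤ (q : ℝ) ^ 400 + (q : ℝ) ^ 400 := add_le_add (hpow (by norm_num)) (hpow (by norm_num))
        _ ≤ 2 * n := by linarith
    calc _ ≤ 4 * (1 / (q : ℝ) ^ 20) + 2 * (1 / (q : ℝ) ^ 20) + 2 / (q : ℝ) ^ 20 := by gcongr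
      _ = 8 / (q : ℝ) ^ 20 := by ring
  have hρ2 : ((q ^ 10 : ℕ) : ℝ) * η ^ 2 + 2 * η ^ 2 + 1 / n + ((q ^ 10 : ℕ) : ℝ) ^ 2 / (n * p) ≤
      8 / (q : ℝ) ^ 20 := by
    have a0 : η ^ 2 = 1 / (q : ℝ) ^ 60 := by rw [hη, div_pow, one_pow, ← pow_mul]
    have a1 : ((q ^ 10 : ℕ) : ℝ) * η ^ 2 ≤ 1 / (q : ℝ) ^ 20 := by
      rw [a0]
      push_cast
      calc (q : ℝ) ^ 10 * (1 / (q : ℝ) ^ 60) = 1 / (q : ℝ) ^ 50 := by field_simp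
        _ ≤ _ := hinv (by norm_num)
    have a2 : η ^ 2 ≤ 1 / (q : ℝ) ^ 20 := by rw [a0]; exact hinv (by norm_num)
    have a3 : 1 / (n : ℝ) ≤ 1 / (q : ℝ) ^ 20 :=
      one_div_le_one_div_of_le (by positivity) ((hpow (by norm_num)).trans hn1)
    have a4 : ((q ^ 10 : ℕ) : ℝ) ^ 2 / (n * p) ≤ 1 / (q : ℝ) ^ 20 := by
      push_cast
      rw [div_le_div_iff₀ (by positivity) (by positivity), one_mul]
      calc ((q : ℝ) ^ 10) ^ 2 * (q : ℝ) ^ 20 = (q : ℝ) ^ 40 := by ring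
        _ ≤ (q : ℝ) ^ 400 := hpow (by norm_num)
        _ ≤ _ := hnp
    calc _ ≤ 1 / (q : ℝ) ^ 20 + 2 * (1 / (q : ℝ) ^ 20) + 1 / (q : ℝ) ^ 20 + 1 / (q : ℝ) ^ 20 := by
          gcongr
      _ = 5 / (q : ℝ) ^ 20 := by ring
      _ ≤ 8 / (q : ℝ) ^ 20 := by gcongr; norm_num
  have hmain := Ex_card_unstable_le (r := r) (n := n) (p := p) (η := η) (k := q ^ 5) (L := q ^ 4)
    (s := q ^ 10) hn0 h0 h1 hη0
    (by rw [hη, div_le_one (by positivity)]; exact one_le_pow₀ hq1)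
    (by
      push_cast
      have a1 : 2 * (q : ℝ) ^ 4 / p ≤ n ^ 2 / (2 * (q : ℝ) ^ 60) := by
        rw [div_le_div_iff₀ h0 (by positivity)]
        calc 2 * (q : ℝ) ^ 4 * (2 * (q : ℝ) ^ 60) = 4 * (q : ℝ) ^ 64 := by ring
          _ ≤ q * (q : ℝ) ^ 64 := by gcongr; linarith
          _ = (q : ℝ) ^ 65 := by ring
          _ ≤ (q : ℝ) ^ 400 := hpow (by norm_num)
          _ ≤ n * p := hnp
          _ ≤ (n * n) * p := by
            gcongr
            nlinarith [one_le_pow₀ hq1 (n := 400)]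
          _ = n ^ 2 * p := by ring
      have a2 : (n : ℝ) ≤ n ^ 2 / (2 * (q : ℝ) ^ 60) := by
        rw [le_div_iff₀ (by positivity), sq]
        refine mul_le_mul_of_nonneg_left ?_ hnpos.le
        calc 2 * (q : ℝ) ^ 60 ≤ q * (q : ℝ) ^ 60 := by gcongr; linarith
          _ = (q : ℝ) ^ 61 := by ring
          _ ≤ (q : ℝ) ^ 400 := hpow (by norm_num)
          _ ≤ n := hn1
      have a3 : η ^ 2 * n ^ 2 = n ^ 2 / (2 * (q : ℝ) ^ 60) + n ^ 2 / (2 * (q : ℝ) ^ 60) := by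
        rw [hη]; field_simp; ring
      linarith)
    (Nat.one_le_pow _ _ hqn)
    (by
      push_cast
      rw [le_div_iff₀ (by positivity), hη]
      calc 10 * (q : ℝ) ^ 5 * (4 * (1 / (q : ℝ) ^ 30)) * (2 * r) = (80 * r) / (q : ℝ) ^ 25 := by
            field_simp; ring
        _ ≤ 1 := by
            rw [div_le_one (by positivity)]
            calc 80 * (r : ℝ) ≤ q := by linarith
              _ = (q : ℝ) ^ 1 := (pow_one _).symm
              _ ≤ (q : ℝ) ^ 25 := hpow (by norm_num))
    (by
      push_cast
      rw [hη]
      calc 4 * (1 / (q : ℝ) ^ 30) * ((q : ℝ) ^ 5) ^ 2 = 4 / (q : ℝ) ^ 20 := by field_simp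
        _ ≤ 4 := div_le_self (by norm_num) (one_le_pow₀ hq1)
        _ ≤ (q : ℝ) ^ 1 := by linarith
        _ ≤ (q : ℝ) ^ 4 := hpow (by norm_num))
    (by
      push_cast
      calc 5 * (q : ℝ) ^ 4 ≤ ((1 - Real.exp (-(1 / (2 * (r : ℝ)) / 10))) * q) * (q : ℝ) ^ 4 := by
            gcongr
        _ = _ := by ring)
    (by ring) hρ1 hρ2
  have hτ : 1 - Ex p (fun G : EdgeSetGraph n => ind (Typ r p (η ^ 2) G)) ≤ 1 / (q : ℝ) ^ 20 := by
    refine le_trans (le_of_eq ?_) hnt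
    have h2 := Ex_const (E := EdgeType n) (p := p) 1
    rw [← h2, ← Ex_sub]
    congr 1
    funext G
    by_cases h : Typ r p (η ^ 2) G
    · rw [ind_of h, ind_not (not_not.2 h), sub_self]
    · rw [ind_not h, ind_of h, sub_zero]
  have hmk := Ex_markov (E := EdgeType n) h0.le h1
    (f := fun G : EdgeSetGraph n => ind (Typ r p (η ^ 2) G) * (unstable r (q ^ 4) G).card)
    (fun G => mul_nonneg (ind_nonneg _) (Nat.cast_nonneg _)) (t := (n : ℝ) / q ^ 3) (by positivity)
  refine (Ex_mono h0.le h1 fun G => ind_mono fun h => ?_).trans (hmk.trans ?_)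
  · rw [ind_of h.1, one_mul]; exact h.2
  rw [div_le_div_iff₀ (by positivity) hqp]
  set X := Ex p (fun G : EdgeSetGraph n => ind (Typ r p (η ^ 2) G) * (unstable r (q ^ 4) G).card)
    with hX
  have h3 : ((q ^ 4 : ℕ) : ℝ) * X ≤ ((q ^ 10 : ℕ) : ℝ) * n * (17 / (q : ℝ) ^ 20) := by
    refine hmain.trans (mul_le_mul_of_nonneg_left ?_ (by positivity))
    have : (17 : ℝ) / (q : ℝ) ^ 20 =
        1 / (q : ℝ) ^ 20 + 8 / (q : ℝ) ^ 20 + 8 / (q : ℝ) ^ 20 := by ring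
    linarith
  push_cast at h3
  have h4 : (q : ℝ) ^ 4 * (X * q) ≤ (q : ℝ) ^ 4 * (1 * (n / (q : ℝ) ^ 3)) := by
    calc (q : ℝ) ^ 4 * (X * q) = ((q : ℝ) ^ 4 * X) * q := by ring
      _ ≤ (q : ℝ) ^ 10 * n * (17 / (q : ℝ) ^ 20) * q := by gcongr
      _ = n * (17 / (q : ℝ) ^ 9) := by field_simp
      _ ≤ n * 1 := by
        gcongr
        rw [div_le_one (by positivity)]
        calc (17 : ℝ) ≤ (q : ℝ) ^ 1 := by linarith
          _ ≤ (q : ℝ) ^ 9 := hpow (by norm_num)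
      _ ≤ n * q := by gcongr
      _ = (q : ℝ) ^ 4 * (1 * (n / (q : ℝ) ^ 3)) := by field_simp
  exact le_of_mul_le_mul_left h4 (by positivity)

end Typical

section Window

variable {V : Type} [Fintype V] {H : SimpleGraph V} {n r q : ℕ} {p C ν K : ℝ}

/-- The quantitative assumptions under which the switching argument applies. -/
structure Window (H : SimpleGraph V) (r q n : ℕ) (p C ν K : ℝ) : Prop where
  pos : 0 < p
  const_nonneg : 0 ≤ C
  rooted : Rooted H n p C ν
  one_le : 1 ≤ K
  card_ed_le : ((ed H).card : ℝ) ≤ K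
  card_le : (Fintype.card V : ℝ) ≤ K
  parts_le : (r : ℝ) ≤ K
  ovl_le : ovl H * C ≤ K
  const_le : C ≤ K
  lam_le : lam H n p ≤ K * q
  large : 1000 * K ^ 3 * ((r : ℝ) + 1) ≤ q
  anti : 5 ≤ (1 - Real.exp (-(1 / (2 * (r : ℝ)) / 10))) * q
  le_exp : (n : ℝ) ≤ Real.exp q
  le_mul : (q : ℝ) ^ 400 ≤ n * p
  mul_le : p * (q : ℝ) ^ 100 ≤ 1
  le_gap : (q : ℝ) ^ 100 ≤ ν

namespace Window

lemma large' (w : Window H r q n p C ν K) : 1000 * ((r : ℝ) + 1) ≤ q := by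
  refine le_trans ?_ w.large
  have : (1 : ℝ) ≤ K ^ 3 := one_le_pow₀ w.one_le
  nlinarith [Nat.cast_nonneg (α := ℝ) r]

lemma cube_le (w : Window H r q n p C ν K) : 1000 * K ^ 3 ≤ q := by
  refine le_trans ?_ w.large
  have : (1 : ℝ) ≤ K ^ 3 := one_le_pow₀ w.one_le
  nlinarith [Nat.cast_nonneg (α := ℝ) r]

lemma thousand_le (w : Window H r q n p C ν K) : (1000 : ℝ) ≤ q := by
  refine le_trans ?_ w.large'
  linarith [Nat.cast_nonneg (α := ℝ) r]

lemma le_one (w : Window H r q n p C ν K) : p ≤ 1 := by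
  have h1 : (1 : ℝ) ≤ q := by linarith [w.thousand_le]
  have : (1 : ℝ) ≤ (q : ℝ) ^ 100 := one_le_pow₀ h1
  nlinarith [w.pos, w.mul_le]

lemma le_card (w : Window H r q n p C ν K) : (q : ℝ) ^ 400 ≤ n :=
  w.le_mul.trans (mul_le_of_le_one_right (Nat.cast_nonneg _) w.le_one)

lemma card_pos (w : Window H r q n p C ν K) : 0 < n := by
  have h1 : (0 : ℝ) < q := by linarith [w.thousand_le]
  exact_mod_cast (pow_pos h1 400).trans_le w.le_card

lemma one_le_lam (w : Window H r q n p C ν K) (h : 1 ≤ (ed H).card) : 1 ≤ C * lam H n p := by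
  refine (w.rooted.one (ed H) subset_rfl (Finset.card_pos.1 h)).trans ?_
  refine mul_le_mul_of_nonneg_left ?_ w.const_nonneg
  refine mul_le_mul_of_nonneg_right ?_ (pow_nonneg w.pos.le _)
  refine pow_le_pow_right₀ (by exact_mod_cast w.card_pos) ?_
  exact Nat.sub_le_sub_right (Finset.card_le_univ _) _

lemma lam_pos (w : Window H r q n p C ν K) : 0 < lam H n p := by
  have h1 : (0 : ℝ) < n := by exact_mod_cast w.card_pos
  have := w.pos
  unfold lam; positivity

lemma one_le_mul_lam (w : Window H r q n p C ν K) (h : 1 ≤ (ed H).card) : 1 ≤ K * lam H n p :=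
  (w.one_le_lam h).trans (mul_le_mul_of_nonneg_right w.const_le w.lam_pos.le)

lemma two_mul_div_add_le (w : Window H r q n p C ν K) :
    2 * ((q ^ 4 : ℕ) : ℝ) / p + n ≤ (1 / (q : ℝ) ^ 30) ^ 2 * n ^ 2 := by
  have hq := w.thousand_le
  have hq1 : (1 : ℝ) ≤ q := by linarith
  have hqp : (0 : ℝ) < q := by linarith
  have hn0 : (0 : ℝ) < n := by exact_mod_cast w.card_pos
  have h0 := w.pos
  have hpow : ∀ {a b : ℕ}, a ≤ b → (q : ℝ) ^ a ≤ (q : ℝ) ^ b := fun h => pow_le_pow_right₀ hq1 h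
  push_cast
  have a1 : 2 * (q : ℝ) ^ 4 / p ≤ n ^ 2 / (2 * (q : ℝ) ^ 60) := by
    rw [div_le_div_iff₀ h0 (by positivity)]
    calc 2 * (q : ℝ) ^ 4 * (2 * (q : ℝ) ^ 60) = 4 * (q : ℝ) ^ 64 := by ring
      _ ≤ q * (q : ℝ) ^ 64 := mul_le_mul_of_nonneg_right (by linarith) (by positivity)
      _ = (q : ℝ) ^ 65 := by ring
      _ ≤ (q : ℝ) ^ 400 := hpow (by norm_num)
      _ ≤ n * p := w.le_mul
      _ ≤ (n * n) * p := by
        refine mul_le_mul_of_nonneg_right ?_ h0.le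
        nlinarith [one_le_pow₀ hq1 (n := 400), w.le_card]
      _ = n ^ 2 * p := by ring
  have a2 : (n : ℝ) ≤ n ^ 2 / (2 * (q : ℝ) ^ 60) := by
    rw [le_div_iff₀ (by positivity), sq]
    refine mul_le_mul_of_nonneg_left ?_ hn0.le
    calc 2 * (q : ℝ) ^ 60 ≤ q * (q : ℝ) ^ 60 :=
          mul_le_mul_of_nonneg_right (by linarith) (by positivity)
      _ = (q : ℝ) ^ 61 := by ring
      _ ≤ (q : ℝ) ^ 400 := hpow (by norm_num)
      _ ≤ n := w.le_card
  have a3 : (1 / (q : ℝ) ^ 30) ^ 2 * n ^ 2 =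
      n ^ 2 / (2 * (q : ℝ) ^ 60) + n ^ 2 / (2 * (q : ℝ) ^ 60) := by
    field_simp; ring
  linarith

lemma Ex_nPairs_nonempty_ge_le (w : Window H r q n p C ν K) (h2 : 2 ≤ Fintype.card V)
    (h1 : 1 ≤ (ed H).card) :
    Ex p (fun G : EdgeSetGraph n => ind ((n : ℝ) ^ 2 * p * q ^ 3 ≤
      nPairs H Finset.Nonempty G)) ≤ K ^ 3 / q := by
  have hq := w.thousand_le
  have hqp : (0 : ℝ) < q := by linarith
  have hn0 : (0 : ℝ) < n := by exact_mod_cast w.card_pos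
  have h0 := w.pos
  have hK := w.one_le
  refine (Ex_markov h0.le w.le_one (f := fun G : EdgeSetGraph n =>
    (nPairs H Finset.Nonempty G : ℝ)) (fun G => Nat.cast_nonneg _) (by positivity)).trans ?_
  rw [div_le_iff₀ (by positivity)]
  refine (Ex_nPairs_nonempty_le h0.le w.const_nonneg h2 h1 w.rooted).trans ?_
  have hl : lam H n p ^ 2 ≤ (K * q) ^ 2 := pow_le_pow_left₀ w.lam_pos.le w.lam_le 2
  calc ovl H * C * ((n : ℝ) ^ 2 * p * lam H n p ^ 2)
      ≤ K * ((n : ℝ) ^ 2 * p * (K * q) ^ 2) :=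
        mul_le_mul w.ovl_le (mul_le_mul_of_nonneg_left hl (by positivity)) (by positivity)
          (by positivity)
    _ = K ^ 3 / q * (n ^ 2 * p * q ^ 3) := by field_simp

lemma Ex_nPairs_overlap_ge_le (w : Window H r q n p C ν K) (h2 : 2 ≤ Fintype.card V)
    (h1 : 1 ≤ (ed H).card) :
    Ex p (fun G : EdgeSetGraph n => ind ((n : ℝ) ^ 2 * p / q ≤
      nPairs H (fun F => 2 ≤ F.card ∧ F ≠ ed H) G)) ≤ K ^ 3 / q := by
  have hq := w.thousand_le
  have hqp : (0 : ℝ) < q := by linarith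
  have hq1 : (1 : ℝ) ≤ q := by linarith
  have hn0 : (0 : ℝ) < n := by exact_mod_cast w.card_pos
  have h0 := w.pos
  have hK := w.one_le
  have hν : 0 < ν := (pow_pos hqp 100).trans_le w.le_gap
  refine (Ex_markov h0.le w.le_one (f := fun G : EdgeSetGraph n =>
    (nPairs H (fun F => 2 ≤ F.card ∧ F ≠ ed H) G : ℝ)) (fun G => Nat.cast_nonneg _)
    (by positivity)).trans ?_
  rw [div_le_iff₀ (by positivity)]
  refine (Ex_nPairs_overlap_le h0.le w.const_nonneg h2 h1 hν w.rooted).trans ?_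
  have hl : lam H n p ^ 2 ≤ (K * q) ^ 2 := pow_le_pow_left₀ w.lam_pos.le w.lam_le 2
  calc ovl H * C * ((n : ℝ) ^ 2 * p * lam H n p ^ 2) / ν
      ≤ K * ((n : ℝ) ^ 2 * p * (K * q) ^ 2) / (q : ℝ) ^ 4 := by
        refine div_le_div₀ (by positivity) ?_ (by positivity)
          ((pow_le_pow_right₀ hq1 (by norm_num)).trans w.le_gap)
        exact mul_le_mul w.ovl_le (mul_le_mul_of_nonneg_left hl (by positivity)) (by positivity)
          (by positivity)
    _ = K ^ 3 / q * (n ^ 2 * p / q) := by field_simp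

lemma Ex_uniform_le (w : Window H r q n p C ν K) {D : Finset (Sym2 V)} (hD : D ⊆ ed H)
    {Θ : Type*} [Fintype Θ] (Q : Θ → (V ↪ Fin n) → Prop) {B t : ℝ} (ht : 0 < t) (hB : 0 < B)
    (hB1 : (n : ℝ) ^ Fintype.card V * p ^ D.card ≤ B)
    (hB2 : (n : ℝ) ^ Fintype.card V * p ^ D.card *
        (ovl H * (C * ((n : ℝ) ^ (Fintype.card V - 2) * p ^ (D.card - 1)))) ≤ B)
    (hΘ : (Fintype.card Θ : ℝ) ≤ Real.exp (n * q)) (hBt : B ≤ t * Real.exp (n * q))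
    (hX : 8 * B * (n * (q : ℝ) ^ 4) ≤ t ^ 2) :
    Ex p (fun G : EdgeSetGraph n => ind (∃ θ,
      p ^ D.card * ((Finset.univ : Finset (V ↪ Fin n)).filter (Q θ)).card + 2 * t ≤
        (cnt (fun ψ : V ↪ Fin n => im D ψ) (Finset.univ.filter (Q θ)) G : ℝ))) ≤ 3 / q := by
  have hq := w.thousand_le
  have hqp : (0 : ℝ) < q := by linarith
  have hq1 : (1 : ℝ) ≤ q := by linarith
  have hn1 : (1 : ℝ) ≤ n := by exact_mod_cast w.card_pos
  have h0 := w.pos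
  refine (Ex_uniform_embeddings h0.le w.le_one w.const_nonneg w.rooted hD Q (t' := t / q) ht
    (by positivity) hB1 hB2).trans ?_
  have e1 : (n : ℝ) * q ^ 2 ≤ (t / q) ^ 2 / (8 * B) := by
    rw [le_div_iff₀ (by positivity), div_pow, le_div_iff₀ (by positivity)]
    refine le_trans (le_of_eq ?_) hX
    ring
  have e2 : (n : ℝ) * q ^ 2 ≤ t ^ 2 / (8 * B) := by
    refine e1.trans ?_
    refine div_le_div_of_nonneg_right ?_ (by positivity)
    exact pow_le_pow_left₀ (by positivity) (div_le_self ht.le hq1) 2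
  have e3 : Real.exp (n * q) * Real.exp (-(n * (q : ℝ) ^ 2)) ≤ 1 / q := by
    rw [← Real.exp_add]
    have : (n : ℝ) * q + -(n * (q : ℝ) ^ 2) = -(n * q * (q - 1)) := by ring
    rw [this]
    refine (exp_neg_le_of_mul_le hqp 1 ?_).trans (le_of_eq (by rw [pow_one]))
    have h3 : (1 : ℝ) ≤ n * (q - 1) := by nlinarith
    push_cast
    nlinarith
  have e4 : B * Real.exp (-((t / q) ^ 2 / (8 * B))) ≤ t * (1 / q) := by
    calc B * Real.exp (-((t / q) ^ 2 / (8 * B)))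
        ≤ (t * Real.exp (n * q)) * Real.exp (-(n * (q : ℝ) ^ 2)) :=
          mul_le_mul hBt (Real.exp_le_exp.2 (neg_le_neg e1)) (Real.exp_pos _).le (by positivity)
      _ = t * (Real.exp (n * q) * Real.exp (-(n * (q : ℝ) ^ 2))) := by ring
      _ ≤ t * (1 / q) := mul_le_mul_of_nonneg_left e3 ht.le
  have e5 : (Fintype.card Θ : ℝ) * Real.exp (-(t ^ 2 / (8 * B))) ≤ 1 / q :=
    (mul_le_mul hΘ (Real.exp_le_exp.2 (neg_le_neg e2)) (Real.exp_pos _).le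
      (Real.exp_pos _).le).trans e3
  have e6 : (t / q + B * Real.exp (-((t / q) ^ 2 / (8 * B)))) / t ≤ 2 / q := by
    rw [div_le_iff₀ ht]
    have : 2 / (q : ℝ) * t = t / q + t * (1 / q) := by ring
    linarith
  have : (3 : ℝ) / q = 2 / q + 1 / q := by ring
  linarith

lemma exp_aux (w : Window H r q n p C ν K) : (n : ℝ) * q ^ 20 ≤ Real.exp (n * q) := by
  have hq := w.thousand_le
  have hq1 : (1 : ℝ) ≤ q := by linarith
  have hqp : (0 : ℝ) < q := by linarith
  have hn := w.le_card
  have h1 : (q : ℝ) ^ 20 ≤ n := (pow_le_pow_right₀ hq1 (by norm_num)).trans hn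
  have hn0 : (0 : ℝ) ≤ n := Nat.cast_nonneg _
  have h2 : (n : ℝ) ≤ Real.exp n := by linarith [Real.add_one_le_exp (n : ℝ)]
  calc (n : ℝ) * q ^ 20 ≤ n * n := mul_le_mul_of_nonneg_left h1 hn0
    _ ≤ Real.exp n * Real.exp n := mul_le_mul h2 h2 hn0 (Real.exp_pos _).le
    _ = Real.exp (n * 2) := by rw [← Real.exp_add]; congr 1; ring
    _ ≤ _ := Real.exp_le_exp.2 (mul_le_mul_of_nonneg_left (by linarith) hn0)

lemma lam_le_sq (w : Window H r q n p C ν K) : lam H n p ≤ (q : ℝ) ^ 2 := by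
  have hK := w.one_le
  have hK3 : K ≤ K ^ 3 := le_self_pow₀ hK (by norm_num)
  have : K ≤ q := by nlinarith [w.cube_le, one_le_pow₀ hK (n := 3)]
  refine w.lam_le.trans ?_
  rw [sq]
  exact mul_le_mul_of_nonneg_right this (Nat.cast_nonneg _)

lemma ovl_mul_le (w : Window H r q n p C ν K) : ovl H * C * lam H n p ^ 2 ≤ (q : ℝ) ^ 3 := by
  have hK := w.one_le
  have hl : lam H n p ^ 2 ≤ (K * q) ^ 2 := pow_le_pow_left₀ w.lam_pos.le w.lam_le 2
  calc ovl H * C * lam H n p ^ 2 ≤ K * (K * q) ^ 2 :=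
        mul_le_mul w.ovl_le hl (sq_nonneg _) (by linarith)
    _ = K ^ 3 * (q : ℝ) ^ 2 := by ring
    _ ≤ q * (q : ℝ) ^ 2 := mul_le_mul_of_nonneg_right
        (by nlinarith [w.cube_le, one_le_pow₀ hK (n := 3)]) (by positivity)
    _ = (q : ℝ) ^ 3 := by ring

lemma Ex_nTouch_le (w : Window H r q n p C ν K) (h2 : 2 ≤ Fintype.card V)
    (h1 : 1 ≤ (ed H).card) :
    Ex p (fun G : EdgeSetGraph n => ind (∃ Z : Finset (Fin n),
      p ^ (ed H).card * ((Finset.univ : Finset (V ↪ Fin n)).filter fun ψ => ∃ w, ψ w ∈ Z).card +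
        2 * (n ^ 2 * p / q) ≤ (nTouch H Z G : ℝ))) ≤ 3 / q := by
  have hq := w.thousand_le
  have hqp : (0 : ℝ) < q := by linarith
  have hq1 : (1 : ℝ) ≤ q := by linarith
  have hn1 : (1 : ℝ) ≤ n := by exact_mod_cast w.card_pos
  have hn0 : (0 : ℝ) < n := by linarith
  have h0 := w.pos
  have hl := w.lam_pos
  have hN : 0 < (n : ℝ) ^ 2 * p := by positivity
  have hmain := w.Ex_uniform_le (D := ed H) subset_rfl
    (fun (Z : Finset (Fin n)) (ψ : V ↪ Fin n) => ∃ w, ψ w ∈ Z)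
    (B := n ^ 2 * p * q ^ 3) (t := n ^ 2 * p / q) (by positivity) (by positivity) ?_ ?_ ?_ ?_ ?_
  · refine le_trans (le_of_eq ?_) hmain
    congr 1
    funext G
    congr 1
    refine propext (exists_congr fun Z => ?_)
    unfold nTouch
    congr!
  · rw [card_pow_eq h2 h1]
    refine mul_le_mul_of_nonneg_left (w.lam_le_sq.trans (pow_le_pow_right₀ hq1 (by norm_num))) hN.le
  · rw [card_pow_eq h2 h1]
    change (n : ℝ) ^ 2 * p * lam H n p * (ovl H * (C * lam H n p)) ≤ _
    calc (n : ℝ) ^ 2 * p * lam H n p * (ovl H * (C * lam H n p))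
        = n ^ 2 * p * (ovl H * C * lam H n p ^ 2) := by ring
      _ ≤ _ := mul_le_mul_of_nonneg_left w.ovl_mul_le hN.le
  · rw [Fintype.card_finset, Fintype.card_fin, Real.exp_nat_mul]
    push_cast
    exact pow_le_pow_left₀ (by norm_num) (by linarith [Real.add_one_le_exp (q : ℝ)]) n
  · calc n ^ 2 * p * (q : ℝ) ^ 3 = n ^ 2 * p / q * q ^ 4 := by field_simp
      _ ≤ n ^ 2 * p / q * Real.exp (n * q) := by
        refine mul_le_mul_of_nonneg_left (le_trans ?_ w.exp_aux) (by positivity)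
        calc (q : ℝ) ^ 4 ≤ (1 : ℝ) * (q : ℝ) ^ 20 := by
              rw [one_mul]; exact pow_le_pow_right₀ hq1 (by norm_num)
          _ ≤ (n : ℝ) * (q : ℝ) ^ 20 := mul_le_mul_of_nonneg_right hn1 (by positivity)
  · have h3 : 8 * (q : ℝ) ^ 9 ≤ n * p := by
      refine le_trans ?_ w.le_mul
      calc 8 * (q : ℝ) ^ 9 ≤ q * q ^ 9 :=
            mul_le_mul_of_nonneg_right (by linarith) (by positivity)
        _ = (q : ℝ) ^ 10 := by ring
        _ ≤ (q : ℝ) ^ 400 := pow_le_pow_right₀ hq1 (by norm_num)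
    calc 8 * (n ^ 2 * p * (q : ℝ) ^ 3) * (n * (q : ℝ) ^ 4)
        = n ^ 3 * p / q ^ 2 * (8 * (q : ℝ) ^ 9) := by field_simp
      _ ≤ n ^ 3 * p / q ^ 2 * (n * p) := mul_le_mul_of_nonneg_left h3 (by positivity)
      _ = (n ^ 2 * p / q) ^ 2 := by field_simp

lemma Ex_monoAt_le (w : Window H r q n p C ν K) (h2 : 2 ≤ Fintype.card V)
    (h1 : 2 ≤ (ed H).card) (ε d : Sym2 V) (hd : d ∈ ed H) :
    Ex p (fun G : EdgeSetGraph n => ind (∃ φ : Fin n → Fin r,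
      p ^ ((ed H).card - 1) *
        ((Finset.univ : Finset (V ↪ Fin n)).filter (MonoAt H φ ε d)).card +
        2 * (n ^ 2 * lam H n p / q) ≤
        (cnt (fun ψ : V ↪ Fin n => im ((ed H).erase d) ψ)
          (Finset.univ.filter (MonoAt H φ ε d)) G : ℝ))) ≤ 3 / q := by
  have hq := w.thousand_le
  have hqp : (0 : ℝ) < q := by linarith
  have hq1 : (1 : ℝ) ≤ q := by linarith
  have hn1 : (1 : ℝ) ≤ n := by exact_mod_cast w.card_pos
  have hn0 : (0 : ℝ) < n := by linarith
  have h0 := w.pos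
  have hl := w.lam_pos
  have hK := w.one_le
  have hcard : ((ed H).erase d).card = (ed H).card - 1 := Finset.card_erase_of_mem hd
  have hnv : (n : ℝ) ^ Fintype.card V * p ^ ((ed H).card - 1) = n ^ 2 * lam H n p := by
    unfold lam
    rw [← mul_assoc, ← pow_add]
    congr 3
    omega
  have hlK : 1 ≤ q * lam H n p := by
    refine (w.one_le_mul_lam (by omega)).trans (mul_le_mul_of_nonneg_right ?_ hl.le)
    nlinarith [w.cube_le, one_le_pow₀ hK (n := 3), le_self_pow₀ hK (n := 3) (by norm_num)]
  have hnp : 1 ≤ n * p := (one_le_pow₀ hq1).trans w.le_mul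
  have hmain := w.Ex_uniform_le (D := (ed H).erase d) (Finset.erase_subset _ _)
    (fun (φ : Fin n → Fin r) (ψ : V ↪ Fin n) => MonoAt H φ ε d ψ)
    (B := n ^ 2 * q ^ 3 / p) (t := n ^ 2 * lam H n p / q) (by positivity) (by positivity)
    ?_ ?_ ?_ ?_ ?_
  · rwa [hcard] at hmain
  · rw [hcard, hnv, le_div_iff₀ h0]
    calc (n : ℝ) ^ 2 * lam H n p * p ≤ n ^ 2 * lam H n p :=
          mul_le_of_le_one_right (by positivity) w.le_one
      _ ≤ n ^ 2 * q ^ 3 := mul_le_mul_of_nonneg_left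
          (w.lam_le_sq.trans (pow_le_pow_right₀ hq1 (by norm_num))) (by positivity)
  · rw [hcard, hnv, le_div_iff₀ h0]
    have hlp : (n : ℝ) ^ (Fintype.card V - 2) * p ^ ((ed H).card - 1 - 1) * p = lam H n p := by
      unfold lam
      rw [mul_assoc, ← pow_succ]
      congr 3
      omega
    calc (n : ℝ) ^ 2 * lam H n p * (ovl H * (C * ((n : ℝ) ^ (Fintype.card V - 2) *
          p ^ ((ed H).card - 1 - 1)))) * p
        = n ^ 2 * lam H n p * (ovl H * (C * ((n : ℝ) ^ (Fintype.card V - 2) *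
          p ^ ((ed H).card - 1 - 1) * p))) := by ring
      _ = n ^ 2 * (ovl H * C * lam H n p ^ 2) := by rw [hlp]; ring
      _ ≤ _ := mul_le_mul_of_nonneg_left w.ovl_mul_le (by positivity)
  · rw [Fintype.card_fun, Fintype.card_fin, Fintype.card_fin, Real.exp_nat_mul]
    push_cast
    refine pow_le_pow_left₀ (Nat.cast_nonneg _) ?_ n
    linarith [Real.add_one_le_exp (q : ℝ), w.large', Nat.cast_nonneg (α := ℝ) r]
  · rw [div_le_iff₀ h0]
    calc (n : ℝ) ^ 2 * q ^ 3 ≤ n ^ 2 * q ^ 3 * (q * lam H n p * (n * p)) :=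
          le_mul_of_one_le_right (by positivity) (one_le_mul_of_one_le_of_one_le hlK hnp)
      _ = n ^ 2 * lam H n p / q * (n * q ^ 5) * p := by field_simp
      _ ≤ n ^ 2 * lam H n p / q * Real.exp (n * q) * p := by
        refine mul_le_mul_of_nonneg_right (mul_le_mul_of_nonneg_left
          (le_trans ?_ w.exp_aux) (by positivity)) h0.le
        exact mul_le_mul_of_nonneg_left (pow_le_pow_right₀ hq1 (by norm_num)) hn0.le
  · have h3 : 8 * (q : ℝ) ^ 11 ≤ n * p := by
      refine le_trans ?_ w.le_mul
      calc 8 * (q : ℝ) ^ 11 ≤ q * q ^ 11 :=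
            mul_le_mul_of_nonneg_right (by linarith) (by positivity)
        _ = (q : ℝ) ^ 12 := by ring
        _ ≤ (q : ℝ) ^ 400 := pow_le_pow_right₀ hq1 (by norm_num)
    have h4 : 1 ≤ (q * lam H n p) ^ 2 := one_le_pow₀ hlK
    calc 8 * (n ^ 2 * (q : ℝ) ^ 3 / p) * (n * (q : ℝ) ^ 4)
        = n ^ 3 / (p * q ^ 4) * (8 * (q : ℝ) ^ 11) := by field_simp
      _ ≤ n ^ 3 / (p * q ^ 4) * (n * p) := mul_le_mul_of_nonneg_left h3 (by positivity)
      _ ≤ n ^ 3 / (p * q ^ 4) * (n * p) * (q * lam H n p) ^ 2 :=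
        le_mul_of_one_le_right (by positivity) h4
      _ = (n ^ 2 * lam H n p / q) ^ 2 := by field_simp

end Window

end Window

section Final

variable {V : Type} [Fintype V] {H : SimpleGraph V} {n r q : ℕ} {p C ν K : ℝ}

lemma one_add_pow_le {x : ℝ} {v : ℕ} (hx : 0 ≤ x) (hv : v * x ≤ 1) :
    (1 + x) ^ v ≤ 1 + 2 * (v * x) := by
  have h1 : (1 + x) ^ v ≤ Real.exp (v * x) := by
    rw [Real.exp_nat_mul]
    exact pow_le_pow_left₀ (by linarith) (by linarith [Real.add_one_le_exp x]) v
  have h2 := Real.abs_exp_sub_one_le (x := v * x) (by rw [abs_of_nonneg (by positivity)]; exact hv)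
  rw [abs_of_nonneg (a := (v : ℝ) * x) (by positivity)] at h2
  linarith [le_abs_self (Real.exp (v * x) - 1)]

namespace Window

lemma K_pow_le (w : Window H r q n p C ν K) {k : ℕ} (hk : k ≤ 3) : K ^ k ≤ q := by
  have hK := w.one_le
  have := pow_le_pow_right₀ hK hk
  nlinarith [w.cube_le, one_le_pow₀ hK (n := 3)]

lemma sum_cnt_monoAt_le [NeZero r] (w : Window H r q n p C ν K) {κ : ℝ} (h2 : 2 ≤ Fintype.card V)
    (hmono : ((oneMono r H).card : ℝ) ≤ κ * r ^ Fintype.card V) {G : EdgeSetGraph n}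
    (hT : Typ r p ((1 / (q : ℝ) ^ 30) ^ 2) G)
    (hM : ∀ x ∈ ed H ×ˢ ed H, ¬ ∃ φ : Fin n → Fin r,
      p ^ ((ed H).card - 1) *
        ((Finset.univ : Finset (V ↪ Fin n)).filter (MonoAt H φ x.1 x.2)).card +
        2 * (n ^ 2 * lam H n p / q) ≤
        (cnt (fun ψ : V ↪ Fin n => im ((ed H).erase x.2) ψ)
          (Finset.univ.filter (MonoAt H φ x.1 x.2)) G : ℝ)) :
    ((∑ x ∈ ed H ×ˢ ed H, cnt (fun ψ : V ↪ Fin n => im ((ed H).erase x.2) ψ)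
        (Finset.univ.filter (MonoAt H (canon r G) x.1 x.2)) G : ℕ) : ℝ) ≤
      n ^ 2 * lam H n p * (κ * (1 + 1 / q) + 2 * K ^ 2 / q) := by
  have hq := w.thousand_le
  have hqp : (0 : ℝ) < q := by linarith
  have hq1 : (1 : ℝ) ≤ q := by linarith
  have hn0 : (0 : ℝ) < n := by exact_mod_cast w.card_pos
  have h0 := w.pos
  have hl := w.lam_pos
  have hK := w.one_le
  have hr1 : 1 ≤ r := Nat.pos_of_ne_zero (NeZero.ne r)
  have hr : (0 : ℝ) < r := by exact_mod_cast hr1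
  set η : ℝ := 1 / (q : ℝ) ^ 30 with hη
  have hη0 : 0 ≤ η := by positivity
  set φ := canon r G with hφ
  have hs := hT.sum_sq_le (L := q ^ 4) h0 (by positivity) w.two_mul_div_add_le (φ := φ)
    (by rw [hφ, card_cutE_canon]; omega)
  have hcl : ∀ k, ((cls φ k).card : ℝ) ≤ (1 + 2 * η * r) * (n / r) := by
    intro k
    have := (abs_le.1 (abs_card_cls_sub_le hr1 hη0 hs k)).2
    have e : (1 + 2 * η * r) * (n / r) = n / r + 2 * η * n := by field_simp
    linarith
  have hsum := sum_card_monoAt_le (H := H) φ hcl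
  have hx : Fintype.card V * (2 * η * r) ≤ 1 / (2 * q) := by
    have e1 : Fintype.card V * (2 * η * r) ≤ K * (2 * η * K) := by
      refine mul_le_mul w.card_le ?_ (by positivity) (by linarith)
      exact mul_le_mul_of_nonneg_left w.parts_le (by positivity)
    refine e1.trans ?_
    have hKK := w.K_pow_le (k := 2) (by norm_num)
    rw [le_div_iff₀ (by positivity), hη]
    calc K * (2 * (1 / (q : ℝ) ^ 30) * K) * (2 * q) = 4 * K ^ 2 / q ^ 29 := by field_simp; ring
      _ ≤ 1 := by
        rw [div_le_one (by positivity)]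
        calc 4 * K ^ 2 ≤ q * q := mul_le_mul (by linarith) hKK (by positivity) hqp.le
          _ = (q : ℝ) ^ 2 := by ring
          _ ≤ _ := pow_le_pow_right₀ hq1 (by norm_num)
  have hhalf : 1 / (2 * (q : ℝ)) ≤ 1 := by rw [div_le_one (by positivity)]; linarith
  have hpow : (1 + 2 * η * r) ^ Fintype.card V ≤ 1 + 1 / q := by
    refine (one_add_pow_le (by positivity) (hx.trans hhalf)).trans ?_
    have : 2 * (1 / (2 * (q : ℝ))) = 1 / q := by field_simp
    linarith
  have hnv : (n : ℝ) ^ Fintype.card V * p ^ ((ed H).card - 1) = n ^ 2 * lam H n p := by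
    unfold lam
    rw [← mul_assoc, ← pow_add]
    congr 3
    omega
  have hmean : p ^ ((ed H).card - 1) * ∑ x ∈ ed H ×ˢ ed H,
      (((Finset.univ : Finset (V ↪ Fin n)).filter (MonoAt H φ x.1 x.2)).card : ℝ) ≤
      n ^ 2 * lam H n p * (κ * (1 + 1 / q)) := by
    calc _ ≤ p ^ ((ed H).card - 1) * ((κ * r ^ Fintype.card V) *
          ((1 + 1 / q) * (n / r) ^ Fintype.card V)) := by
          refine mul_le_mul_of_nonneg_left (hsum.trans ?_) (by positivity)
          rw [mul_pow]
          refine mul_le_mul hmono (mul_le_mul_of_nonneg_right hpow (by positivity))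
            (by positivity) ?_
          exact (Nat.cast_nonneg _).trans hmono
      _ = (n ^ Fintype.card V * p ^ ((ed H).card - 1)) * (κ * (1 + 1 / q)) := by
          rw [div_pow]; field_simp
      _ = _ := by rw [hnv]
  have hterm : ∀ x ∈ ed H ×ˢ ed H, (cnt (fun ψ : V ↪ Fin n => im ((ed H).erase x.2) ψ)
        (Finset.univ.filter (MonoAt H φ x.1 x.2)) G : ℝ) ≤
      p ^ ((ed H).card - 1) *
        ((Finset.univ : Finset (V ↪ Fin n)).filter (MonoAt H φ x.1 x.2)).card +
        2 * (n ^ 2 * lam H n p / q) := by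
    intro x hx
    by_contra hcon
    exact hM x hx ⟨φ, (not_le.1 hcon).le⟩
  push_cast
  refine (Finset.sum_le_sum hterm).trans ?_
  rw [Finset.sum_add_distrib, ← Finset.mul_sum, Finset.sum_const, Finset.card_product,
    nsmul_eq_mul]
  have hh : (((ed H).card * (ed H).card : ℕ) : ℝ) ≤ K ^ 2 := by
    push_cast; rw [sq]
    exact mul_le_mul w.card_ed_le w.card_ed_le (Nat.cast_nonneg _) (by linarith)
  have h3 := mul_le_mul_of_nonneg_right hh (by positivity : 0 ≤ 2 * ((n : ℝ) ^ 2 * lam H n p / q))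
  have h4 : (n : ℝ) ^ 2 * lam H n p * (κ * (1 + 1 / q) + 2 * K ^ 2 / q) =
      n ^ 2 * lam H n p * (κ * (1 + 1 / q)) + K ^ 2 * (2 * ((n : ℝ) ^ 2 * lam H n p / q)) := by
    ring
  rw [h4]
  exact add_le_add hmean h3

lemma card_intE_ge [NeZero r] (w : Window H r q n p C ν K) {G : EdgeSetGraph n}
    (hT : Typ r p ((1 / (q : ℝ) ^ 30) ^ 2) G) :
    n ^ 2 * p / (2 * r) - n ^ 2 * p / q - n ^ 2 * p / q ≤ ((intE (canon r G) G).card : ℝ) := by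
  have hq := w.thousand_le
  have hqp : (0 : ℝ) < q := by linarith
  have hq1 : (1 : ℝ) ≤ q := by linarith
  have hn0 : (0 : ℝ) < n := by exact_mod_cast w.card_pos
  have h0 := w.pos
  have hr : (0 : ℝ) < r := by exact_mod_cast Nat.pos_of_ne_zero (NeZero.ne r)
  set N := (n : ℝ) ^ 2 * p with hNdef
  have hN0 : 0 < N := by positivity
  have e1 := hT.int (canon r G)
  have e2 : 2 * ((intE (canon r G) (Finset.univ : EdgeSetGraph n)).card : ℝ) + n =
      ∑ k, ((cls (canon r G) k).card : ℝ) ^ 2 := by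
    exact_mod_cast two_mul_card_intE_univ (canon r G)
  have e3 : (n : ℝ) ^ 2 / r ≤ ∑ k, ((cls (canon r G) k).card : ℝ) ^ 2 := by
    rw [div_le_iff₀ hr, mul_comm]
    have := sq_sum_le_card_mul_sum_sq (s := (Finset.univ : Finset (Fin r)))
      (f := fun k => ((cls (canon r G) k).card : ℝ))
    rw [Finset.card_univ, Fintype.card_fin] at this
    have e : ∑ k, ((cls (canon r G) k).card : ℝ) = n := by
      exact_mod_cast sum_card_cls (canon r G)
    rwa [e] at this
  have e4 : (n : ℝ) * p ≤ N / q := by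
    rw [le_div_iff₀ hqp, hNdef]
    have : (q : ℝ) ≤ n := (le_self_pow₀ hq1 (by norm_num)).trans w.le_card
    calc (n : ℝ) * p * q ≤ n * p * n := mul_le_mul_of_nonneg_left this (by positivity)
      _ = n ^ 2 * p := by ring
  have e5 : (1 / (q : ℝ) ^ 30) ^ 2 * N ≤ N / q := by
    rw [div_pow, one_pow, ← pow_mul, one_div_mul_eq_div]
    exact div_le_div_of_nonneg_left hN0.le hqp (le_self_pow₀ hq1 (by norm_num))
  have e6 : p * ((n : ℝ) ^ 2 / r - n) ≤
      2 * (p * ((intE (canon r G) (Finset.univ : EdgeSetGraph n)).card : ℝ)) := by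
    have : (n : ℝ) ^ 2 / r - n ≤
      2 * ((intE (canon r G) (Finset.univ : EdgeSetGraph n)).card : ℝ) := by linarith
    nlinarith
  have e7 : p * ((n : ℝ) ^ 2 / r - n) = 2 * (N / (2 * r)) - n * p := by
    rw [hNdef]; field_simp
  have : 0 < N / q := by positivity
  linarith

lemma card_good_ge [NeZero r] (w : Window H r q n p C ν K) {κ η₀ : ℝ} (h2 : 2 ≤ Fintype.card V)
    (h1 : 2 ≤ (ed H).card) (hκ : 0 < κ) (hκK : 1 ≤ K * κ) (hη₀ : 0 < η₀)
    (hmono : ((oneMono r H).card : ℝ) ≤ κ * r ^ Fintype.card V) {G : EdgeSetGraph n}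
    (hT : Typ r p ((1 / (q : ℝ) ^ 30) ^ 2) G)
    (hZ : ¬ (n : ℝ) / q ^ 3 ≤ (unstable r (q ^ 4) G).card)
    (hN : ¬ (n : ℝ) ^ 2 * p * q ^ 3 ≤ nPairs H Finset.Nonempty G)
    (hO : ¬ (n : ℝ) ^ 2 * p / q ≤ nPairs H (fun F => 2 ≤ F.card ∧ F ≠ ed H) G)
    (hU : ¬ ∃ Z : Finset (Fin n), p ^ (ed H).card *
        ((Finset.univ : Finset (V ↪ Fin n)).filter fun ψ => ∃ w, ψ w ∈ Z).card +
        2 * (n ^ 2 * p / q) ≤ (nTouch H Z G : ℝ))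
    (hM : ∀ x ∈ ed H ×ˢ ed H, ¬ ∃ φ : Fin n → Fin r,
      p ^ ((ed H).card - 1) *
        ((Finset.univ : Finset (V ↪ Fin n)).filter (MonoAt H φ x.1 x.2)).card +
        2 * (n ^ 2 * lam H n p / q) ≤
        (cnt (fun ψ : V ↪ Fin n => im ((ed H).erase x.2) ψ)
          (Finset.univ.filter (MonoAt H φ x.1 x.2)) G : ℝ)) :
    n ^ 2 * p * (η₀ / (2 * r * (1 + η₀)) - 10 * K ^ 3 / q) ≤ ((Finset.univ.filter
      (GoodEdge r H (q ^ 4) ((1 + η₀) * (2 * r * κ * lam H n p / p)) G)).card : ℝ) := by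
  have hq := w.thousand_le
  have hqp : (0 : ℝ) < q := by linarith
  have hq1 : (1 : ℝ) ≤ q := by linarith
  have hn0 : (0 : ℝ) < n := by exact_mod_cast w.card_pos
  have h0 := w.pos
  have hl := w.lam_pos
  have hK := w.one_le
  have hr1 : 1 ≤ r := Nat.pos_of_ne_zero (NeZero.ne r)
  have hr : (0 : ℝ) < r := by exact_mod_cast hr1
  have hr1' : (1 : ℝ) ≤ r := by exact_mod_cast hr1
  set N := (n : ℝ) ^ 2 * p with hNdef
  have hN0 : 0 < N := by positivity
  set a := (1 + η₀) * (2 * r * κ * lam H n p / p) with ha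
  have ha0 : 0 < a := by positivity
  have hqnat : 0 < q ^ 4 := pow_pos (by exact_mod_cast hqp) 4
  have hmain := card_intE_le_card_good (r := r) H (q ^ 4) ha0 hqnat h1 G
  have hsum := w.sum_cnt_monoAt_le h2 hmono hT hM
  set S : ℕ := ∑ x ∈ ed H ×ˢ ed H, cnt (fun ψ : V ↪ Fin n => im ((ed H).erase x.2) ψ)
        (Finset.univ.filter (MonoAt H (canon r G) x.1 x.2)) G
  have hI := w.card_intE_ge hT
  have hh := w.card_ed_le
  have hh0 : (0 : ℝ) ≤ (ed H).card := Nat.cast_nonneg _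
  have b1 : (ed H).card * (nPairs H Finset.Nonempty G : ℝ) / (q ^ 4 : ℕ) ≤ K * (N / q) := by
    push_cast
    rw [div_le_iff₀ (by positivity)]
    calc (ed H).card * (nPairs H Finset.Nonempty G : ℝ) ≤ K * (N * q ^ 3) :=
          mul_le_mul hh (not_le.1 hN).le (Nat.cast_nonneg _) (by linarith)
      _ = K * (N / q) * q ^ 4 := by field_simp
  have b2 : (ed H).card * (nPairs H (fun F => 2 ≤ F.card ∧ F ≠ ed H) G : ℝ) ≤ K * (N / q) :=
    mul_le_mul hh (not_le.1 hO).le (Nat.cast_nonneg _) (by linarith)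
  have b3 : (nTouch H (unstable r (q ^ 4) G) G : ℝ) ≤ K ^ 2 * (N / q) + 2 * (N / q) := by
    push Not at hU
    refine (hU (unstable r (q ^ 4) G)).le.trans (add_le_add ?_ le_rfl)
    have hc := card_touch_embeddings_le (V := V) (unstable r (q ^ 4) G)
    have hc' : (((Finset.univ : Finset (V ↪ Fin n)).filter
        fun ψ => ∃ w, ψ w ∈ unstable r (q ^ 4) G).card : ℝ) ≤
        K * (n / q ^ 3 * (n : ℝ) ^ (Fintype.card V - 1)) := by
      refine hc.trans (mul_le_mul w.card_le ?_ (by positivity) (by linarith))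
      exact mul_le_mul_of_nonneg_right (not_le.1 hZ).le (by positivity)
    have e : (n : ℝ) * n ^ (Fintype.card V - 1) = n ^ Fintype.card V := by
      rw [← pow_succ']; congr 1; omega
    calc _ ≤ p ^ (ed H).card * (K * (n / q ^ 3 * (n : ℝ) ^ (Fintype.card V - 1))) :=
          mul_le_mul_of_nonneg_left hc' (by positivity)
      _ = K * ((n * (n : ℝ) ^ (Fintype.card V - 1)) * p ^ (ed H).card) / q ^ 3 := by ring
      _ = K * (N * lam H n p) / q ^ 3 := by rw [e, card_pow_eq h2 (by omega)]
      _ ≤ K * (N * (K * q)) / q ^ 3 := by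
          refine div_le_div_of_nonneg_right ?_ (by positivity)
          exact mul_le_mul_of_nonneg_left (mul_le_mul_of_nonneg_left w.lam_le hN0.le) (by linarith)
      _ = K ^ 2 * (N / q) / q := by field_simp
      _ ≤ K ^ 2 * (N / q) := div_le_self (by positivity) hq1
  have b3' : (ed H).card * (nTouch H (unstable r (q ^ 4) G) G : ℝ) ≤
      K * (K ^ 2 * (N / q) + 2 * (N / q)) :=
    mul_le_mul hh b3 (Nat.cast_nonneg _) (by linarith)
  have b4 : (S : ℝ) / a ≤ N / (2 * r * (1 + η₀)) + (1 + 2 * K ^ 3) * (N / q) := by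
    rw [div_le_iff₀ ha0]
    refine hsum.trans ?_
    have e1 : (N / (2 * r * (1 + η₀)) + (1 + 2 * K ^ 3) * (N / q)) * a =
        n ^ 2 * lam H n p * (κ + (2 * r * (1 + η₀)) * κ * (1 + 2 * K ^ 3) / q) := by
      rw [ha, hNdef]; field_simp
    rw [e1]
    refine mul_le_mul_of_nonneg_left ?_ (by positivity)
    have e2 : 1 ≤ 2 * r * (1 + η₀) := by nlinarith
    have e3 : K ^ 2 ≤ κ * K ^ 3 := by
      calc K ^ 2 = K ^ 2 * 1 := (mul_one _).symm
        _ ≤ K ^ 2 * (K * κ) := mul_le_mul_of_nonneg_left hκK (by positivity)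
        _ = κ * K ^ 3 := by ring
    have e4 : κ * (1 + 1 / q) + 2 * K ^ 2 / q = κ + (κ + 2 * K ^ 2) / q := by field_simp; ring
    rw [e4]
    refine add_le_add le_rfl (div_le_div_of_nonneg_right ?_ hqp.le)
    calc κ + 2 * K ^ 2 ≤ 1 * (κ * (1 + 2 * K ^ 3)) := by linarith
      _ ≤ (2 * r * (1 + η₀)) * (κ * (1 + 2 * K ^ 3)) :=
        mul_le_mul_of_nonneg_right e2 (by positivity)
      _ = 2 * r * (1 + η₀) * κ * (1 + 2 * K ^ 3) := by ring
  have hid : N / (2 * r) - N / (2 * r * (1 + η₀)) = N * (η₀ / (2 * r * (1 + η₀))) := by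
    field_simp; ring
  have hKK' : 3 + 4 * K + 3 * K ^ 3 ≤ 10 * K ^ 3 := by
    have : K ≤ K ^ 3 := le_self_pow₀ hK (by norm_num)
    have h13 : 1 ≤ K ^ 3 := one_le_pow₀ hK
    linarith
  have hq' := mul_le_mul_of_nonneg_right hKK' (by positivity : 0 ≤ N / q)
  have e8 : N * (η₀ / (2 * r * (1 + η₀)) - 10 * K ^ 3 / q) =
      N * (η₀ / (2 * r * (1 + η₀))) - 10 * K ^ 3 * (N / q) := by ring
  rw [e8]
  linarith

theorem Ex_bad_le [NeZero r] (w : Window H r q n p C ν K) {κ η₀ : ℝ} (h2 : 2 ≤ Fintype.card V)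
    (h1 : 2 ≤ (ed H).card) (hr : ¬ H.Colorable r) (hκ : 0 < κ) (hκK : 1 ≤ K * κ) (hη₀ : 0 < η₀)
    (hmono : ((oneMono r H).card : ℝ) ≤ κ * r ^ Fintype.card V)
    (hgap : 20 * K ^ 3 ≤ η₀ / (2 * r * (1 + η₀)) * q) :
    Ex p (fun G : EdgeSetGraph n => ind (Bad r H G)) ≤ 10 * K ^ 3 / q +
      q ^ 4 * Real.exp (p / (1 - p) * ((1 + η₀) * (2 * r * κ * lam H n p / p) /
        Nat.card (H ≃g H))) / (n ^ 2 * p * (η₀ / (4 * r * (1 + η₀)))) := by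
  have hq := w.thousand_le
  have hqp : (0 : ℝ) < q := by linarith
  have hq1 : (1 : ℝ) ≤ q := by linarith
  have hn0 : (0 : ℝ) < n := by exact_mod_cast w.card_pos
  have h0 := w.pos
  have hp1 := w.le_one
  have hK := w.one_le
  have hr0 : (0 : ℝ) < r := by exact_mod_cast Nat.pos_of_ne_zero (NeZero.ne r)
  have hplt : p < 1 := by
    have : (2 : ℝ) ≤ (q : ℝ) ^ 100 := le_trans (by linarith) (le_self_pow₀ hq1 (by norm_num))
    nlinarith [w.mul_le]
  set a := (1 + η₀) * (2 * r * κ * lam H n p / p) with ha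
  set η : ℝ := 1 / (q : ℝ) ^ 30 with hη
  set g := (n : ℝ) ^ 2 * p * (η₀ / (4 * r * (1 + η₀))) with hg
  have hg0 : 0 < g := by positivity
  set P1 : EdgeSetGraph n → Prop := fun G => ¬ Typ r p (η ^ 2) G
  set P2 : EdgeSetGraph n → Prop := fun G => Typ r p (η ^ 2) G ∧
    (n : ℝ) / q ^ 3 ≤ (unstable r (q ^ 4) G).card
  set P3 : EdgeSetGraph n → Prop := fun G => (n : ℝ) ^ 2 * p * q ^ 3 ≤
    nPairs H Finset.Nonempty G
  set P4 : EdgeSetGraph n → Prop := fun G => (n : ℝ) ^ 2 * p / q ≤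
    nPairs H (fun F => 2 ≤ F.card ∧ F ≠ ed H) G
  set P5 : EdgeSetGraph n → Prop := fun G => ∃ Z : Finset (Fin n), p ^ (ed H).card *
    ((Finset.univ : Finset (V ↪ Fin n)).filter fun ψ => ∃ w, ψ w ∈ Z).card +
    2 * (n ^ 2 * p / q) ≤ (nTouch H Z G : ℝ)
  set P6 : EdgeSetGraph n → Prop := fun G => ∃ x ∈ ed H ×ˢ ed H, ∃ φ : Fin n → Fin r,
      p ^ ((ed H).card - 1) *
        ((Finset.univ : Finset (V ↪ Fin n)).filter (MonoAt H φ x.1 x.2)).card +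
        2 * (n ^ 2 * lam H n p / q) ≤
        (cnt (fun ψ : V ↪ Fin n => im ((ed H).erase x.2) ψ)
          (Finset.univ.filter (MonoAt H φ x.1 x.2)) G : ℝ)
  set f : EdgeSetGraph n → ℝ := fun G => ((Finset.univ.filter fun e =>
      Bad r H G ∧ Typ r p (η ^ 2) G ∧ GoodEdge r H (q ^ 4) a G e).card : ℝ)
  have b1 : Ex p (fun G => ind (P1 G)) ≤ 1 / q := by
    refine (Ex_not_typ_le h0 hp1 w.large' w.le_exp w.le_mul).trans ?_
    exact one_div_le_one_div_of_le hqp (le_self_pow₀ hq1 (by norm_num))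
  have b2 : Ex p (fun G => ind (P2 G)) ≤ 1 / q :=
    Ex_unstable_le h0 w.card_pos w.large' w.anti w.le_exp w.le_mul w.mul_le
  have b3 : Ex p (fun G => ind (P3 G)) ≤ K ^ 3 / q := w.Ex_nPairs_nonempty_ge_le h2 (by omega)
  have b4 : Ex p (fun G => ind (P4 G)) ≤ K ^ 3 / q := w.Ex_nPairs_overlap_ge_le h2 (by omega)
  have b5 : Ex p (fun G => ind (P5 G)) ≤ 3 / q := w.Ex_nTouch_le h2 (by omega)
  have b6 : Ex p (fun G => ind (P6 G)) ≤ K ^ 2 * (3 / q) := by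
    refine (Ex_ind_exists_le h0.le hp1 (ed H ×ˢ ed H) _).trans ?_
    refine (Finset.sum_le_sum fun x hx =>
      w.Ex_monoAt_le h2 h1 x.1 x.2 (Finset.mem_product.1 hx).2).trans ?_
    rw [Finset.sum_const, Finset.card_product, nsmul_eq_mul]
    refine mul_le_mul_of_nonneg_right ?_ (by positivity)
    push_cast; rw [sq]
    exact mul_le_mul w.card_ed_le w.card_ed_le (Nat.cast_nonneg _) (by linarith)
  have b7 : Ex p (fun G => ind (g ≤ f G)) ≤
      q ^ 4 * Real.exp (p / (1 - p) * (a / Nat.card (H ≃g H))) / g := by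
    refine (Ex_markov h0.le hp1 (f := f) (fun G => Nat.cast_nonneg _) hg0).trans ?_
    refine div_le_div_of_nonneg_right ?_ hg0.le
    have := Ex_card_good_le (H := H) (r := r) (n := n) (L := q ^ 4) (a := a) (η := η) w.card_pos h1
      hr h0 hplt (by positivity) (by
        rw [hη]
        calc 4 * (1 / (q : ℝ) ^ 30) * r = 4 * r / (q : ℝ) ^ 30 := by ring
          _ ≤ 1 := by
            rw [div_le_one (by positivity)]
            refine le_trans ?_ (le_self_pow₀ hq1 (n := 30) (by norm_num))
            linarith [w.large']) w.two_mul_div_add_le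
    push_cast at this
    exact this
  have hcover : ∀ G, Bad r H G →
      (P1 G ∨ P2 G ∨ P3 G ∨ P4 G ∨ P5 G ∨ P6 G ∨ g ≤ f G) := by
    intro G hB
    by_contra hcon
    simp only [not_or] at hcon
    obtain ⟨c1, c2, c3, c4, c5, c6, c7⟩ := hcon
    have hT : Typ r p (η ^ 2) G := not_not.1 c1
    have hgood := w.card_good_ge h2 h1 hκ hκK hη₀ hmono hT (fun h => c2 ⟨hT, h⟩) c3 c4 c5
      (fun x hx hφ => c6 ⟨x, hx, hφ⟩)
    have hf : f G = ((Finset.univ.filter (GoodEdge r H (q ^ 4) a G)).card : ℝ) := by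
      change ((Finset.univ.filter fun e =>
        Bad r H G ∧ Typ r p (η ^ 2) G ∧ GoodEdge r H (q ^ 4) a G e).card : ℝ) = _
      congr 2
      ext e
      simp only [Finset.mem_filter, Finset.mem_univ, true_and, hB, hT]
    refine c7 ?_
    rw [hf]
    refine le_trans ?_ hgood
    refine mul_le_mul_of_nonneg_left ?_ (by positivity)
    have e1 : 10 * K ^ 3 / q ≤ η₀ / (4 * r * (1 + η₀)) := by
      rw [div_le_iff₀ hqp]
      have : η₀ / (2 * r * (1 + η₀)) * q = 2 * (η₀ / (4 * r * (1 + η₀)) * q) := by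
        field_simp; norm_num
      linarith
    have e2 : η₀ / (2 * r * (1 + η₀)) = 2 * (η₀ / (4 * r * (1 + η₀))) := by field_simp; norm_num
    linarith
  have hor := Ex_ind_or_le (E := EdgeType n) h0.le hp1
  have htotal : Ex p (fun G : EdgeSetGraph n => ind (Bad r H G)) ≤
      1 / q + (1 / q + (K ^ 3 / q + (K ^ 3 / q + (3 / q + (K ^ 2 * (3 / q) +
        q ^ 4 * Real.exp (p / (1 - p) * (a / Nat.card (H ≃g H))) / g))))) := by
    refine (Ex_mono h0.le hp1 fun G => ind_mono (hcover G)).trans ?_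
    refine (hor _ _).trans (add_le_add b1 ?_)
    refine (hor _ _).trans (add_le_add b2 ?_)
    refine (hor _ _).trans (add_le_add b3 ?_)
    refine (hor _ _).trans (add_le_add b4 ?_)
    refine (hor _ _).trans (add_le_add b5 ?_)
    exact (hor _ _).trans (add_le_add b6 b7)
  refine htotal.trans ?_
  have hKK : 5 + 2 * K ^ 3 + 3 * K ^ 2 ≤ 10 * K ^ 3 := by
    have : K ^ 2 ≤ K ^ 3 := pow_le_pow_right₀ hK (by norm_num)
    have h13 : 1 ≤ K ^ 3 := one_le_pow₀ hK
    linarith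
  have := div_le_div_of_nonneg_right hKK hqp.le
  have e : (5 + 2 * K ^ 3 + 3 * K ^ 2) / (q : ℝ) =
      1 / q + (1 / q + (K ^ 3 / q + (K ^ 3 / q + (3 / q + K ^ 2 * (3 / q))))) := by ring
  linarith

end Window

end Final

section Asymptotic

variable {V : Type} [Fintype V] {H : SimpleGraph V} {n r : ℕ} {p : ℝ}

lemma lam_le_of_le (hnon : ¬ H.Colorable 2) (hbal : StrictlyTwoBalanced H) (hn : 1 ≤ n)
    (h0 : 0 ≤ p) {y : ℝ} (hp : p ≤ y * (n : ℝ) ^ (-(1 / m2 H))) :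
    lam H n p ≤ y ^ ((ed H).card - 1) := by
  have hn0 : (0 : ℝ) < n := by exact_mod_cast hn
  have hm := one_lt_m2 hnon hbal
  have hv := three_le_card_of_not_colorable hnon
  have hh := three_le_card_ed hnon
  have hmul := m2_mul hnon hbal
  have e : (n : ℝ) ^ (Fintype.card V - 2) *
      ((n : ℝ) ^ (-(1 / m2 H))) ^ ((ed H).card - 1) = 1 := by
    rw [← Real.rpow_natCast, ← Real.rpow_natCast, ← Real.rpow_mul hn0.le, ← Real.rpow_add hn0]
    have : ((Fintype.card V - 2 : ℕ) : ℝ) + -(1 / m2 H) * (((ed H).card - 1 : ℕ) : ℝ) = 0 := by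
      rw [Nat.cast_sub (by omega), Nat.cast_sub (by omega)]
      push_cast
      rw [← hmul]
      field_simp
      ring
    rw [this, Real.rpow_zero]
  calc lam H n p ≤ (n : ℝ) ^ (Fintype.card V - 2) *
        (y * (n : ℝ) ^ (-(1 / m2 H))) ^ ((ed H).card - 1) :=
        mul_le_mul_of_nonneg_left (pow_le_pow_left₀ h0 hp _) (by positivity)
    _ = y ^ ((ed H).card - 1) * ((n : ℝ) ^ (Fintype.card V - 2) *
      ((n : ℝ) ^ (-(1 / m2 H))) ^ ((ed H).card - 1)) := by rw [mul_pow]; ring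
    _ = _ := by rw [e, mul_one]

lemma tendsto_ceil_log : Tendsto (fun n : ℕ => ((⌈Real.log n⌉₊ : ℕ) : ℝ)) atTop atTop :=
  tendsto_atTop_mono (fun _ => Nat.le_ceil _)
    (Real.tendsto_log_atTop.comp tendsto_natCast_atTop_atTop)

lemma tendsto_ceil_log_pow_div (k : ℕ) {s : ℝ} (hs : 0 < s) :
    Tendsto (fun n : ℕ => ((⌈Real.log n⌉₊ : ℕ) : ℝ) ^ k / (n : ℝ) ^ s) atTop (nhds 0) := by
  have h1 := (isLittleO_log_rpow_rpow_atTop (k : ℝ) hs).tendsto_div_nhds_zero.comp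
    tendsto_natCast_atTop_atTop
  have h2 : Tendsto (fun n : ℕ => (2 : ℝ) ^ k * (Real.log n ^ (k : ℝ) / (n : ℝ) ^ s)) atTop
      (nhds 0) := by
    simpa using h1.const_mul ((2 : ℝ) ^ k)
  refine squeeze_zero' (Eventually.of_forall fun n => by positivity) ?_ h2
  filter_upwards [(Real.tendsto_log_atTop.comp tendsto_natCast_atTop_atTop).eventually_ge_atTop 1]
    with n hn
  have hl : 1 ≤ Real.log n := hn
  have h3 : ((⌈Real.log n⌉₊ : ℕ) : ℝ) ≤ 2 * Real.log n := by
    linarith [Nat.ceil_lt_add_one (a := Real.log n) (by linarith)]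
  rw [Real.rpow_natCast, ← mul_div_assoc, ← mul_pow]
  exact div_le_div_of_nonneg_right (pow_le_pow_left₀ (Nat.cast_nonneg _) h3 _) (by positivity)

lemma exists_pos_of_lt_one {ρ : ℝ} (h0 : 0 ≤ ρ) (h1 : ρ < 1) :
    ∃ η > 0, (1 + η) ^ 2 * ρ ≤ (1 + ρ) / 2 := by
  refine ⟨(1 - ρ) / 6, by linarith, ?_⟩
  have h2 : (1 + (1 - ρ) / 6) ^ 2 ≤ 1 + (1 - ρ) / 2 := by nlinarith
  nlinarith

/-- In the sparse regime the edges of `G` vastly outnumber the copies of `H`. -/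
lemma eventually_Ex_bad_le_sparse [NeZero r] (hnon : ¬ H.Colorable 2)
    (hbal : StrictlyTwoBalanced H) {δ : ℝ} (hδ : 0 < δ) :
    ∃ c : ℝ, 0 < c ∧ c ≤ 1 ∧ ∃ M : ℝ, ∀ᶠ n : ℕ in atTop, ∀ p : ℝ, 0 < p → p ≤ 1 → M ≤ n * p →
      p ≤ c * (n : ℝ) ^ (-(1 / m2 H)) →
      Ex p (fun G : EdgeSetGraph n => ind (Bad r H G)) ≤ δ := by
  have hr : (0 : ℝ) < r := by exact_mod_cast Nat.pos_of_ne_zero (NeZero.ne r)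
  have hv := three_le_card_of_not_colorable hnon
  have hh := three_le_card_ed hnon
  refine ⟨min 1 (δ / (16 * r)), by positivity, min_le_left _ _, 256 * r ^ 2 * (r + 1), ?_⟩
  have ht : Tendsto (fun n : ℕ => Real.exp (-(n : ℝ))) atTop (nhds 0) :=
    Real.tendsto_exp_neg_atTop_nhds_zero.comp tendsto_natCast_atTop_atTop
  filter_upwards [ht.eventually_le_const (half_pos hδ), eventually_ge_atTop (2 * r),
    eventually_ge_atTop 1] with n hn1 hn2 hn3 p h0 h1 hM hp
  have hn0 : (0 : ℝ) < n := by exact_mod_cast hn3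
  refine (Ex_bad_le_sparse h0 h1 hn2 (by omega) (by omega)).trans ?_
  have e1 : (r : ℝ) ^ n * Real.exp (-(n ^ 2 * p / (256 * r ^ 2))) ≤ Real.exp (-(n : ℝ)) := by
    have e2 : (r : ℝ) ^ n ≤ Real.exp (n * r) := by
      rw [Real.exp_nat_mul]
      exact pow_le_pow_left₀ hr.le (by linarith [Real.add_one_le_exp (r : ℝ)]) n
    refine (mul_le_mul_of_nonneg_right e2 (Real.exp_pos _).le).trans ?_
    rw [← Real.exp_add]
    refine Real.exp_le_exp.2 ?_
    have e3 : (n : ℝ) * (r + 1) ≤ n ^ 2 * p / (256 * r ^ 2) := by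
      rw [le_div_iff₀ (by positivity)]
      calc (n : ℝ) * (r + 1) * (256 * r ^ 2) = n * (256 * r ^ 2 * (r + 1)) := by ring
        _ ≤ n * (n * p) := mul_le_mul_of_nonneg_left hM hn0.le
        _ = n ^ 2 * p := by ring
    linarith
  have e4 := lam_le_of_le hnon hbal hn3 h0.le hp
  set c := min 1 (δ / (16 * r)) with hc
  have hc0 : 0 < c := by rw [hc]; positivity
  have e5 : c ^ ((ed H).card - 1) ≤ c :=
    pow_le_of_le_one hc0.le (min_le_left _ _) (by omega)
  have e6 : 8 * r * lam H n p ≤ δ / 2 := by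
    calc 8 * r * lam H n p ≤ 8 * r * (δ / (16 * r)) :=
          mul_le_mul_of_nonneg_left ((e4.trans e5).trans (min_le_right _ _)) (by positivity)
      _ = δ / 2 := by field_simp; norm_num
  change _ + 8 * r * lam H n p ≤ δ
  linarith

set_option maxHeartbeats 4000000 in
/-- In the dense regime the switching argument applies. -/
lemma eventually_Ex_bad_le_dense [NeZero r] (hnon : ¬ H.Colorable 2)
    (hbal : StrictlyTwoBalanced H) (hcol : ¬ H.Colorable r) {piH : ℝ} (hpiH : 0 < piH)
    (hmono : 2 * ((oneMono r H).card : ℝ) ≤ r * (Nat.card (H ≃g H) * piH))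
    {θ ϑ : ℝ} (hϑ0 : 0 < ϑ) (hϑ : ϑ < θ)
    (hθ : (r : ℝ) ^ 2 / r ^ Fintype.card V * piH * θ ^ ((ed H).card - 1) = 2 - 1 / m2 H)
    {c δ : ℝ} (hc0 : 0 < c) (hc1 : c ≤ 1) (hδ : 0 < δ) :
    ∀ᶠ n : ℕ in atTop, ∀ p : ℝ, c * (n : ℝ) ^ (-(1 / m2 H)) ≤ p →
      p ≤ ϑ * Real.log n ^ ((1 : ℝ) / (((ed H).card : ℝ) - 1)) * (n : ℝ) ^ (-(1 / m2 H)) →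
      Ex p (fun G : EdgeSetGraph n => ind (Bad r H G)) ≤ δ := by
  have hr : (0 : ℝ) < r := by exact_mod_cast Nat.pos_of_ne_zero (NeZero.ne r)
  have hv := three_le_card_of_not_colorable hnon
  have hh := three_le_card_ed hnon
  have hm := one_lt_m2 hnon hbal
  have hm0 : 0 < m2 H := by linarith
  obtain ⟨γ, hγ0, hγ⟩ := exists_density_gap hbal
  have hα : (0 : ℝ) < Nat.card (H ≃g H) := by
    have : Nonempty (H ≃g H) := ⟨RelIso.refl _⟩
    have : Finite (H ≃g H) := Finite.of_injective (fun f : H ≃g H => (f : V → V))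
      DFunLike.coe_injective
    exact_mod_cast Nat.card_pos
  set α : ℝ := (Nat.card (H ≃g H) : ℝ) with hαdef
  have hθ0 : 0 < θ := hϑ0.trans hϑ
  set ρ := (ϑ / θ) ^ ((ed H).card - 1) with hρ
  have hρ0 : 0 ≤ ρ := by positivity
  have hρ1 : ρ < 1 := pow_lt_one₀ (by positivity) ((div_lt_one hθ0).2 hϑ) (by omega)
  obtain ⟨η, hη0, hη⟩ := exists_pos_of_lt_one hρ0 hρ1
  set κ := r * (α * piH) / 2 / r ^ Fintype.card V with hκdef
  have hκ : 0 < κ := by positivity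
  have hmono' : ((oneMono r H).card : ℝ) ≤ κ * r ^ Fintype.card V := by
    rw [hκdef, div_mul_cancel₀ _ (by positivity)]
    linarith
  set C := 1 / c ^ (ed H).card with hC
  have hC0 : 0 < C := by positivity
  have hovl := ovl_nonneg H
  set K := 1 + (ed H).card + Fintype.card V + r + ovl H * C + C + ϑ ^ ((ed H).card - 1) + 1 / κ
    with hK
  have a1 : 0 ≤ ovl H * C := mul_nonneg hovl hC0.le
  have a2 : 0 < ϑ ^ ((ed H).card - 1) := by positivity
  have a3 : 0 < 1 / κ := by positivity
  have a4 : (0 : ℝ) ≤ (ed H).card := Nat.cast_nonneg _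
  have a5 : (0 : ℝ) ≤ Fintype.card V := Nat.cast_nonneg _
  set β := η / (2 * r * (1 + η)) with hβ
  have hβ0 : 0 < β := by positivity
  have hβ' : η / (4 * r * (1 + η)) = β / 2 := by rw [hβ]; field_simp; norm_num
  have hm' : 0 < 2 - 1 / m2 H := by
    have : 1 / m2 H < 1 := by rw [div_lt_one hm0]; exact hm
    linarith
  have hm'' : 0 < 1 - 1 / m2 H := by
    have : 1 / m2 H < 1 := by rw [div_lt_one hm0]; exact hm
    linarith
  set s := (2 - 1 / m2 H) * (1 - (1 + ρ) / 2) with hs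
  have hs0 : 0 < s := mul_pos hm' (by linarith)
  have hanti : 0 < 1 - Real.exp (-(1 / (2 * (r : ℝ)) / 10)) := by
    have : Real.exp (-(1 / (2 * (r : ℝ)) / 10)) < 1 := Real.exp_lt_one_iff.2 (by
      have : 0 < 1 / (2 * (r : ℝ)) / 10 := by positivity
      linarith)
    linarith
  filter_upwards [eventually_ge_atTop 3,
    tendsto_ceil_log.eventually_ge_atTop (1000 * K ^ 3 * ((r : ℝ) + 1)),
    tendsto_ceil_log.eventually_ge_atTop (5 / (1 - Real.exp (-(1 / (2 * (r : ℝ)) / 10)))),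
    tendsto_ceil_log.eventually_ge_atTop ((1 + η) / η),
    tendsto_ceil_log.eventually_ge_atTop (20 * K ^ 3 / β),
    tendsto_ceil_log.eventually_ge_atTop (10 * K ^ 3 / (δ / 2)),
    (tendsto_ceil_log_pow_div 400 hm'').eventually_le_const hc0,
    (tendsto_ceil_log_pow_div 101 (s := 1 / m2 H) (by positivity)).eventually_le_const
      (show 0 < 1 / ϑ by positivity),
    (tendsto_ceil_log_pow_div 100 (s := γ / m2 H) (by positivity)).eventually_le_const one_pos,
    (tendsto_ceil_log_pow_div 4 hs0).eventually_le_const (show 0 < δ / 2 * (c * (β / 2)) by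
      positivity)]
    with n hn3 f1 f2 f3 f4 f5 f6 f7 f8 f9 p hpc hpu
  set q := ⌈Real.log n⌉₊ with hq
  have hn1 : 1 ≤ n := by omega
  have hn0 : (0 : ℝ) < n := by exact_mod_cast hn1
  have h0 : 0 < p := lt_of_lt_of_le (by positivity) hpc
  have hl0 : 0 ≤ Real.log n := Real.log_natCast_nonneg n
  have hlq : Real.log n ≤ q := Nat.le_ceil _
  have hK1 : 1 ≤ K := by rw [hK]; linarith
  have hK3 : 1 ≤ K ^ 3 := one_le_pow₀ hK1
  have hq1 : (1 : ℝ) ≤ q := by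
    refine le_trans ?_ f1
    calc (1 : ℝ) ≤ 1000 * 1 * 1 := by norm_num
      _ ≤ 1000 * K ^ 3 * ((r : ℝ) + 1) :=
        mul_le_mul (by linarith) (by linarith) zero_le_one (by positivity)
  have hqp : (0 : ℝ) < q := by linarith
  have hexpo : (1 : ℝ) / (((ed H).card : ℝ) - 1) = (((ed H).card - 1 : ℕ) : ℝ)⁻¹ := by
    rw [Nat.cast_sub (by omega), one_div, Nat.cast_one]
  have hlam : lam H n p ≤ ϑ ^ ((ed H).card - 1) * Real.log n := by
    refine (lam_le_of_le hnon hbal hn1 h0.le hpu).trans (le_of_eq ?_)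
    rw [mul_pow, hexpo, Real.rpow_inv_natCast_pow hl0 (by omega)]
  have hpq : p ≤ ϑ * q * (n : ℝ) ^ (-(1 / m2 H)) := by
    refine hpu.trans (mul_le_mul_of_nonneg_right (mul_le_mul_of_nonneg_left ?_ hϑ0.le)
      (by positivity))
    rw [hexpo]
    calc Real.log n ^ ((((ed H).card - 1 : ℕ) : ℝ)⁻¹) ≤ (q : ℝ) ^ ((((ed H).card - 1 : ℕ) : ℝ)⁻¹) :=
          Real.rpow_le_rpow hl0 hlq (by positivity)
      _ ≤ (q : ℝ) ^ (1 : ℝ) := by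
          refine Real.rpow_le_rpow_of_exponent_le hq1 (inv_le_one_of_one_le₀ ?_)
          exact_mod_cast (by omega : 1 ≤ (ed H).card - 1)
      _ = q := Real.rpow_one _
  have hpm : p * (q : ℝ) ^ 100 ≤ 1 := by
    rw [div_le_iff₀ (by positivity)] at f7
    calc p * (q : ℝ) ^ 100 ≤ ϑ * q * (n : ℝ) ^ (-(1 / m2 H)) * q ^ 100 :=
          mul_le_mul_of_nonneg_right hpq (by positivity)
      _ = ϑ * q ^ 101 * (n : ℝ) ^ (-(1 / m2 H)) := by ring
      _ ≤ ϑ * (1 / ϑ * (n : ℝ) ^ (1 / m2 H)) * (n : ℝ) ^ (-(1 / m2 H)) :=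
          mul_le_mul_of_nonneg_right (mul_le_mul_of_nonneg_left f7 hϑ0.le) (by positivity)
      _ = (n : ℝ) ^ (1 / m2 H) * (n : ℝ) ^ (-(1 / m2 H)) := by field_simp
      _ = 1 := by rw [← Real.rpow_add hn0, add_neg_cancel, Real.rpow_zero]
  have hnpc : c * (n : ℝ) ^ (1 - 1 / m2 H) ≤ n * p := by
    calc c * (n : ℝ) ^ (1 - 1 / m2 H) = n * (c * (n : ℝ) ^ (-(1 / m2 H))) := by
          rw [sub_eq_add_neg, Real.rpow_add hn0, Real.rpow_one]; ring
      _ ≤ n * p := mul_le_mul_of_nonneg_left hpc hn0.le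
  have w : Window H r q n p C ((n : ℝ) ^ (γ / m2 H)) K :=
    { pos := h0
      const_nonneg := hC0.le
      rooted := ext_of_rpow hnon hbal hγ hn1 hc0 hc1 hpc
      one_le := hK1
      card_ed_le := by rw [hK]; linarith
      card_le := by rw [hK]; linarith
      parts_le := by rw [hK]; linarith
      ovl_le := by rw [hK]; linarith
      const_le := by rw [hK]; linarith
      lam_le := by
        refine hlam.trans (mul_le_mul ?_ hlq hl0 (by linarith))
        rw [hK]; linarith
      large := f1
      anti := (div_le_iff₀' hanti).1 f2
      le_exp := by
        calc (n : ℝ) = Real.exp (Real.log n) := (Real.exp_log hn0).symm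
          _ ≤ Real.exp q := Real.exp_le_exp.2 hlq
      le_mul := by
        rw [div_le_iff₀ (by positivity)] at f6
        exact f6.trans hnpc
      mul_le := hpm
      le_gap := by
        rwa [div_le_iff₀ (by positivity), one_mul] at f8 }
  have hκK : 1 ≤ K * κ := by
    rw [← div_le_iff₀ hκ, hK]; linarith
  refine (w.Ex_bad_le (κ := κ) (η₀ := η) (by omega) (by omega) hcol hκ hκK hη0 hmono'
    ((div_le_iff₀' hβ0).1 f4)).trans ?_
  have g1 : 10 * K ^ 3 / q ≤ δ / 2 := by
    rw [div_le_iff₀ (by positivity)] at f5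
    rw [div_le_iff₀ hqp]; linarith only [f5]
  have hpq1 : p * q ≤ 1 :=
    (mul_le_mul_of_nonneg_left (le_self_pow₀ hq1 (by norm_num)) h0.le).trans hpm
  have hp1' : 0 < 1 - p := by
    have b1 : p * 1000 ≤ p * q := mul_le_mul_of_nonneg_left w.thousand_le h0.le
    linarith only [b1, hpq1]
  have hp1 : 1 / (1 - p) ≤ 1 + η := by
    rw [div_le_iff₀ hη0] at f3
    have b2 : p * (1 + η) ≤ η := by
      calc p * (1 + η) ≤ p * (q * η) := mul_le_mul_of_nonneg_left f3 h0.le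
        _ = p * q * η := by ring
        _ ≤ 1 * η := mul_le_mul_of_nonneg_right hpq1 hη0.le
        _ = η := one_mul _
    rw [div_le_iff₀ hp1']
    linarith only [b2]
  have hτ : (r : ℝ) ^ 2 / r ^ Fintype.card V * piH * ϑ ^ ((ed H).card - 1) =
      (2 - 1 / m2 H) * ρ := by
    rw [← hθ, hρ, div_pow]
    field_simp
  have hexp : p / (1 - p) * ((1 + η) * (2 * r * κ * lam H n p / p) / α) ≤
      (2 - 1 / m2 H) * ((1 + ρ) / 2) * Real.log n := by
    have e1 : p / (1 - p) * ((1 + η) * (2 * r * κ * lam H n p / p) / α) =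
        (1 + η) * (1 / (1 - p)) * ((r : ℝ) ^ 2 / r ^ Fintype.card V * piH * lam H n p) := by
      rw [hκdef]; field_simp
    have e2 : (r : ℝ) ^ 2 / r ^ Fintype.card V * piH * lam H n p ≤
        (2 - 1 / m2 H) * ρ * Real.log n := by
      rw [← hτ, mul_assoc _ (ϑ ^ ((ed H).card - 1)) _]
      exact mul_le_mul_of_nonneg_left hlam (by positivity)
    rw [e1]
    calc (1 + η) * (1 / (1 - p)) * ((r : ℝ) ^ 2 / r ^ Fintype.card V * piH * lam H n p)
        ≤ (1 + η) * (1 + η) * ((2 - 1 / m2 H) * ρ * Real.log n) := by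
          refine mul_le_mul (mul_le_mul_of_nonneg_left hp1 (by linarith)) e2 ?_ (by positivity)
          have := w.lam_pos
          positivity
      _ = ((1 + η) ^ 2 * ρ) * ((2 - 1 / m2 H) * Real.log n) := by ring
      _ ≤ ((1 + ρ) / 2) * ((2 - 1 / m2 H) * Real.log n) :=
          mul_le_mul_of_nonneg_right hη (mul_nonneg hm'.le hl0)
      _ = _ := by ring
  have hexp' : Real.exp (p / (1 - p) * ((1 + η) * (2 * r * κ * lam H n p / p) / α)) ≤
      (n : ℝ) ^ ((2 - 1 / m2 H) - s) := by
    rw [Real.rpow_def_of_pos hn0]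
    refine Real.exp_le_exp.2 (hexp.trans (le_of_eq ?_))
    rw [hs]; ring
  have hden : c * (n : ℝ) ^ (2 - 1 / m2 H) ≤ n ^ 2 * p := by
    calc c * (n : ℝ) ^ (2 - 1 / m2 H) = n ^ 2 * (c * (n : ℝ) ^ (-(1 / m2 H))) := by
          rw [sub_eq_add_neg, Real.rpow_add hn0, Real.rpow_two]; ring
      _ ≤ n ^ 2 * p := mul_le_mul_of_nonneg_left hpc (by positivity)
  have g2 : (q : ℝ) ^ 4 * Real.exp (p / (1 - p) * ((1 + η) * (2 * r * κ * lam H n p / p) / α)) /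
      (n ^ 2 * p * (η / (4 * r * (1 + η)))) ≤ δ / 2 := by
    rw [hβ', div_le_iff₀ (by positivity)]
    rw [div_le_iff₀ (by positivity)] at f9
    calc (q : ℝ) ^ 4 * Real.exp (p / (1 - p) * ((1 + η) * (2 * r * κ * lam H n p / p) / α))
        ≤ (δ / 2 * (c * (β / 2)) * (n : ℝ) ^ s) * (n : ℝ) ^ ((2 - 1 / m2 H) - s) :=
          mul_le_mul f9 hexp' (Real.exp_pos _).le (by positivity)
      _ = δ / 2 * (c * ((n : ℝ) ^ s * (n : ℝ) ^ ((2 - 1 / m2 H) - s)) * (β / 2)) := by ring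
      _ = δ / 2 * (c * (n : ℝ) ^ (2 - 1 / m2 H) * (β / 2)) := by
          rw [← Real.rpow_add hn0, add_sub_cancel]
      _ ≤ δ / 2 * (n ^ 2 * p * (β / 2)) := by
          refine mul_le_mul_of_nonneg_left ?_ (by positivity)
          exact mul_le_mul_of_nonneg_right hden (by positivity)
  linarith only [g1, g2]

end Asymptotic

/-- If `H` is a nonbipartite, edge-critical, strictly 2-balanced graph and
`1/n ≪ p ≤ (θ_H - ε) n^{-1/m₂(H)} (log n)^{1/(e_H-1)}`, then whp `G_{n,p}` is not
`H`-Simonovits: it has a largest `H`-free subgraph that is not `(χ(H)-1)`-partite. -/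
theorem whp_not_Simonovits
    {V : Type} [Fintype V] (H : SimpleGraph V)
    (hnonbip : ¬ H.Colorable 2)
    (hcrit : ∃ e ∈ H.edgeSet, (H.deleteEdges {e}).chromaticNumber + 1 = H.chromaticNumber)
    (hbal : StrictlyTwoBalanced H)
    (r : ℕ) (hchrom : H.chromaticNumber = (r + 1 : ℕ))
    (piH : ℝ) (hpiH : 0 < piH)
    (hpi : Tendsto (fun m : ℕ =>
        (copCount H (KrmPlus r m) : ℝ) / (m : ℝ) ^ (Fintype.card V - 2))
      atTop (nhds piH))
    (θH : ℝ) (hθpos : 0 < θH)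
    (hθ : (r : ℝ) ^ ((2 : ℤ) - (Fintype.card V : ℤ)) * piH * θH ^ (H.edgeSet.ncard - 1) =
      2 - 1 / m2 H)
    (ε : ℝ) (hε : 0 < ε)
    (p : ℕ → ℝ) (hp0 : ∀ n, 0 ≤ p n) (hp1 : ∀ n, p n ≤ 1)
    (hnp : Tendsto (fun n : ℕ => (n : ℝ) * p n) atTop atTop)
    (hpu : ∀ n : ℕ, 2 ≤ n →
      p n ≤ (θH - ε) * (n : ℝ) ^ (-(1 / m2 H)) *
        Real.log n ^ ((1 : ℝ) / ((H.edgeSet.ncard : ℝ) - 1))) :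
    Tendsto (fun n : ℕ => prGnp n (p n) fun G =>
        ∃ F ⊆ G, HFree H F ∧ (∀ F' ⊆ G, HFree H F' → F'.card ≤ F.card) ∧ ¬ IsRPartite r F)
      atTop (nhds 1) := by
  have hcol := not_colorable_of_chromaticNumber hchrom
  have hr2 : 2 ≤ r := by
    by_contra h
    have h1 : H.Colorable (r + 1) := SimpleGraph.chromaticNumber_le_iff_colorable.1 hchrom.le
    exact hnonbip (h1.mono (by omega))
  have : NeZero r := ⟨by omega⟩
  have hr : (r : ℝ) ≠ 0 := by exact_mod_cast NeZero.ne r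
  rw [← card_ed, zpow_sub₀ hr, zpow_natCast, show (r : ℝ) ^ (2 : ℤ) = (r : ℝ) ^ 2 from
    zpow_ofNat _ 2] at hθ
  rw [← card_ed] at hpu
  have hpos : ∀ᶠ n : ℕ in atTop, 0 < p n := by
    filter_upwards [hnp.eventually_gt_atTop 0] with n hn
    exact pos_of_mul_pos_right hn (Nat.cast_nonneg n)
  have hϑ : 0 < θH - ε := by
    by_contra! h
    obtain ⟨n, hn, hn2⟩ := (hpos.and (eventually_ge_atTop 2)).exists
    refine absurd (hpu n hn2) (not_le.2 (lt_of_le_of_lt ?_ hn))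
    refine mul_nonpos_of_nonpos_of_nonneg (mul_nonpos_of_nonpos_of_nonneg h (by positivity)) ?_
    exact Real.rpow_nonneg (Real.log_natCast_nonneg n) _
  have hsmall : ∀ δ > 0, ∀ᶠ n : ℕ in atTop,
      Ex (p n) (fun G : EdgeSetGraph n => ind (Bad r H G)) ≤ δ := by
    intro δ hδ
    obtain ⟨c, hc0, hc1, M, hM⟩ := eventually_Ex_bad_le_sparse (r := r) hnonbip hbal hδ
    filter_upwards [hM, hpos, hnp.eventually_ge_atTop M, eventually_ge_atTop 2,
      eventually_Ex_bad_le_dense hnonbip hbal hcol hpiH (card_oneMono_le_piH H hpi) hϑ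
        (sub_lt_self θH hε) hθ hc0 hc1 hδ] with n h1 h2 h3 h4 h5
    rcases le_total (p n) (c * (n : ℝ) ^ (-(1 / m2 H))) with h | h
    · exact h1 _ h2 (hp1 n) h3 h
    · exact h5 _ h ((hpu n h4).trans (le_of_eq (mul_right_comm _ _ _)))
  have hcompl : ∀ n, (prGnp n (p n) fun G =>
      ∃ F ⊆ G, HFree H F ∧ (∀ F' ⊆ G, HFree H F' → F'.card ≤ F.card) ∧ ¬ IsRPartite r F) =
      1 - Ex (p n) (fun G : EdgeSetGraph n => ind (Bad r H G)) := by
    intro n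
    have e := Ex_sub (p := p n) (fun _ : EdgeSetGraph n => 1) (fun G => ind (Bad r H G))
    rw [Ex_const] at e
    rw [prGnp_eq_Ex, ← e]
    congr 1
    funext G
    by_cases h : Bad r H G
    · rw [ind_of h, ind_not, sub_self]
      rintro ⟨F, hF, h1, h2, h3⟩
      exact h3 (h F hF h1 h2)
    · rw [ind_not h, ind_of, sub_zero]
      unfold Bad at h
      push Not at h
      exact h
  simp only [hcompl]
  have h0 : Tendsto (fun n => Ex (p n) (fun G : EdgeSetGraph n => ind (Bad r H G))) atTop
      (nhds 0) := by
    refine Metric.tendsto_atTop.2 fun δ hδ => ?_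
    obtain ⟨N, hN⟩ := eventually_atTop.1 (hsmall (δ / 2) (half_pos hδ))
    refine ⟨N, fun n hn => ?_⟩
    rw [Real.dist_0_eq_abs, abs_of_nonneg (Ex_nonneg (hp0 n) (hp1 n) fun G => ind_nonneg _)]
    exact (hN n hn).trans_lt (half_lt_self hδ)
  simpa using h0.const_sub 1

end
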